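/- Fix a k-element set H of distinct nonnegative integers, integers l_1, l_2 ≥ 0, an element h_0 ∈ H, and ε > 0, and assume the primes have distribution level ϑ. If R = R(N) satisfies R ≤ N^{(ϑ−ε)/2} and R → ∞ as N → ∞, then (1/N) Σ_{N ≤ n < 2N} Λ_R(n; H, l_1) Λ_R(n; H, l_2) θ(n + h_0) = (𝔖(H) + o(1)) · binom(l_1+l_2+2, l_1+1) · (log R)^{k+l_1+l_2+1}/(k+l_1+l_2+1)! as N → ∞. -/

import Mathlib

open Filter

/-- The Liouville function `λ(n) = (-1)^Ω(n)`. -/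
noncomputable def lio (n : ℕ) : ℝ := (-1) ^ n.primeFactorsList.length

/-- `θ(n) = log n` if `n` is prime, `0` otherwise. -/
noncomputable def theta (n : ℕ) : ℝ := if n.Prime then Real.log n else 0

/-- `max_a |∑_{n ≤ N, n ≡ a (q)} f(n)|`. -/
noncomputable def maxAbs (f : ℕ → ℝ) (q N : ℕ) : ℝ :=
  ⨆ a : ℕ, |∑ n ∈ Finset.Icc 1 N, if n % q = a % q then f n else 0|

/-- `f` has (zero-mean) distribution level `ϑ`. -/
def HasLevel (f : ℕ → ℝ) (ϑ : ℝ) : Prop :=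
  ∀ ε > (0 : ℝ), ∀ A > (0 : ℝ), ∃ C > (0 : ℝ), ∀ N : ℕ, 2 ≤ N →
    ∑ q ∈ Finset.Icc 1 ⌊(N : ℝ) ^ (ϑ - ε)⌋₊, maxAbs f q N ≤ C * N / Real.log N ^ A

/-- `max_{(a,q)=1} |∑_{p ≤ N, p ≡ a (q)} log p - N/φ(q)|`. -/
noncomputable def primeMaxAbs (q N : ℕ) : ℝ :=
  ⨆ a : ℕ, if Nat.Coprime a q then
    |(∑ p ∈ Finset.Icc 1 N, if p.Prime ∧ p % q = a % q then Real.log p else 0)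
      - N / q.totient|
  else 0

/-- The primes have distribution level `ϑ` (Bombieri–Vinogradov/Elliott–Halberstam type). -/
def PrimesLevel (ϑ : ℝ) : Prop :=
  ∀ ε > (0 : ℝ), ∀ A > (0 : ℝ), ∃ C > (0 : ℝ), ∀ N : ℕ, 2 ≤ N →
    ∑ q ∈ Finset.Icc 1 ⌊(N : ℝ) ^ (ϑ - ε)⌋₊, primeMaxAbs q N ≤ C * N / Real.log N ^ A

/-- Hypothesis D(ϑ, h): the primes and the four auxiliary Liouville-type sequences
all have distribution level `ϑ`. -/
def HypD (ϑ : ℝ) (h : ℕ) : Prop :=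
  PrimesLevel ϑ ∧
  HasLevel lio ϑ ∧
  HasLevel (fun n => lio n * lio (n + h)) ϑ ∧
  HasLevel (fun n => theta n * lio (n + h)) ϑ ∧
  HasLevel (fun n => if h < n then theta n * lio (n - h) else 0) ϑ

/-- The Goldston–Pintz–Yıldırım weight
`Λ_R(n; H, l) = (1/(k+l)!) ∑_{d ≤ R, d ∣ P_H(n)} μ(d) (log (R/d))^{k+l}`. -/
noncomputable def LambdaR (R : ℝ) (n : ℕ) (H : Finset ℕ) (l : ℕ) : ℝ :=
  (1 / (H.card + l).factorial) *
    ∑ d ∈ Finset.Icc 1 ⌊R⌋₊,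
      if d ∣ ∏ hi ∈ H, (n + hi) then
        (ArithmeticFunction.moebius d : ℝ) * Real.log (R / d) ^ (H.card + l)
      else 0

/-- `ν_m(H)`: the number of residue classes `n` mod `m` with `m ∣ P_H(n)`. -/
def nu (H : Finset ℕ) (m : ℕ) : ℕ :=
  ((Finset.range m).filter fun n => m ∣ ∏ hi ∈ H, (n + hi)).card

/-- The singular series `𝔖(H) = ∏_p (1 - ν_p(H)/p)(1 - 1/p)^{-k}`. -/
noncomputable def singSeries (H : Finset ℕ) : ℝ :=
  ∏' p : Nat.Primes, (1 - (nu H p : ℝ) / (p : ℕ)) * (1 - 1 / ((p : ℕ) : ℝ)) ^ (-(H.card : ℤ))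

/-- `𝔖₀(h) = ∏_{p ∣ h} (1-1/p)⁻¹ ∏_{p ∤ h} (1 - 1/(p-1)²)`. -/
noncomputable def singSeries0 (h : ℕ) : ℝ :=
  ∏' p : Nat.Primes, if (p : ℕ) ∣ h then (1 - 1 / ((p : ℕ) : ℝ))⁻¹
    else 1 - 1 / (((p : ℕ) : ℝ) - 1) ^ 2

open MeasureTheory in
theorem integrable_inv_one_add_I_mul_pow {m : ℕ} (hm : 1 ≤ m) :
    Integrable fun ξ : ℝ => ((1 : ℂ) + Complex.I * ξ)⁻¹ ^ (m + 1) := by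
  refine integrable_inv_one_add_sq.mono' ?_ (ae_of_all _ fun ξ => ?_)
  · refine Continuous.aestronglyMeasurable ?_
    refine Continuous.pow (Continuous.inv₀ (by fun_prop) fun ξ h => ?_) _
    have := congrArg Complex.re h
    simp at this
  · have h1 : ‖(1 : ℂ) + Complex.I * ξ‖ ^ 2 = 1 + ξ ^ 2 := by
      rw [← Complex.normSq_eq_norm_sq, Complex.normSq_apply]; simp; ring
    have h2 : 1 ≤ ‖(1 : ℂ) + Complex.I * ξ‖ := by
      by_contra h
      nlinarith [norm_nonneg ((1 : ℂ) + Complex.I * ξ), sq_nonneg ξ]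
    rw [norm_pow, norm_inv, ← h1, ← inv_pow]
    exact pow_le_pow_of_le_one (by positivity) (inv_le_one_of_one_le₀ h2) (by omega)

open MeasureTheory in
theorem integrableOn_pow_mul_exp_neg_mul (m : ℕ) {b : ℝ} (hb : 0 < b) :
    IntegrableOn (fun t : ℝ => t ^ m * Real.exp (-(b * t))) (Set.Ioi 0) := by
  have h := integrableOn_rpow_mul_exp_neg_mul_rpow (p := 1) (s := m) (b := b)
    (by have : (0 : ℝ) ≤ m := by positivity
        linarith) one_pos hb
  refine h.congr_fun (fun t _ => ?_) measurableSet_Ioi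
  simp

open MeasureTheory in
theorem integrableOn_pow_mul_cexp_neg_mul (m : ℕ) {z : ℂ} (hz : 0 < z.re) :
    IntegrableOn (fun t : ℝ => (t : ℂ) ^ m * Complex.exp (-(z * t))) (Set.Ioi 0) := by
  refine (integrableOn_pow_mul_exp_neg_mul m hz).mono' (by fun_prop) ?_
  filter_upwards [ae_restrict_mem measurableSet_Ioi] with t ht
  rw [norm_mul, norm_pow, Complex.norm_exp, Complex.norm_real, Real.norm_of_nonneg (le_of_lt ht)]
  simp

open MeasureTheory in
theorem integral_pow_mul_exp_neg_mul (m : ℕ) (z : ℂ) (hz : 0 < z.re) :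
    ∫ t : ℝ in Set.Ioi 0, (t : ℂ) ^ m * Complex.exp (-(z * t)) = m.factorial * z⁻¹ ^ (m + 1) := by
  have hz0 : z ≠ 0 := by rintro rfl; simp at hz
  induction m with
  | zero =>
    have h := integral_exp_mul_complex_Ioi (a := -z) (by simpa) 0
    simp only [pow_zero, one_mul, Nat.factorial_zero, Nat.cast_one, zero_add, pow_one]
    simp only [neg_mul] at h
    rw [h]
    simp
  | succ m ih =>
    have hd : ∀ t ∈ Set.Ici (0 : ℝ), HasDerivAt
        (fun t : ℝ => -(z⁻¹ * ((t : ℂ) ^ (m + 1) * Complex.exp (-(z * t)))))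
        ((t : ℂ) ^ (m + 1) * Complex.exp (-(z * t)) -
          (m + 1) * z⁻¹ * ((t : ℂ) ^ m * Complex.exp (-(z * t)))) t := by
      intro t _
      have h1 : HasDerivAt (fun t : ℝ => (t : ℂ)) 1 t := Complex.ofRealCLM.hasDerivAt
      have h2 := (((h1.pow (m + 1)).mul ((h1.const_mul z).neg.cexp)).const_mul z⁻¹).neg
      refine h2.congr_deriv ?_
      simp only [Pi.pow_apply, Pi.neg_apply]
      push_cast
      field_simp
      ring
    have hi := (integrableOn_pow_mul_cexp_neg_mul (m + 1) hz).sub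
      ((integrableOn_pow_mul_cexp_neg_mul m hz).const_mul ((m + 1) * z⁻¹))
    have ht : Tendsto (fun t : ℝ => -(z⁻¹ * ((t : ℂ) ^ (m + 1) * Complex.exp (-(z * t)))))
        atTop (nhds 0) := by
      rw [show (0 : ℂ) = -(z⁻¹ * 0) by simp]
      refine (Tendsto.const_mul _ ?_).neg
      rw [tendsto_zero_iff_norm_tendsto_zero]
      refine (tendsto_rpow_mul_exp_neg_mul_atTop_nhds_zero (m + 1 : ℕ) z.re hz).congr' ?_
      filter_upwards [eventually_ge_atTop 0] with t ht
      rw [norm_mul, norm_pow, Complex.norm_exp, Complex.norm_real, Real.norm_of_nonneg ht]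
      simp only [Real.rpow_natCast]
      simp
    have h := integral_Ioi_of_hasDerivAt_of_tendsto' hd hi ht
    rw [integral_sub (integrableOn_pow_mul_cexp_neg_mul (m + 1) hz)
      ((integrableOn_pow_mul_cexp_neg_mul m hz).const_mul _), integral_const_mul, ih] at h
    simp only [Complex.ofReal_zero, ne_eq, Nat.add_eq_zero_iff, one_ne_zero, and_false,
      not_false_eq_true, zero_pow, zero_mul, mul_zero, neg_zero, sub_zero] at h
    rw [sub_eq_zero.1 h, Nat.factorial_succ]
    push_cast
    ring

open MeasureTheory FourierTransform in
theorem fourier_pow_mul_exp_neg (m : ℕ) (hm : 1 ≤ m) (w : ℝ) :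
    𝓕 (fun t : ℝ => (((max t 0) ^ m * Real.exp (-t) : ℝ) : ℂ)) w
      = m.factorial * ((1 : ℂ) + Complex.I * (2 * Real.pi * w : ℝ))⁻¹ ^ (m + 1) := by
  rw [Real.fourier_real_eq_integral_exp_smul,
    ← integral_pow_mul_exp_neg_mul m _ (by simp)]
  rw [← integral_indicator measurableSet_Ioi]
  refine integral_congr_ae (ae_of_all _ fun t => ?_)
  simp only [Set.indicator_apply, Set.mem_Ioi]
  split_ifs with h
  · rw [max_eq_left h.le]
    push_cast
    rw [smul_eq_mul, mul_left_comm, ← Complex.exp_add]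
    congr 2
    ring
  · rw [max_eq_right (not_lt.1 h)]
    simp [Nat.one_le_iff_ne_zero.1 hm]

open MeasureTheory in
theorem integrable_pow_mul_exp_neg (m : ℕ) (hm : 1 ≤ m) :
    Integrable (fun t : ℝ => (((max t 0) ^ m * Real.exp (-t) : ℝ) : ℂ)) := by
  have h := integrableOn_pow_mul_exp_neg_mul m one_pos
  rw [← integrable_indicator_iff measurableSet_Ioi] at h
  have h2 : Integrable (fun t : ℝ => (max t 0) ^ m * Real.exp (-t)) := by
    refine h.congr (ae_of_all _ fun t => ?_)
    simp only [Set.indicator_apply, Set.mem_Ioi]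
    split_ifs with h
    · rw [max_eq_left h.le]
      simp
    · rw [max_eq_right (not_lt.1 h)]
      simp [Nat.one_le_iff_ne_zero.1 hm]
  exact h2.ofReal

open MeasureTheory FourierTransform in
/-- The truncated power as a Perron integral on the line `Re s = 1`. -/
theorem integral_exp_mul_inv_pow {m : ℕ} (hm : 1 ≤ m) (y : ℝ) :
    ∫ ξ : ℝ, Complex.exp (y * (1 + Complex.I * ξ)) * ((1 : ℂ) + Complex.I * ξ)⁻¹ ^ (m + 1)
      = 2 * Real.pi * ((max y 0 ^ m : ℝ) / m.factorial) := by
  have hF : 𝓕 (fun t : ℝ => (((max t 0) ^ m * Real.exp (-t) : ℝ) : ℂ)) = fun w : ℝ =>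
      m.factorial * ((1 : ℂ) + Complex.I * (2 * Real.pi * w : ℝ))⁻¹ ^ (m + 1) :=
    funext (fourier_pow_mul_exp_neg m hm)
  have hpi : (2 * Real.pi) ≠ 0 := by positivity
  have hc : Continuous (fun t : ℝ => (((max t 0) ^ m * Real.exp (-t) : ℝ) : ℂ)) := by fun_prop
  have hint : Integrable (𝓕 (fun t : ℝ => (((max t 0) ^ m * Real.exp (-t) : ℝ) : ℂ))) := by
    rw [hF]
    exact ((integrable_inv_one_add_I_mul_pow hm).comp_mul_left' hpi).const_mul _
  have hinv := congrFun (hc.fourierInv_fourier_eq (integrable_pow_mul_exp_neg m hm) hint) y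
  rw [hF, Real.fourierInv_eq'] at hinv
  have hsub := Measure.integral_comp_mul_left (fun ξ : ℝ => Complex.exp (y * (Complex.I * ξ)) *
    (m.factorial * ((1 : ℂ) + Complex.I * ξ)⁻¹ ^ (m + 1))) (2 * Real.pi)
  have e1 : ∫ v : ℝ, Complex.exp ((↑(2 * Real.pi * inner ℝ v y) * Complex.I)) •
      ((m.factorial : ℂ) * ((1 : ℂ) + Complex.I * (2 * Real.pi * v : ℝ))⁻¹ ^ (m + 1)) =
      ∫ v : ℝ, Complex.exp (y * (Complex.I * (2 * Real.pi * v : ℝ))) *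
    (m.factorial * ((1 : ℂ) + Complex.I * (2 * Real.pi * v : ℝ))⁻¹ ^ (m + 1)) := by
    refine integral_congr_ae (ae_of_all _ fun v => ?_)
    simp only [smul_eq_mul]
    congr 2
    simp
    ring
  rw [e1, hsub, abs_of_pos (by positivity)] at hinv
  have e2 : ∫ ξ : ℝ, Complex.exp (y * (1 + Complex.I * ξ)) * ((1 : ℂ) + Complex.I * ξ)⁻¹ ^ (m + 1)
      = (Complex.exp y / m.factorial) * ∫ ξ : ℝ, Complex.exp (y * (Complex.I * ξ)) *
    (m.factorial * ((1 : ℂ) + Complex.I * ξ)⁻¹ ^ (m + 1)) := by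
    rw [← integral_const_mul]
    refine integral_congr_ae (ae_of_all _ fun v => ?_)
    have : (m.factorial : ℂ) ≠ 0 := by exact_mod_cast m.factorial_ne_zero
    simp only [mul_add, mul_one, Complex.exp_add]
    field_simp
  rw [e2]
  rw [Complex.real_smul, Complex.ofReal_inv, inv_mul_eq_iff_eq_mul₀ (by exact_mod_cast hpi)] at hinv
  rw [hinv]
  push_cast
  rw [Complex.exp_neg]
  have := Complex.exp_ne_zero y
  field_simp

open MeasureTheory in
theorem integral_pow_mul_max_one_sub_pow (j M : ℕ) (hM : 1 ≤ M) :
    ∫ v : ℝ in Set.Ioi 0, (v : ℂ) ^ j * ((max (1 - v) 0 ^ M : ℝ) : ℂ)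
      = j.factorial * M.factorial / (j + M + 1).factorial := by
  have hB := Complex.betaIntegral_eq_Gamma_mul_div (j + 1 : ℂ) (M + 1 : ℂ)
    (by simp; positivity) (by simp; positivity)
  rw [Complex.Gamma_nat_eq_factorial, Complex.Gamma_nat_eq_factorial,
    show (j + 1 + (M + 1) : ℂ) = ((j + M + 1 : ℕ) : ℂ) + 1 by push_cast; ring,
    Complex.Gamma_nat_eq_factorial, Complex.betaIntegral,
    intervalIntegral.integral_of_le zero_le_one] at hB
  rw [← hB, ← integral_indicator measurableSet_Ioi, ← integral_indicator measurableSet_Ioc]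
  refine integral_congr_ae (ae_of_all _ fun v => ?_)
  simp only [Set.indicator_apply, Set.mem_Ioi, Set.mem_Ioc]
  by_cases h0 : 0 < v
  · by_cases h1 : v ≤ 1
    · simp [h0, h1]
    · have : max (1 - v) 0 = 0 := max_eq_right (by linarith)
      simp [h0, h1, this, Nat.one_le_iff_ne_zero.1 hM]
  · simp [h0]

open MeasureTheory in
/-- The double Perron integral with a power of `(s₁ + s₂)⁻¹`. -/
theorem integral_prod_exp_mul_inv_pow {m n : ℕ} (hm : 1 ≤ m) (hn : 1 ≤ n) (κ : ℕ) :
    ∫ ξ : ℝ × ℝ, (Complex.exp (1 + Complex.I * ξ.1) * ((1 : ℂ) + Complex.I * ξ.1)⁻¹ ^ (m + 1)) *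
        (Complex.exp (1 + Complex.I * ξ.2) * ((1 : ℂ) + Complex.I * ξ.2)⁻¹ ^ (n + 1)) *
        ((1 + Complex.I * ξ.1) + (1 + Complex.I * ξ.2) : ℂ)⁻¹ ^ κ
      = (2 * Real.pi) ^ 2 * ((m + n).choose m / (κ + m + n).factorial) := by
  have hP1 := integral_exp_mul_inv_pow hm 1
  have hP2 := integral_exp_mul_inv_pow hn 1
  have hmf : (m.factorial : ℂ) ≠ 0 := by exact_mod_cast m.factorial_ne_zero
  have hnf : (n.factorial : ℂ) ≠ 0 := by exact_mod_cast n.factorial_ne_zero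
  have hmnf : ((m + n).factorial : ℂ) ≠ 0 := by exact_mod_cast (m + n).factorial_ne_zero
  have hch : ((m + n).choose m : ℂ) = (m + n).factorial / (m.factorial * n.factorial) := by
    rw [Nat.cast_choose ℂ (Nat.le_add_right m n), Nat.add_sub_cancel_left]
  simp only [Complex.ofReal_one, one_mul] at hP1 hP2
  rcases κ with _ | j
  · simp only [pow_zero, mul_one]
    rw [Measure.volume_eq_prod,
      integral_prod_mul (f := fun x : ℝ => Complex.exp (1 + Complex.I * x) * ((1 : ℂ) + Complex.I * x)⁻¹ ^ (m + 1))
      (g := fun x : ℝ => Complex.exp (1 + Complex.I * x) * ((1 : ℂ) + Complex.I * x)⁻¹ ^ (n + 1)),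
      hP1, hP2, hch]
    simp only [zero_le_one, sup_of_le_left, one_pow, Complex.ofReal_one, zero_add]
    field_simp
  · have hjf : (j.factorial : ℂ) ≠ 0 := by exact_mod_cast j.factorial_ne_zero
    set A : ℝ → ℂ := fun x => ((1 : ℂ) + Complex.I * x)⁻¹ ^ (m + 1) with hA
    set B : ℝ → ℂ := fun x => ((1 : ℂ) + Complex.I * x)⁻¹ ^ (n + 1) with hB
    have hAi : Integrable A := integrable_inv_one_add_I_mul_pow hm
    have hBi : Integrable B := integrable_inv_one_add_I_mul_pow hn
    have hrep : ∀ ξ : ℝ × ℝ, (Complex.exp (1 + Complex.I * ξ.1) * A ξ.1) *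
        (Complex.exp (1 + Complex.I * ξ.2) * B ξ.2) *
        ((1 + Complex.I * ξ.1) + (1 + Complex.I * ξ.2) : ℂ)⁻¹ ^ (j + 1) =
        (j.factorial : ℂ)⁻¹ * ∫ v : ℝ in Set.Ioi 0, (v : ℂ) ^ j *
          ((Complex.exp ((1 - v : ℝ) * (1 + Complex.I * ξ.1)) * A ξ.1) *
          (Complex.exp ((1 - v : ℝ) * (1 + Complex.I * ξ.2)) * B ξ.2)) := by
      intro ξ
      have h := integral_pow_mul_exp_neg_mul j
        ((1 + Complex.I * ξ.1) + (1 + Complex.I * ξ.2) : ℂ) (by simp)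
      rw [show ((1 + Complex.I * ξ.1) + (1 + Complex.I * ξ.2) : ℂ)⁻¹ ^ (j + 1) =
        (j.factorial : ℂ)⁻¹ * (j.factorial * ((1 + Complex.I * ξ.1) +
          (1 + Complex.I * ξ.2) : ℂ)⁻¹ ^ (j + 1)) by field_simp, ← h, mul_left_comm,
          ← integral_const_mul]
      congr 1
      refine integral_congr_ae (ae_of_all _ fun v => ?_)
      simp only
      rw [show ((1 - v : ℝ) * (1 + Complex.I * ξ.1) : ℂ) = (1 + Complex.I * ξ.1) + (- v * (1 + Complex.I * ξ.1)) by push_cast; ring,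
       show ((1 - v : ℝ) * (1 + Complex.I * ξ.2) : ℂ) = (1 + Complex.I * ξ.2) + (- v * (1 + Complex.I * ξ.2)) by push_cast; ring,
       show (-((1 + Complex.I * ξ.1 + (1 + Complex.I * ξ.2)) * v) : ℂ) = (- v * (1 + Complex.I * ξ.1)) + (- v * (1 + Complex.I * ξ.2)) by ring]
      simp only [Complex.exp_add]
      ring
    refine (integral_congr_ae (ae_of_all _ hrep)).trans ?_
    rw [integral_const_mul, integral_integral_swap]
    · have hin : ∀ v : ℝ, ∫ ξ : ℝ × ℝ, (v : ℂ) ^ j *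
          ((Complex.exp ((1 - v : ℝ) * (1 + Complex.I * ξ.1)) * A ξ.1) *
          (Complex.exp ((1 - v : ℝ) * (1 + Complex.I * ξ.2)) * B ξ.2)) =
          (2 * Real.pi) ^ 2 / (m.factorial * n.factorial) *
            ((v : ℂ) ^ j * ((max (1 - v) 0 ^ (m + n) : ℝ) : ℂ)) := by
        intro v
        rw [integral_const_mul, Measure.volume_eq_prod, integral_prod_mul
          (f := fun x : ℝ => Complex.exp ((1 - v : ℝ) * (1 + Complex.I * x)) * A x)
          (g := fun x : ℝ => Complex.exp ((1 - v : ℝ) * (1 + Complex.I * x)) * B x),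
          integral_exp_mul_inv_pow hm, integral_exp_mul_inv_pow hn, pow_add]
        push_cast
        field_simp
      simp_rw [hin]
      rw [integral_const_mul, integral_pow_mul_max_one_sub_pow _ _ (by omega), hch,
        show j + 1 + m + n = j + (m + n) + 1 by ring]
      field_simp
    · have h1 := (hAi.mul_prod hBi).mul_prod
        (show Integrable (fun t : ℝ => (t : ℂ) ^ j * Complex.exp (-((2 : ℂ) * t)))
          (volume.restrict (Set.Ioi 0)) from integrableOn_pow_mul_cexp_neg_mul j (by simp))
      rw [← Measure.volume_eq_prod] at h1
      refine (h1.norm.const_mul (Real.exp 2)).mono' ?_ ?_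
      · have h2 : AEStronglyMeasurable (fun ξ : ℝ × ℝ => A ξ.1 * B ξ.2)
          (volume : Measure (ℝ × ℝ)) := by
          exact (hAi.mul_prod hBi).1
        have h3 : AEStronglyMeasurable (fun ξ : (ℝ × ℝ) × ℝ => A ξ.1.1 * B ξ.1.2)
          ((volume : Measure (ℝ × ℝ)).prod (volume.restrict (Set.Ioi 0))) := h2.comp_fst
        have h4 : Continuous (fun ξ : (ℝ × ℝ) × ℝ => (ξ.2 : ℂ) ^ j *
          (Complex.exp ((1 - ξ.2 : ℝ) * (1 + Complex.I * ξ.1.1)) *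
          Complex.exp ((1 - ξ.2 : ℝ) * (1 + Complex.I * ξ.1.2)))) := by fun_prop
        refine (h4.aestronglyMeasurable.mul h3).congr (ae_of_all _ fun ξ => ?_)
        simp only [Function.uncurry, Pi.mul_apply]
        ring
      · refine ae_of_all _ fun ξ => le_of_eq ?_
        simp only [Function.uncurry, norm_mul, Complex.norm_exp, norm_pow, Complex.norm_real]
        rw [show (-((2 : ℂ) * ξ.2)).re = -(2 * ξ.2) by simp, show -(2 * ξ.2) = -2 + ((1 - ξ.2) + (1 - ξ.2)) by ring, Real.exp_add, Real.exp_add,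
          Real.exp_neg]
        have : ∀ x : ℝ, ((1 - ξ.2 : ℝ) * (1 + Complex.I * x) : ℂ).re = 1 - ξ.2 := by
          intro x; simp
        rw [this, this]
        have := Real.exp_ne_zero 2
        field_simp

section ZetaBound

open MeasureTheory Set Topology

theorem exists_abs_chebyshevTheta_sub_le
    (h : ∃ C : ℝ, ∀ N : ℕ, 2 ≤ N → |Chebyshev.theta N - N| ≤ C * N / Real.log N ^ 2) :
    ∃ C : ℝ, 0 ≤ C ∧ ∀ t : ℝ, 2 ≤ t → |Chebyshev.theta t - t| ≤ C * (t / Real.log t ^ 2) := by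
  obtain ⟨C, hC⟩ := h
  refine ⟨4 * |C| + 4, by positivity, fun t ht => ?_⟩
  have ht0 : 0 < t := by linarith
  have hfl : 2 ≤ ⌊t⌋₊ := Nat.le_floor (by simpa using ht)
  have hfl' : (2 : ℝ) ≤ ⌊t⌋₊ := by exact_mod_cast hfl
  have h1 := hC ⌊t⌋₊ hfl
  have hle : (⌊t⌋₊ : ℝ) ≤ t := Nat.floor_le ht0.le
  have hlt : t < ⌊t⌋₊ + 1 := Nat.lt_floor_add_one t
  have hlogt : 0 < Real.log t := Real.log_pos (by linarith)
  have hlogf : 0 < Real.log ⌊t⌋₊ := Real.log_pos (by linarith)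
  have hlog : Real.log t ≤ 2 * Real.log ⌊t⌋₊ := by
    rw [← Real.log_rpow (by linarith)]
    apply Real.log_le_log ht0
    norm_num
    nlinarith
  have hlog2 : Real.log t ^ 2 ≤ 4 * t := by
    have : Real.log t ≤ 2 * √t := by
      have := Real.log_le_sub_one_of_pos (Real.sqrt_pos.2 ht0)
      rw [Real.log_sqrt ht0.le] at this
      linarith
    nlinarith [Real.sq_sqrt ht0.le, Real.sqrt_nonneg t]
  have h2 : |C| * ⌊t⌋₊ / Real.log ⌊t⌋₊ ^ 2 ≤ 4 * |C| * (t / Real.log t ^ 2) := by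
    rw [mul_div_assoc', div_le_div_iff₀ (by positivity) (by positivity)]
    have : Real.log t ^ 2 ≤ 4 * Real.log ⌊t⌋₊ ^ 2 := by nlinarith
    calc |C| * ⌊t⌋₊ * Real.log t ^ 2 ≤ |C| * t * (4 * Real.log ⌊t⌋₊ ^ 2) := by gcongr
      _ = _ := by ring
  have h3 : (1 : ℝ) ≤ 4 * (t / Real.log t ^ 2) := by
    rw [mul_div_assoc', le_div_iff₀ (by positivity)]; linarith
  have h4 : C * ⌊t⌋₊ / Real.log ⌊t⌋₊ ^ 2 ≤ |C| * ⌊t⌋₊ / Real.log ⌊t⌋₊ ^ 2 := by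
    gcongr; exact le_abs_self C
  rw [Chebyshev.theta_eq_theta_coe_floor]
  calc |Chebyshev.theta ⌊t⌋₊ - t| = |(Chebyshev.theta ⌊t⌋₊ - ⌊t⌋₊) + (⌊t⌋₊ - t)| := by ring_nf
    _ ≤ |Chebyshev.theta ⌊t⌋₊ - ⌊t⌋₊| + |⌊t⌋₊ - t| := abs_add_le _ _
    _ ≤ 4 * |C| * (t / Real.log t ^ 2) + 1 := by
        gcongr
        · linarith
        · rw [abs_le]; constructor <;> linarith
    _ ≤ _ := by linarith

theorem measurable_chebyshevPsi : Measurable Chebyshev.psi := Chebyshev.psi_mono.measurable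

theorem integrableOn_psi_sub_div_sq
    (h : ∃ C : ℝ, ∀ N : ℕ, 2 ≤ N → |Chebyshev.theta N - N| ≤ C * N / Real.log N ^ 2) :
    IntegrableOn (fun t : ℝ => (Chebyshev.psi t - t) / t ^ 2) (Ioi 1) := by
  obtain ⟨C, hC0, hC⟩ := exists_abs_chebyshevTheta_sub_le h
  obtain ⟨D, hD⟩ := Chebyshev.psi_sub_theta_le_mul_sqrt
  have hmeas : Measurable fun t : ℝ => (Chebyshev.psi t - t) / t ^ 2 :=
    (measurable_chebyshevPsi.sub measurable_id).div (measurable_id.pow_const 2)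
  rw [← Ioc_union_Ioi_eq_Ioi (one_le_two : (1 : ℝ) ≤ 2)]
  apply IntegrableOn.union
  · apply Measure.integrableOn_of_bounded (M := Chebyshev.psi 2 + 2)
      (by simp) hmeas.aestronglyMeasurable
    filter_upwards [ae_restrict_mem measurableSet_Ioc] with t ht
    have h1 := Chebyshev.psi_mono ht.2
    have h0 := Chebyshev.psi_nonneg t
    have ht1 : 1 ≤ t ^ 2 := by nlinarith [ht.1]
    rw [norm_div, Real.norm_eq_abs, Real.norm_eq_abs, abs_of_nonneg (sq_nonneg t)]
    apply (div_le_self (abs_nonneg _) ht1).trans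
    rw [abs_le]; constructor <;> linarith [ht.1, ht.2]
  · have hi : IntegrableOn (fun t : ℝ => C * (t⁻¹ / Real.log t ^ 2) + D * t ^ (-(3/2) : ℝ))
        (Ioi 2) :=
      ((integrableOn_inv_div_log_sq_Ioi one_lt_two).const_mul C).add
        ((integrableOn_Ioi_rpow_of_lt (by norm_num) two_pos).const_mul D)
    refine hi.mono' hmeas.aestronglyMeasurable ?_
    filter_upwards [ae_restrict_mem measurableSet_Ioi] with t ht
    have ht2 : (2 : ℝ) < t := ht
    have ht0 : 0 < t := by linarith
    have h1 := hC t ht2.le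
    have h2 := hD t
    have h3 := Chebyshev.theta_le_psi t
    have h4 : |Chebyshev.psi t - t| ≤ C * (t / Real.log t ^ 2) + D * √t := by
      rw [abs_le] at h1 ⊢
      constructor <;> linarith
    have hs : t ^ (-(3/2) : ℝ) = √t / t ^ 2 := by
      rw [Real.sqrt_eq_rpow, ← Real.rpow_natCast, ← Real.rpow_sub ht0]; norm_num
    have hl : t⁻¹ / Real.log t ^ 2 = t / Real.log t ^ 2 / t ^ 2 := by
      field_simp
    rw [norm_div, Real.norm_eq_abs, Real.norm_eq_abs, abs_of_nonneg (sq_nonneg t), hs, hl]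
    rw [show C * (t / Real.log t ^ 2 / t ^ 2) + D * (√t / t ^ 2)
      = (C * (t / Real.log t ^ 2) + D * √t) / t ^ 2 by ring]
    gcongr

theorem exists_norm_logDeriv_zeta_le
    (h : ∃ C : ℝ, ∀ N : ℕ, 2 ≤ N → |Chebyshev.theta N - N| ≤ C * N / Real.log N ^ 2) :
    ∃ K : ℝ, 0 ≤ K ∧ ∀ s : ℂ, 0 < s.re →
      ‖deriv riemannZeta (1 + s) / riemannZeta (1 + s)‖ ≤ ‖1 + s‖ * (1 / ‖s‖ + K) := by
  have hint := integrableOn_psi_sub_div_sq h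
  refine ⟨∫ t in Ioi (1:ℝ), ‖(Chebyshev.psi t - t) / t ^ 2‖,
    integral_nonneg fun _ => norm_nonneg _, fun s hs => ?_⟩
  have hs1 : 1 < (1 + s).re := by simpa using hs
  have hs0 : s ≠ 0 := by rintro rfl; simp at hs
  have hL := ArithmeticFunction.LSeries_vonMangoldt_eq_deriv_riemannZeta_div hs1
  have hpsi : ∀ t : ℝ, (∑ k ∈ Finset.Icc 1 ⌊t⌋₊, (ArithmeticFunction.vonMangoldt k : ℂ))
      = (Chebyshev.psi t : ℂ) := by
    intro t
    rw [Chebyshev.psi]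
    push_cast
    rfl
  have hO : (fun n : ℕ ↦ ∑ k ∈ Finset.Icc 1 n, ArithmeticFunction.vonMangoldt k)
      =O[atTop] fun n ↦ (n : ℝ) ^ (1 : ℝ) := by
    obtain ⟨c, hc⟩ : ∃ c : ℝ, ∀ x : ℝ, 0 ≤ x → Chebyshev.psi x ≤ c * x :=
      ⟨_, fun x hx => Chebyshev.psi_le_const_mul_self hx⟩
    apply Asymptotics.IsBigO.of_bound c
    refine Eventually.of_forall fun n => ?_
    have h1 := hc n (by positivity)
    have h2 : ∑ k ∈ Finset.Icc 1 n, ArithmeticFunction.vonMangoldt k = Chebyshev.psi n := by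
      rw [Chebyshev.psi, Nat.floor_natCast]; rfl
    rw [h2, Real.norm_of_nonneg (Chebyshev.psi_nonneg _)]
    simpa using h1
  have hI := LSeries_eq_mul_integral_of_nonneg (fun n => ArithmeticFunction.vonMangoldt n)
    zero_le_one hs1 hO (fun n => ArithmeticFunction.vonMangoldt_nonneg)
  have hpow : ∀ t ∈ Ioi (1:ℝ), ((t : ℂ) ^ (-(1 + s + 1))) * (t : ℂ) = (t : ℂ) ^ (-(1 + s)) := by
    intro t ht
    have : (t : ℂ) ≠ 0 := by exact_mod_cast (zero_lt_one.trans ht).ne'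
    rw [show -(1 + s) = -(1 + s + 1) + 1 by ring, Complex.cpow_add _ _ this, Complex.cpow_one]
  have hb : ∀ t ∈ Ioi (1:ℝ), ‖((Chebyshev.psi t - t : ℝ) : ℂ) * (t : ℂ) ^ (-(1 + s + 1))‖
      ≤ ‖(Chebyshev.psi t - t) / t ^ 2‖ := by
    intro t ht
    have ht0 : 0 < t := zero_lt_one.trans ht
    rw [norm_mul, Complex.norm_cpow_eq_rpow_re_of_pos ht0, norm_div, Complex.norm_real,
      div_eq_mul_inv]
    gcongr
    rw [Real.norm_of_nonneg (by positivity), ← Real.rpow_natCast, ← Real.rpow_neg ht0.le]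
    apply Real.rpow_le_rpow_of_exponent_le (le_of_lt ht)
    simp; linarith
  have hint2 : IntegrableOn (fun t : ℝ => ((Chebyshev.psi t - t : ℝ) : ℂ) *
      (t : ℂ) ^ (-(1 + s + 1))) (Ioi 1) := by
    refine hint.norm.mono' ?_ ((ae_restrict_iff' measurableSet_Ioi).2 (Eventually.of_forall hb))
    apply AEStronglyMeasurable.mul
    · exact (Complex.measurable_ofReal.comp
        (measurable_chebyshevPsi.sub measurable_id)).aestronglyMeasurable
    · refine ContinuousOn.aestronglyMeasurable (fun t ht ↦ ?_) measurableSet_Ioi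
      exact (Complex.continuousAt_ofReal_cpow_const _ _
        (Or.inr (zero_lt_one.trans ht).ne')).continuousWithinAt
  have hint3 : IntegrableOn (fun t : ℝ => (t : ℂ) ^ (-(1 + s))) (Ioi 1) :=
    integrableOn_Ioi_cpow_of_lt (by simpa using hs) zero_lt_one
  have hsplit : (∫ t in Ioi (1:ℝ), (∑ k ∈ Finset.Icc 1 ⌊t⌋₊,
      (ArithmeticFunction.vonMangoldt k : ℂ)) * (t : ℂ) ^ (-(1 + s + 1)))
      = (∫ t in Ioi (1:ℝ), ((Chebyshev.psi t - t : ℝ) : ℂ) * (t : ℂ) ^ (-(1 + s + 1)))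
        + 1 / s := by
    have : (1 : ℂ) / s = ∫ t in Ioi (1:ℝ), (t : ℂ) ^ (-(1 + s)) := by
      rw [integral_Ioi_cpow_of_lt (by simpa using hs) zero_lt_one]
      simp
    rw [this, ← integral_add hint2 hint3]
    apply setIntegral_congr_fun measurableSet_Ioi
    intro t ht
    simp only [hpsi, ← hpow t ht]
    push_cast
    ring
  rw [hL, hsplit] at hI
  have : deriv riemannZeta (1 + s) / riemannZeta (1 + s) =
    -((1 + s) * ((∫ t in Ioi (1:ℝ), ((Chebyshev.psi t - t : ℝ) : ℂ) * (t : ℂ) ^ (-(1 + s + 1)))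
        + 1 / s)) := by rw [← hI]; ring
  rw [this, norm_neg, norm_mul]
  gcongr
  rw [add_comm]
  refine (norm_add_le _ _).trans ?_
  gcongr
  · simp
  · refine (norm_integral_le_integral_norm _).trans ?_
    exact setIntegral_mono_on hint2.norm hint.norm measurableSet_Ioi hb

end ZetaBound

section ZetaBound2

open MeasureTheory Set Topology

theorem norm_LSeries_le_of_norm_le_one {f : ℕ → ℂ} (hf : ∀ n, ‖f n‖ ≤ 1) {w : ℂ}
    (hw : 0 < w.re) : ‖LSeries f (1 + w)‖ ≤ 1 + 1 / w.re := by
  set σ := w.re with hσ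
  have h1σ : 1 < ((1 + σ : ℝ) : ℂ).re := by simpa using hw
  have hsum : Summable fun n : ℕ => 1 / (n : ℝ) ^ (1 + σ) :=
    Real.summable_one_div_nat_rpow.2 (by linarith)
  have hterm : ∀ n : ℕ, ‖LSeries.term f (1 + w) n‖ ≤ 1 / (n : ℝ) ^ (1 + σ) := by
    intro n
    rcases eq_or_ne n 0 with rfl | hn
    · simp; positivity
    · rw [LSeries.term_of_ne_zero hn, norm_div, Complex.norm_natCast_cpow_of_pos (by omega)]
      have : (1 + w).re = 1 + σ := by simp [hσ]
      rw [this]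
      gcongr
      exact hf n
  have hle : ‖LSeries f (1 + w)‖ ≤ ∑' n : ℕ, 1 / (n : ℝ) ^ (1 + σ) :=
    tsum_of_norm_bounded hsum.hasSum hterm
  have hO : (fun n : ℕ ↦ ∑ k ∈ Finset.Icc 1 n, (1 : ℝ)) =O[atTop] fun n ↦ (n : ℝ) ^ (1 : ℝ) := by
    apply Asymptotics.IsBigO.of_bound 1
    exact Eventually.of_forall fun n => by simp
  have hI := LSeries_eq_mul_integral_of_nonneg (fun _ => (1 : ℝ)) zero_le_one h1σ hO
    (fun _ => zero_le_one)
  have hz : LSeries (fun _ => ((1 : ℝ) : ℂ)) ((1 + σ : ℝ) : ℂ)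
      = ((∑' n : ℕ, 1 / (n : ℝ) ^ (1 + σ) : ℝ) : ℂ) := by
    rw [LSeries, Complex.ofReal_tsum]
    congr 1
    ext n
    rcases eq_or_ne n 0 with rfl | hn
    · simp [Real.zero_rpow (by linarith : (1 + σ) ≠ 0)]
    · rw [LSeries.term_of_ne_zero hn]
      push_cast [Complex.ofReal_cpow (Nat.cast_nonneg n)]
      rfl
  have hr : ∀ t ∈ Ioi (1 : ℝ), (∑ k ∈ Finset.Icc 1 ⌊t⌋₊, ((1 : ℝ) : ℂ)) *
      (t : ℂ) ^ (-(((1 + σ : ℝ) : ℂ) + 1)) = ((⌊t⌋₊ * t ^ (-(1 + σ + 1)) : ℝ) : ℂ) := by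
    intro t ht
    have ht0 : 0 ≤ t := (zero_lt_one.trans ht).le
    push_cast [Complex.ofReal_cpow ht0]
    simp
  rw [hz, setIntegral_congr_fun measurableSet_Ioi hr, integral_complex_ofReal,
    ← Complex.ofReal_mul] at hI
  have hI' := Complex.ofReal_injective hI
  refine hle.trans (hI'.trans_le ?_)
  have hb : (∫ t in Ioi (1:ℝ), (⌊t⌋₊ * t ^ (-(1 + σ + 1)) : ℝ)) ≤ ∫ t in Ioi (1:ℝ), t ^ (-(1 + σ)) := by
    apply integral_mono_of_nonneg
    · exact (ae_restrict_iff' measurableSet_Ioi).2 (Eventually.of_forall fun t ht => by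
        have : (0:ℝ) < t := zero_lt_one.trans ht
        simp only [Pi.zero_apply]; positivity)
    · exact integrableOn_Ioi_rpow_of_lt (by linarith) zero_lt_one
    · refine (ae_restrict_iff' measurableSet_Ioi).2 (Eventually.of_forall fun t ht => ?_)
      have ht0 : (0:ℝ) < t := zero_lt_one.trans ht
      simp only
      rw [show -(1 + σ) = 1 + -(1 + σ + 1) by ring, Real.rpow_add ht0, Real.rpow_one]
      gcongr
      exact Nat.floor_le ht0.le
  rw [integral_Ioi_rpow_of_lt (by linarith) zero_lt_one] at hb
  calc (1 + σ) * _ ≤ (1 + σ) * (-1 ^ (-(1 + σ) + 1) / (-(1 + σ) + 1)) := by gcongr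
    _ = 1 + 1 / σ := by
      rw [Real.one_rpow, show -(1 + σ) + 1 = -σ by ring]
      field_simp
      ring

theorem norm_riemannZeta_one_add_le {w : ℂ} (hw : 0 < w.re) :
    ‖riemannZeta (1 + w)‖ ≤ 1 + 1 / w.re := by
  rw [← LSeries_one_eq_riemannZeta (by simpa using hw)]
  exact norm_LSeries_le_of_norm_le_one (by simp) hw

theorem norm_inv_riemannZeta_one_add_le {w : ℂ} (hw : 0 < w.re) :
    ‖(riemannZeta (1 + w))⁻¹‖ ≤ 1 + 1 / w.re := by
  have h1 : 1 < (1 + w).re := by simpa using hw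
  rw [← LSeries_one_eq_riemannZeta h1, inv_eq_of_mul_eq_one_right
    (LSeries_one_mul_Lseries_moebius h1)]
  refine norm_LSeries_le_of_norm_le_one (fun n => ?_) hw
  rw [Complex.norm_intCast]
  exact_mod_cast ArithmeticFunction.abs_moebius_le_one

theorem exists_norm_inv_zeta_le_of_abs_im_le_one :
    ∃ C : ℝ, 0 < C ∧ ∀ s : ℂ, 0 < s.re → s.re ≤ 1 → |s.im| ≤ 1 →
      ‖(riemannZeta (1 + s))⁻¹‖ ≤ C * ‖s‖ := by
  set F : ℂ → ℂ := Function.update (fun s => s * riemannZeta (1 + s)) 0 1 with hF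
  set S : Set ℂ := Icc 0 1 ×ℂ Icc (-1) 1 with hS
  have hSc : IsCompact S := isCompact_Icc.reProdIm isCompact_Icc
  have hFc : Continuous F := by
    rw [continuous_iff_continuousAt]
    intro s
    rcases eq_or_ne s 0 with rfl | hs
    · rw [hF, continuousAt_update_same]
      have hz : Tendsto (fun s : ℂ => 1 + s) (𝓝[≠] 0) (𝓝[≠] 1) := by
        apply tendsto_nhdsWithin_of_tendsto_nhds_of_eventually_within
        · exact tendsto_nhdsWithin_of_tendsto_nhds (by
            simpa using (continuous_const.add continuous_id).tendsto (0:ℂ) (f := fun s : ℂ => 1 + s))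
        · filter_upwards [self_mem_nhdsWithin] with s hs
          simpa using hs
      have := riemannZeta_residue_one.comp hz
      refine this.congr fun s => ?_
      simp
    · rw [hF, continuousAt_update_of_ne hs]
      apply continuousAt_id.mul
      apply ContinuousAt.comp (g := riemannZeta)
      · exact (differentiableAt_riemannZeta (by simpa using hs)).continuousAt
      · fun_prop
  have hF0 : ∀ s ∈ S, F s ≠ 0 := by
    intro s hs
    rcases eq_or_ne s 0 with rfl | hs0
    · simp [hF]
    · rw [hF, Function.update_of_ne hs0]
      refine mul_ne_zero hs0 (riemannZeta_ne_zero_of_one_le_re ?_)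
      simpa using hs.1.1
  obtain ⟨s₀, hs₀, hmin⟩ := hSc.exists_isMinOn ⟨0, by simp [hS, Complex.mem_reProdIm]⟩
    hFc.norm.continuousOn
  have hpos : 0 < ‖F s₀‖ := norm_pos_iff.2 (hF0 s₀ hs₀)
  refine ⟨‖F s₀‖⁻¹, by positivity, fun s h0 h1 him => ?_⟩
  have hsS : s ∈ S := ⟨⟨h0.le, h1⟩, abs_le.1 him⟩
  have hs0 : s ≠ 0 := by rintro rfl; simp at h0
  have hm : ‖F s₀‖ ≤ ‖F s‖ := hmin hsS
  rw [hF, Function.update_of_ne hs0, norm_mul, ← hF] at hm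
  have hzpos : 0 < ‖riemannZeta (1 + s)‖ := norm_pos_iff.2
    (riemannZeta_ne_zero_of_one_le_re (by simpa using h0.le))
  rw [norm_inv, inv_mul_eq_div, inv_eq_one_div, div_le_div_iff₀ hzpos hpos, one_mul]
  exact hm

theorem exists_norm_inv_zeta_le
    (h : ∃ C : ℝ, ∀ N : ℕ, 2 ≤ N → |Chebyshev.theta N - N| ≤ C * N / Real.log N ^ 2) :
    ∃ C : ℝ, 0 < C ∧ ∀ s : ℂ, 0 < s.re → s.re ≤ 1 →
      ‖(riemannZeta (1 + s))⁻¹‖ ≤ C * ‖s‖ := by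
  obtain ⟨C₁, hC₁, h₁⟩ := exists_norm_inv_zeta_le_of_abs_im_le_one
  obtain ⟨K, hK, hd⟩ := exists_norm_logDeriv_zeta_le h
  refine ⟨C₁ + 2 * Real.exp (3 * (1 + K)), by positivity, fun s h0 h1 => ?_⟩
  rcases le_total |s.im| 1 with him | him
  · refine (h₁ s h0 h1 him).trans ?_
    gcongr
    linarith [Real.exp_pos (3 * (1 + K))]
  have hims : |s.im| ≤ ‖s‖ := Complex.abs_im_le_norm s
  set T := |s.im| with hT
  have hT0 : 0 < T := by linarith
  have hexp : 1 ≤ Real.exp (3 * (1 + K)) := Real.one_le_exp (by positivity)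
  suffices hmain : ‖(riemannZeta (1 + s))⁻¹‖ ≤ 2 * T * Real.exp (3 * (1 + K)) by
    refine hmain.trans ?_
    have : 0 ≤ C₁ * ‖s‖ := by positivity
    nlinarith [Real.exp_pos (3 * (1 + K))]
  rcases le_or_gt (1 / T) s.re with hbig | hsmall
  · refine (norm_inv_riemannZeta_one_add_le h0).trans ?_
    have : 1 / s.re ≤ T := by
      rw [div_le_iff₀ h0]; rw [div_le_iff₀ hT0] at hbig; linarith
    nlinarith
  set σ := s.re with hσ
  set u := 1 / T with hu
  have hu0 : 0 < u := by positivity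
  have hu1 : u ≤ 1 := by rw [hu, div_le_one hT0]; exact him
  set p : ℝ → ℂ := fun v => (u - v : ℝ) + s.im * Complex.I with hp
  have hpre : ∀ v, (p v).re = u - v := by intro v; simp [hp]
  have hpim : ∀ v, (p v).im = s.im := by intro v; simp [hp]
  set G : ℝ → ℂ := fun v => (riemannZeta (1 + p v))⁻¹ with hG
  set M := 3 * T * (1 + K) with hM
  have hG' : ∀ v ∈ Icc 0 (u - σ), HasDerivAt G
      (deriv riemannZeta (1 + p v) / riemannZeta (1 + p v) * G v) v := by
    intro v hv
    have hre : 0 < (p v).re := by rw [hpre]; linarith [hv.2]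
    have hz : riemannZeta (1 + p v) ≠ 0 :=
      riemannZeta_ne_zero_of_one_le_re (by simpa using hre.le)
    have hne : 1 + p v ≠ 1 := by
      intro hh
      rw [add_eq_left] at hh
      rw [hh] at hre; simp at hre
    have hpd : HasDerivAt (fun v => 1 + p v) (-1 : ℂ) v := by
      have : HasDerivAt (fun v : ℝ => ((u - v : ℝ) : ℂ)) ((-1 : ℝ) : ℂ) v :=
        ((hasDerivAt_id v).const_sub u).ofReal_comp
      simpa [hp] using (this.add_const (s.im * Complex.I)).const_add 1
    have h2 : HasDerivAt (fun v => riemannZeta (1 + p v))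
        (deriv riemannZeta (1 + p v) * (-1)) v :=
      HasDerivAt.comp (𝕜 := ℝ) (𝕜' := ℂ) v (h := fun v => 1 + p v)
        (differentiableAt_riemannZeta hne).hasDerivAt hpd
    have h3 := h2.fun_inv hz
    refine h3.congr_deriv ?_
    simp only [hG]
    field_simp
  have hgr := norm_le_gronwallBound_of_norm_deriv_right_le (f := G)
    (f' := fun v => deriv riemannZeta (1 + p v) / riemannZeta (1 + p v) * G v)
    (δ := 2 * T) (K := M) (ε := 0) (a := 0) (b := u - σ)
    (fun v hv => (hG' v hv).continuousAt.continuousWithinAt)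
    (fun v hv => (hG' v ⟨hv.1, hv.2.le⟩).hasDerivWithinAt)
    (by
      refine (norm_inv_riemannZeta_one_add_le (by rw [hpre]; linarith)).trans ?_
      rw [hpre, sub_zero, hu, one_div_one_div]
      linarith)
    (by
      intro v hv
      rw [norm_mul, add_zero]
      gcongr
      have hre : 0 < (p v).re := by rw [hpre]; linarith [hv.2]
      refine (hd (p v) hre).trans ?_
      have hpn : T ≤ ‖p v‖ := by
        have := Complex.abs_im_le_norm (p v); rwa [hpim] at this
      have hpl : ‖1 + p v‖ ≤ 3 * T := by
        refine (norm_add_le _ _).trans ?_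
        have := Complex.norm_le_abs_re_add_abs_im (p v)
        rw [hpre, hpim, ← hT, abs_of_pos (by linarith [hv.2] : 0 < u - v)] at this
        rw [norm_one]
        linarith [hv.1]
      rw [hM]
      gcongr
      rw [div_le_one (by linarith)]
      linarith)
    (u - σ) ⟨by linarith, le_rfl⟩
  have hps : p (u - σ) = s := by
    apply Complex.ext
    · rw [hpre]; ring
    · rw [hpim]
  rw [gronwallBound_ε0] at hgr
  simp only [hG, hps, sub_zero] at hgr
  refine hgr.trans (mul_le_mul_of_nonneg_left (Real.exp_le_exp.2 ?_) (by positivity))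
  rw [hM, hu]
  have : T * (1 / T - σ) ≤ 1 := by
    rw [mul_sub, mul_one_div_cancel hT0.ne']
    nlinarith
  nlinarith

end ZetaBound2

section SubsetSums

/-- The inclusion of the primes in the natural numbers. -/
def primesEmbedding : Nat.Primes ↪ ℕ := ⟨fun p => (p : ℕ), fun _ _ h => Subtype.ext h⟩

theorem primeFactors_prod_primes (A : Finset Nat.Primes) :
    (∏ p ∈ A, (p : ℕ)).primeFactors = A.map primesEmbedding := by
  have : ∏ p ∈ A, (p : ℕ) = ∏ p ∈ A.map primesEmbedding, p := by
    rw [Finset.prod_map]; rfl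
  rw [this, Nat.primeFactors_prod]
  intro p hp
  obtain ⟨q, -, rfl⟩ := Finset.mem_map.1 hp
  exact q.2

theorem prod_primes_ne_zero (A : Finset Nat.Primes) : ∏ p ∈ A, (p : ℕ) ≠ 0 :=
  Finset.prod_ne_zero_iff.2 fun p _ => p.2.ne_zero

theorem moebius_prod_primes (A : Finset Nat.Primes) :
    ArithmeticFunction.moebius (∏ p ∈ A, (p : ℕ)) = (-1) ^ A.card := by
  induction A using Finset.induction_on with
  | empty => simp
  | insert p A hp ih =>
    rw [Finset.prod_insert hp, ArithmeticFunction.isMultiplicative_moebius.map_mul_of_coprime, ih,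
      ArithmeticFunction.moebius_apply_prime p.2, Finset.card_insert_of_notMem hp, pow_succ]
    · ring
    · apply Nat.Coprime.prod_right
      intro q hq
      rw [Nat.coprime_primes p.2 q.2]
      rintro h
      exact hp (by rwa [Subtype.ext h])

theorem sum_moebius_mul_eq_sum_powerset (S : Finset Nat.Primes) (R : ℝ)
    (hS : ∀ p : Nat.Primes, (p : ℝ) ≤ R → p ∈ S) (F : ℕ → ℝ)
    (hF : ∀ d : ℕ, R < d → F d = 0) :
    ∑ d ∈ Finset.Icc 1 ⌊R⌋₊, (ArithmeticFunction.moebius d : ℝ) * F d =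
      ∑ A ∈ S.powerset, (-1 : ℝ) ^ A.card * F (∏ p ∈ A, (p : ℕ)) := by
  classical
  symm
  refine Finset.sum_bij_ne_zero (fun (A : Finset Nat.Primes) _ _ => ∏ p ∈ A, (p : ℕ)) ?_ ?_ ?_ ?_
  · intro A _ hne
    have hFA : F (∏ p ∈ A, (p : ℕ)) ≠ 0 := right_ne_zero_of_mul hne
    have hle : ((∏ p ∈ A, (p : ℕ) : ℕ) : ℝ) ≤ R := by
      by_contra hlt
      exact hFA (hF _ (not_le.1 hlt))
    rw [Finset.mem_Icc]
    exact ⟨Nat.one_le_iff_ne_zero.2 (prod_primes_ne_zero A), Nat.le_floor hle⟩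
  · intro A _ _ B _ _ hAB
    have := congrArg Nat.primeFactors hAB
    simp only [primeFactors_prod_primes] at this
    exact Finset.map_injective _ this
  · intro d hd hne
    have hμ : ArithmeticFunction.moebius d ≠ 0 := by
      intro h0; simp [h0] at hne
    have hsq : Squarefree d := ArithmeticFunction.moebius_ne_zero_iff_squarefree.1 hμ
    rw [Finset.mem_Icc] at hd
    have hR : (d : ℝ) ≤ R := (Nat.le_floor_iff' (by omega)).1 hd.2
    have hprod : ∏ p ∈ S.filter (fun p : Nat.Primes => (p : ℕ) ∣ d), (p : ℕ) = d := by
      conv_rhs => rw [← Nat.prod_primeFactors_of_squarefree hsq]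
      apply Finset.prod_bij (fun (p : Nat.Primes) _ => (p : ℕ))
      · intro p hp
        exact Nat.mem_primeFactors.2 ⟨p.2, (Finset.mem_filter.1 hp).2, hsq.ne_zero⟩
      · intro p _ q _ h
        exact Subtype.ext h
      · intro p hp
        obtain ⟨h1, h2, -⟩ := Nat.mem_primeFactors.1 hp
        refine ⟨⟨p, h1⟩, Finset.mem_filter.2 ⟨hS _ ?_, h2⟩, rfl⟩
        exact le_trans (by exact_mod_cast Nat.le_of_dvd (by omega) h2) hR
      · intro p _; rfl
    refine ⟨S.filter (fun p : Nat.Primes => (p : ℕ) ∣ d), Finset.mem_powerset.2 (Finset.filter_subset _ _), ?_,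
      hprod⟩
    have hμ2 := moebius_prod_primes (S.filter (fun p : Nat.Primes => (p : ℕ) ∣ d))
    rw [hprod] at hμ2 ⊢
    have hμ3 : (ArithmeticFunction.moebius d : ℝ) = (-1 : ℝ) ^
      (S.filter (fun p : Nat.Primes => (p : ℕ) ∣ d)).card := by rw [hμ2]; push_cast; rfl
    rwa [← hμ3]
  · intro A _ _
    rw [moebius_prod_primes]; push_cast; rfl

theorem primeFactors_lcm {a b : ℕ} (ha : a ≠ 0) (hb : b ≠ 0) :
    (Nat.lcm a b).primeFactors = a.primeFactors ∪ b.primeFactors := by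
  ext p
  simp only [Nat.mem_primeFactors, Finset.mem_union, Nat.lcm_ne_zero ha hb, ha, hb, ne_eq,
    not_false_eq_true, and_true, ← and_or_left]
  refine and_congr_right fun hp => ?_
  exact hp.dvd_lcm

theorem prod_primeFactors_lcm_prod_primes (g : ℕ → ℝ) (A B : Finset Nat.Primes) :
    ∏ p ∈ (Nat.lcm (∏ p ∈ A, (p : ℕ)) (∏ p ∈ B, (p : ℕ))).primeFactors, g p =
      ∏ p ∈ A ∪ B, g p := by
  classical
  rw [primeFactors_lcm (prod_primes_ne_zero A) (prod_primes_ne_zero B),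
    primeFactors_prod_primes, primeFactors_prod_primes, ← Finset.map_union, Finset.prod_map]
  rfl

theorem sum_moebius_moebius_eq_sum_powerset (S : Finset Nat.Primes) (R : ℝ)
    (hS : ∀ p : Nat.Primes, (p : ℝ) ≤ R → p ∈ S) (g : ℕ → ℝ) (W V : ℕ → ℝ)
    (hW : ∀ d : ℕ, R < d → W d = 0) (hV : ∀ d : ℕ, R < d → V d = 0) :
    ∑ d₁ ∈ Finset.Icc 1 ⌊R⌋₊, ∑ d₂ ∈ Finset.Icc 1 ⌊R⌋₊,
      (ArithmeticFunction.moebius d₁ : ℝ) * (ArithmeticFunction.moebius d₂ : ℝ) *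
        (W d₁ * V d₂ * ∏ p ∈ (Nat.lcm d₁ d₂).primeFactors, g p) =
    ∑ A ∈ S.powerset, ∑ B ∈ S.powerset, (-1 : ℝ) ^ A.card * (-1 : ℝ) ^ B.card *
      (W (∏ p ∈ A, (p : ℕ)) * V (∏ p ∈ B, (p : ℕ)) * ∏ p ∈ A ∪ B, g p) := by
  calc _ = ∑ d₁ ∈ Finset.Icc 1 ⌊R⌋₊, (ArithmeticFunction.moebius d₁ : ℝ) *
        (W d₁ * ∑ d₂ ∈ Finset.Icc 1 ⌊R⌋₊, (ArithmeticFunction.moebius d₂ : ℝ) *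
          (V d₂ * ∏ p ∈ (Nat.lcm d₁ d₂).primeFactors, g p)) := by
        refine Finset.sum_congr rfl fun d₁ _ => ?_
        rw [Finset.mul_sum, Finset.mul_sum]
        refine Finset.sum_congr rfl fun d₂ _ => ?_
        ring
    _ = _ := by
        rw [sum_moebius_mul_eq_sum_powerset S R hS]
        · refine Finset.sum_congr rfl fun A _ => ?_
          rw [sum_moebius_mul_eq_sum_powerset S R hS]
          · rw [Finset.mul_sum, Finset.mul_sum]
            refine Finset.sum_congr rfl fun B _ => ?_
            rw [prod_primeFactors_lcm_prod_primes]
            ring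
          · intro d hd; rw [hV d hd, zero_mul]
        · intro d hd; rw [hW d hd, zero_mul]

theorem sum_powerset_powerset_eq_prod {ι : Type*} [DecidableEq ι] (S : Finset ι)
    (g x y : ι → ℂ) :
    ∑ A ∈ S.powerset, ∑ B ∈ S.powerset, (-1 : ℂ) ^ A.card * (-1 : ℂ) ^ B.card *
      ((∏ p ∈ A, x p) * (∏ p ∈ B, y p) * ∏ p ∈ A ∪ B, g p) =
    ∏ p ∈ S, (1 - g p * (x p + y p - x p * y p)) := by
  induction S using Finset.induction_on with
  | empty => simp
  | insert q S hq ih =>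
    rw [Finset.prod_insert hq, ← ih, Finset.sum_powerset_insert hq]
    simp only [Finset.sum_powerset_insert hq]
    rw [← Finset.sum_add_distrib, Finset.mul_sum]
    refine Finset.sum_congr rfl fun A hA => ?_
    rw [← Finset.sum_add_distrib, ← Finset.sum_add_distrib, ← Finset.sum_add_distrib,
      Finset.mul_sum]
    refine Finset.sum_congr rfl fun B hB => ?_
    have hqA : q ∉ A := fun h => hq (Finset.mem_powerset.1 hA h)
    have hqB : q ∉ B := fun h => hq (Finset.mem_powerset.1 hB h)
    have hqAB : q ∉ A ∪ B := by simp [hqA, hqB]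
    rw [← Finset.insert_union_distrib, Finset.insert_union, Finset.union_insert,
      Finset.card_insert_of_notMem hqA,
      Finset.card_insert_of_notMem hqB, Finset.prod_insert hqA, Finset.prod_insert hqB,
      Finset.prod_insert hqAB, pow_succ, pow_succ]
    ring

end SubsetSums

section IntegralRepresentation

open MeasureTheory Topology

/-- The kernel `e^z z^{-(a+1)}` on the line `z = 1 + iξ`. -/
noncomputable def perronKernel (a : ℕ) (ξ : ℝ) : ℂ :=
  Complex.exp (1 + Complex.I * ξ) * ((1 : ℂ) + Complex.I * ξ)⁻¹ ^ (a + 1)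

/-- The point `(1 + iξ)/L`. -/
noncomputable def linePoint (L ξ : ℝ) : ℂ := (1 + Complex.I * ξ) / L

/-- The deviation from `1` of the local factor at `p` of the two-variable Euler product. -/
noncomputable def localTerm (g : ℕ → ℝ) (s t : ℂ) (p : ℕ) : ℂ :=
  -((g p : ℂ) * ((p : ℂ) ^ (-s) + (p : ℂ) ^ (-t) - (p : ℂ) ^ (-s) * (p : ℂ) ^ (-t)))

theorem linePoint_re (L ξ : ℝ) : (linePoint L ξ).re = 1 / L := by
  rw [linePoint, Complex.div_ofReal_re]; simp

theorem continuous_linePoint (L : ℝ) : Continuous (linePoint L) := by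
  unfold linePoint; fun_prop

theorem integrable_perronKernel {a : ℕ} (ha : 1 ≤ a) : Integrable (perronKernel a) := by
  refine (integrable_inv_one_add_I_mul_pow ha).bdd_mul (c := Real.exp 1) ?_ ?_
  · exact (by fun_prop : Continuous fun ξ : ℝ =>
      Complex.exp (1 + Complex.I * ξ)).aestronglyMeasurable
  · exact ae_of_all _ fun ξ => by simp [Complex.norm_exp]

theorem norm_natCast_cpow_neg_linePoint {L : ℝ} {d : ℕ} (hd : 0 < d) (ξ : ℝ) :
    ‖(d : ℂ) ^ (-linePoint L ξ)‖ = (d : ℝ) ^ (-(1 / L)) := by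
  rw [Complex.norm_natCast_cpow_of_pos hd, Complex.neg_re, linePoint_re]

theorem continuous_natCast_cpow_neg_linePoint (L : ℝ) {d : ℕ} (hd : 0 < d) :
    Continuous fun ξ : ℝ => (d : ℂ) ^ (-linePoint L ξ) := by
  have hd' : (d : ℂ) ≠ 0 := by exact_mod_cast hd.ne'
  exact (continuous_linePoint L).neg.const_cpow (Or.inl hd')

theorem integrable_perronKernel_mul_cpow {a : ℕ} (ha : 1 ≤ a) (L : ℝ) {d : ℕ} (hd : 0 < d) :
    Integrable fun ξ : ℝ => perronKernel a ξ * (d : ℂ) ^ (-linePoint L ξ) := by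
  refine (integrable_perronKernel ha).mul_bdd (c := (d : ℝ) ^ (-(1 / L)))
    (continuous_natCast_cpow_neg_linePoint L hd).aestronglyMeasurable ?_
  exact ae_of_all _ fun ξ => (norm_natCast_cpow_neg_linePoint hd ξ).le

theorem max_log_pow_eq_integral {a : ℕ} (ha : 1 ≤ a) {L : ℝ} (hL : 0 < L) {d : ℕ} (hd : 0 < d) :
    ((max (L - Real.log d) 0 ^ a / a.factorial : ℝ) : ℂ) =
      (L : ℂ) ^ a / (2 * Real.pi) * ∫ ξ : ℝ, perronKernel a ξ * (d : ℂ) ^ (-linePoint L ξ) := by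
  have hP := integral_exp_mul_inv_pow ha (1 - Real.log d / L)
  have hLc : (L : ℂ) ≠ 0 := by exact_mod_cast hL.ne'
  have hd' : (d : ℂ) ≠ 0 := by exact_mod_cast hd.ne'
  have hpt : ∀ ξ : ℝ, Complex.exp ((1 - Real.log d / L : ℝ) * (1 + Complex.I * ξ)) *
      ((1 : ℂ) + Complex.I * ξ)⁻¹ ^ (a + 1) = perronKernel a ξ * (d : ℂ) ^ (-linePoint L ξ) := by
    intro ξ
    rw [perronKernel, Complex.cpow_def_of_ne_zero hd', ← Complex.natCast_log, mul_right_comm,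
      ← Complex.exp_add, linePoint]
    congr 2
    push_cast
    field_simp
    ring
  simp_rw [hpt] at hP
  rw [hP]
  have hmax : max (L - Real.log d) 0 = L * max (1 - Real.log d / L) 0 := by
    rw [mul_max_of_nonneg _ _ hL.le, mul_zero, mul_sub, mul_div_cancel₀ _ hL.ne', mul_one]
  rw [hmax, mul_pow]
  have hpi : (Real.pi : ℂ) ≠ 0 := by exact_mod_cast Real.pi_ne_zero
  push_cast
  field_simp

theorem natCast_prod_cpow (A : Finset Nat.Primes) (s : ℂ) :
    ((∏ p ∈ A, (p : ℕ) : ℕ) : ℂ) ^ s = ∏ p ∈ A, ((p : ℕ) : ℂ) ^ s := by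
  induction A using Finset.induction_on with
  | empty => simp
  | insert p A hp ih =>
    rw [Finset.prod_insert hp, Finset.prod_insert hp, ← ih, Nat.cast_mul,
      Complex.natCast_mul_natCast_cpow]

theorem sum_powerset_eq_integral {a b : ℕ} (ha : 1 ≤ a) (hb : 1 ≤ b) {L : ℝ} (hL : 0 < L)
    (g : ℕ → ℝ) (S : Finset Nat.Primes) :
    ((∑ A ∈ S.powerset, ∑ B ∈ S.powerset, (-1 : ℝ) ^ A.card * (-1 : ℝ) ^ B.card *
      ((max (L - Real.log (∏ p ∈ A, (p : ℕ) : ℕ)) 0 ^ a / a.factorial) *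
        (max (L - Real.log (∏ p ∈ B, (p : ℕ) : ℕ)) 0 ^ b / b.factorial) *
        ∏ p ∈ A ∪ B, g p) : ℝ) : ℂ) =
    (L : ℂ) ^ (a + b) / (2 * Real.pi) ^ 2 * ∫ ξ : ℝ × ℝ, perronKernel a ξ.1 * perronKernel b ξ.2 *
      ∏ p ∈ S, (1 + localTerm g (linePoint L ξ.1) (linePoint L ξ.2) p) := by
  have hpos : ∀ A : Finset Nat.Primes, 0 < ∏ p ∈ A, (p : ℕ) := fun A =>
    Nat.pos_of_ne_zero (prod_primes_ne_zero A)
  have hpt : ∀ ξ : ℝ × ℝ, perronKernel a ξ.1 * perronKernel b ξ.2 *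
      ∏ p ∈ S, (1 + localTerm g (linePoint L ξ.1) (linePoint L ξ.2) p) =
      ∑ A ∈ S.powerset, ∑ B ∈ S.powerset, ((-1 : ℂ) ^ A.card * (-1 : ℂ) ^ B.card *
        ∏ p ∈ A ∪ B, (g p : ℂ)) *
      ((perronKernel a ξ.1 * ((∏ p ∈ A, (p : ℕ) : ℕ) : ℂ) ^ (-linePoint L ξ.1)) *
        (perronKernel b ξ.2 * ((∏ p ∈ B, (p : ℕ) : ℕ) : ℂ) ^ (-linePoint L ξ.2))) := by
    intro ξ
    have h1 : ∏ p ∈ S, (1 + localTerm g (linePoint L ξ.1) (linePoint L ξ.2) p) =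
        ∏ p ∈ S, (1 - (g p : ℂ) * (((p : ℕ) : ℂ) ^ (-linePoint L ξ.1) +
          ((p : ℕ) : ℂ) ^ (-linePoint L ξ.2) - ((p : ℕ) : ℂ) ^ (-linePoint L ξ.1) *
          ((p : ℕ) : ℂ) ^ (-linePoint L ξ.2))) := by
      refine Finset.prod_congr rfl fun p _ => ?_
      rw [localTerm]; ring
    rw [h1, ← sum_powerset_powerset_eq_prod S (fun p => (g p : ℂ)), Finset.mul_sum]
    refine Finset.sum_congr rfl fun A _ => ?_
    rw [Finset.mul_sum]
    refine Finset.sum_congr rfl fun B _ => ?_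
    rw [natCast_prod_cpow, natCast_prod_cpow]
    ring
  have hint : ∀ A B : Finset Nat.Primes, Integrable fun ξ : ℝ × ℝ =>
      ((perronKernel a ξ.1 * ((∏ p ∈ A, (p : ℕ) : ℕ) : ℂ) ^ (-linePoint L ξ.1)) *
        (perronKernel b ξ.2 * ((∏ p ∈ B, (p : ℕ) : ℕ) : ℂ) ^ (-linePoint L ξ.2))) := fun A B =>
    (integrable_perronKernel_mul_cpow ha L (hpos A)).mul_prod
      (integrable_perronKernel_mul_cpow hb L (hpos B))
  simp_rw [hpt]
  rw [integral_finsetSum _ fun A _ => integrable_finsetSum _ fun B _ => (hint A B).const_mul _,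
    Finset.mul_sum]
  simp only [Complex.ofReal_sum, Complex.ofReal_mul, Complex.ofReal_pow, Complex.ofReal_neg,
    Complex.ofReal_one, Complex.ofReal_prod]
  refine Finset.sum_congr rfl fun A _ => ?_
  rw [integral_finsetSum _ fun B _ => (hint A B).const_mul _, Finset.mul_sum]
  refine Finset.sum_congr rfl fun B _ => ?_
  have hA := max_log_pow_eq_integral ha hL (hpos A)
  have hB := max_log_pow_eq_integral hb hL (hpos B)
  rw [integral_const_mul, Measure.volume_eq_prod, integral_prod_mul
    (f := fun x : ℝ => perronKernel a x * ((∏ p ∈ A, (p : ℕ) : ℕ) : ℂ) ^ (-linePoint L x))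
    (g := fun x : ℝ => perronKernel b x * ((∏ p ∈ B, (p : ℕ) : ℕ) : ℂ) ^ (-linePoint L x))]
  rw [hA, hB, pow_add]
  ring

theorem norm_localTerm_le {g : ℕ → ℝ} {D L : ℝ} (hL : 0 < L)
    (hg : ∀ p : ℕ, p.Prime → |g p| ≤ D / p) (ξ η : ℝ) (p : Nat.Primes) :
    ‖localTerm g (linePoint L ξ) (linePoint L η) p‖ ≤ 3 * D * (p : ℝ) ^ (-1 - 1 / L) := by
  have hp := p.2.pos
  have hp1 : (1 : ℝ) ≤ (p : ℕ) := by exact_mod_cast p.2.one_le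
  have hp0 : (0 : ℝ) < (p : ℕ) := by linarith
  rw [localTerm, norm_neg, norm_mul, Complex.norm_real, Real.norm_eq_abs]
  set X := (p : ℝ) ^ (-(1 / L)) with hX
  have hX0 : 0 ≤ X := by positivity
  have hX1 : X ≤ 1 := Real.rpow_le_one_of_one_le_of_nonpos hp1 (by simp; exact hL.le)
  have h1 := norm_natCast_cpow_neg_linePoint (L := L) hp ξ
  have h2 := norm_natCast_cpow_neg_linePoint (L := L) hp η
  have h3 : ‖((p : ℕ) : ℂ) ^ (-linePoint L ξ) + ((p : ℕ) : ℂ) ^ (-linePoint L η) -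
      ((p : ℕ) : ℂ) ^ (-linePoint L ξ) * ((p : ℕ) : ℂ) ^ (-linePoint L η)‖ ≤ 3 * X := by
    refine (norm_sub_le _ _).trans ?_
    refine (add_le_add (norm_add_le _ _) le_rfl).trans ?_
    rw [norm_mul, h1, h2, ← hX]
    nlinarith
  have hD : 0 ≤ D / (p : ℕ) := (abs_nonneg _).trans (hg p p.2)
  calc |g p| * _ ≤ D / (p : ℕ) * (3 * X) := mul_le_mul (hg p p.2) h3 (norm_nonneg _) hD
    _ = _ := by
      rw [sub_eq_add_neg, Real.rpow_add hp0, Real.rpow_neg_one]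
      ring

theorem summable_primes_rpow {L : ℝ} (hL : 0 < L) (c : ℝ) :
    Summable fun p : Nat.Primes => c * (p : ℝ) ^ (-1 - 1 / L) := by
  apply Summable.mul_left
  rw [Nat.Primes.summable_rpow]
  have : 0 < 1 / L := by positivity
  linarith

theorem continuous_localTerm (g : ℕ → ℝ) (L : ℝ) (p : Nat.Primes) :
    Continuous fun ξ : ℝ × ℝ => localTerm g (linePoint L ξ.1) (linePoint L ξ.2) p := by
  have h := continuous_natCast_cpow_neg_linePoint L p.2.pos
  have h1 : Continuous fun ξ : ℝ × ℝ => ((p : ℕ) : ℂ) ^ (-linePoint L ξ.1) :=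
    h.comp continuous_fst
  have h2 : Continuous fun ξ : ℝ × ℝ => ((p : ℕ) : ℂ) ^ (-linePoint L ξ.2) :=
    h.comp continuous_snd
  exact (continuous_const.mul ((h1.add h2).sub (h1.mul h2))).neg

theorem multipliable_localTerm {g : ℕ → ℝ} {D L : ℝ} (hL : 0 < L)
    (hg : ∀ p : ℕ, p.Prime → |g p| ≤ D / p) (ξ η : ℝ) :
    Multipliable fun p : Nat.Primes => 1 + localTerm g (linePoint L ξ) (linePoint L η) p :=
  multipliable_one_add_of_summable <| (summable_primes_rpow hL (3 * D)).of_nonneg_of_le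
    (fun _ => norm_nonneg _) (norm_localTerm_le hL hg ξ η)

theorem norm_prod_one_add_le {ι : Type*} (S : Finset ι) (f : ι → ℂ) :
    ‖∏ i ∈ S, (1 + f i)‖ ≤ Real.exp (∑ i ∈ S, ‖f i‖) := by
  have := Finset.norm_prod_one_add_sub_one_le S f
  have h2 := norm_add_le (∏ i ∈ S, (1 + f i) - 1) 1
  rw [sub_add_cancel, norm_one] at h2
  linarith

theorem tendsto_integral_prod {a b : ℕ} (ha : 1 ≤ a) (hb : 1 ≤ b) {g : ℕ → ℝ} {D L : ℝ}
    (hL : 0 < L) (hg : ∀ p : ℕ, p.Prime → |g p| ≤ D / p) :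
    Tendsto (fun S : Finset Nat.Primes => ∫ ξ : ℝ × ℝ, perronKernel a ξ.1 * perronKernel b ξ.2 *
      ∏ p ∈ S, (1 + localTerm g (linePoint L ξ.1) (linePoint L ξ.2) p)) atTop
    (𝓝 (∫ ξ : ℝ × ℝ, perronKernel a ξ.1 * perronKernel b ξ.2 *
      ∏' p : Nat.Primes, (1 + localTerm g (linePoint L ξ.1) (linePoint L ξ.2) p))) := by
  have hK : Integrable (fun ξ : ℝ × ℝ => perronKernel a ξ.1 * perronKernel b ξ.2) :=
    (integrable_perronKernel ha).mul_prod (integrable_perronKernel hb)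
  set M := Real.exp (∑' p : Nat.Primes, 3 * D * (p : ℝ) ^ (-1 - 1 / L))
  refine tendsto_integral_filter_of_dominated_convergence
    (fun ξ => ‖perronKernel a ξ.1 * perronKernel b ξ.2‖ * M) ?_ ?_ (hK.norm.mul_const _) ?_
  · refine Eventually.of_forall fun S => hK.1.mul ?_
    exact (continuous_finsetProd S fun p _ =>
      continuous_const.add (continuous_localTerm g L p)).aestronglyMeasurable
  · refine Eventually.of_forall fun S => ae_of_all _ fun ξ => ?_
    rw [norm_mul]
    gcongr
    refine (norm_prod_one_add_le _ _).trans (Real.exp_le_exp.2 ?_)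
    refine (Finset.sum_le_sum fun p _ => norm_localTerm_le hL hg ξ.1 ξ.2 p).trans ?_
    exact (summable_primes_rpow hL (3 * D)).sum_le_tsum _ fun p _ =>
      (norm_nonneg _).trans (norm_localTerm_le hL hg ξ.1 ξ.2 p)
  · refine ae_of_all _ fun ξ => ?_
    exact (multipliable_localTerm hL hg ξ.1 ξ.2).hasProd.const_mul _

end IntegralRepresentation

section SelbergSum

open MeasureTheory Topology

theorem sum_moebius_mul_log_pow_eq_integral {a b : ℕ} (ha : 1 ≤ a) (hb : 1 ≤ b) {g : ℕ → ℝ}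
    {D R : ℝ} (hR : 1 < R) (hg : ∀ p : ℕ, p.Prime → |g p| ≤ D / p) :
    ((∑ d₁ ∈ Finset.Icc 1 ⌊R⌋₊, ∑ d₂ ∈ Finset.Icc 1 ⌊R⌋₊,
      (ArithmeticFunction.moebius d₁ : ℝ) * (ArithmeticFunction.moebius d₂ : ℝ) *
        ((Real.log (R / d₁) ^ a / a.factorial) * (Real.log (R / d₂) ^ b / b.factorial) *
          ∏ p ∈ (Nat.lcm d₁ d₂).primeFactors, g p) : ℝ) : ℂ) =
    (Real.log R : ℂ) ^ (a + b) / (2 * Real.pi) ^ 2 * ∫ ξ : ℝ × ℝ,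
      perronKernel a ξ.1 * perronKernel b ξ.2 * ∏' p : Nat.Primes,
        (1 + localTerm g (linePoint (Real.log R) ξ.1) (linePoint (Real.log R) ξ.2) p) := by
  have hL : 0 < Real.log R := Real.log_pos hR
  have hR0 : 0 < R := by linarith
  set W : ℕ → ℕ → ℝ := fun c d => max (Real.log R - Real.log d) 0 ^ c / c.factorial with hWdef
  have hW0 : ∀ c : ℕ, 1 ≤ c → ∀ d : ℕ, R < d → W c d = 0 := by
    intro c hc d hd
    have : Real.log R - Real.log d ≤ 0 := sub_nonpos.2 (Real.log_le_log hR0 hd.le)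
    simp only [hWdef, max_eq_right this, zero_pow (by omega : c ≠ 0), zero_div]
  have hWlog : ∀ c : ℕ, ∀ d ∈ Finset.Icc 1 ⌊R⌋₊,
      Real.log (R / d) ^ c / c.factorial = W c d := by
    intro c d hd
    rw [Finset.mem_Icc] at hd
    have hd1 : (0 : ℝ) < d := by exact_mod_cast hd.1
    have hdR : (d : ℝ) ≤ R := (Nat.le_floor_iff hR0.le).1 hd.2
    have : 0 ≤ Real.log R - Real.log d := sub_nonneg.2 (Real.log_le_log hd1 hdR)
    simp only [hWdef, max_eq_left this, Real.log_div hR0.ne' hd1.ne']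
  obtain ⟨S₀, hS₀⟩ : ∃ S₀ : Finset Nat.Primes, ∀ p : Nat.Primes, (p : ℝ) ≤ R → p ∈ S₀ := by
    have hfin : {p : Nat.Primes | (p : ℝ) ≤ R}.Finite := by
      refine Set.Finite.of_finite_image (f := fun p : Nat.Primes => (p : ℕ))
        ((Set.finite_Iic ⌊R⌋₊).subset ?_) (fun p _ q _ h => Subtype.ext h)
      rintro _ ⟨p, hp, rfl⟩
      exact Nat.le_floor hp
    exact ⟨hfin.toFinset, fun p hp => hfin.mem_toFinset.2 hp⟩
  refine tendsto_nhds_unique (tendsto_const_nhds.congr' ?_)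
    ((tendsto_integral_prod ha hb hL hg).const_mul _)
  filter_upwards [eventually_ge_atTop S₀] with S hS
  rw [← sum_powerset_eq_integral ha hb hL g S]
  congr 1
  rw [← sum_moebius_moebius_eq_sum_powerset S R (fun p hp => hS (hS₀ p hp)) g (W a) (W b)
    (hW0 a ha) (hW0 b hb)]
  refine Finset.sum_congr rfl fun d₁ h₁ => Finset.sum_congr rfl fun d₂ h₂ => ?_
  rw [hWlog a d₁ h₁, hWlog b d₂ h₂]

end SelbergSum

section EulerProduct

open MeasureTheory Topology Asymptotics

/-- `a = 1 + c + O(u²)` with `c = O(u)`, uniformly along `l`. -/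
def IsNearOne {X : Type*} (l : Filter X) (u : X → ℝ) (a c : X → ℂ) : Prop :=
  c =O[l] u ∧ (fun i => a i - 1 - c i) =O[l] fun i => u i ^ 2

namespace IsNearOne

variable {X : Type*} {l : Filter X} {u : X → ℝ} {a b c d : X → ℂ}

theorem sub_one_isBigO (hu : u =O[l] fun _ => (1 : ℝ)) (ha : IsNearOne l u a c) :
    (fun i => a i - 1) =O[l] u := by
  have h2 : (fun i => u i ^ 2) =O[l] u := by
    simpa [pow_two] using hu.mul (isBigO_refl u l)
  simpa using (ha.2.trans h2).add ha.1

theorem mul (hu : u =O[l] fun _ => (1 : ℝ)) (ha : IsNearOne l u a c) (hb : IsNearOne l u b d) :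
    IsNearOne l u (fun i => a i * b i) (fun i => c i + d i) := by
  refine ⟨ha.1.add hb.1, ?_⟩
  have h1 : (fun i => (a i - 1) * (b i - 1)) =O[l] fun i => u i ^ 2 := by
    simpa [pow_two] using (ha.sub_one_isBigO hu).mul (hb.sub_one_isBigO hu)
  refine ((ha.2.add hb.2).add h1).congr_left fun i => ?_
  ring

theorem pow (hu : u =O[l] fun _ => (1 : ℝ)) (ha : IsNearOne l u a c) (n : ℕ) :
    IsNearOne l u (fun i => a i ^ n) (fun i => n * c i) := by
  induction n with
  | zero =>
    constructor
    · simpa using isBigO_zero _ _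
    · simpa using isBigO_zero _ _
  | succ n ih =>
    have := ih.mul hu ha
    simpa [pow_succ, add_mul] using this

theorem one_add (hc : c =O[l] u) : IsNearOne l u (fun i => 1 + c i) c :=
  ⟨hc, by simpa using isBigO_zero _ _⟩

end IsNearOne

/-- The deviation from `1` of the local factor at `p`, after the zeta factors have been
divided out. -/
noncomputable def regularizedTerm (g : ℕ → ℝ) (κ p : ℕ) (x y : ℂ) : ℂ :=
  (1 - (g p : ℂ) * (x + y - x * y)) * (1 - x / p)⁻¹ ^ κ * (1 - y / p)⁻¹ ^ κ *
    (1 - x * y / p) ^ κ - 1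

theorem one_half_le_norm_one_sub_div {p : ℕ} (hp : p.Prime) {x : ℂ} (hx : ‖x‖ ≤ 1) :
    1 / 2 ≤ ‖1 - x / p‖ := by
  have hp2 : (2 : ℝ) ≤ p := by exact_mod_cast hp.two_le
  have h1 : ‖x / (p : ℂ)‖ ≤ 1 / 2 := by
    rw [norm_div, Complex.norm_natCast]
    exact div_le_div₀ zero_le_one hx two_pos hp2
  have h2 := norm_sub_norm_le (1 : ℂ) (x / p)
  rw [norm_one] at h2
  linarith

theorem exists_norm_regularizedTerm_le {g : ℕ → ℝ} {κ : ℕ} {C : ℝ}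
    (hg : ∀ p : ℕ, p.Prime → |g p - κ / p| ≤ C / p ^ 2) :
    ∃ M : ℝ, 0 ≤ M ∧ ∀ (p : Nat.Primes) (x y : ℂ), ‖x‖ ≤ 1 → ‖y‖ ≤ 1 →
      ‖regularizedTerm g κ p x y‖ ≤ M / (p : ℝ) ^ 2 := by
  let X := {i : Nat.Primes × ℂ × ℂ // ‖i.2.1‖ ≤ 1 ∧ ‖i.2.2‖ ≤ 1}
  let P : X → ℕ := fun i => i.1.1
  let x : X → ℂ := fun i => i.1.2.1
  let y : X → ℂ := fun i => i.1.2.2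
  let u : X → ℝ := fun i => (P i : ℝ)⁻¹
  have hP : ∀ i, (P i).Prime := fun i => i.1.1.2
  have hx : ∀ i, ‖x i‖ ≤ 1 := fun i => i.2.1
  have hy : ∀ i, ‖y i‖ ≤ 1 := fun i => i.2.2
  have hx1 : x =O[⊤] fun _ => (1 : ℝ) :=
    IsBigO.of_bound 1 (Eventually.of_forall fun i => by simpa using hx i)
  have hy1 : y =O[⊤] fun _ => (1 : ℝ) :=
    IsBigO.of_bound 1 (Eventually.of_forall fun i => by simpa using hy i)
  have hxy1 : (fun i => x i * y i) =O[⊤] fun _ => (1 : ℝ) := by simpa using hx1.mul hy1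
  have hu : u =O[⊤] fun _ => (1 : ℝ) := by
    refine IsBigO.of_bound 1 (Eventually.of_forall fun i => ?_)
    have : (1 : ℝ) ≤ P i := by exact_mod_cast (hP i).one_le
    simpa [u] using inv_le_one_of_one_le₀ this
  have hinv : (fun i => ((P i : ℂ))⁻¹) =O[⊤] u :=
    IsBigO.of_bound 1 (Eventually.of_forall fun i => by simp [u])
  have hdiv : ∀ z : X → ℂ, z =O[⊤] (fun _ => (1 : ℝ)) →
      (fun i => z i / (P i : ℂ)) =O[⊤] u := by
    intro z hz
    simpa [div_eq_mul_inv] using hz.mul hinv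
  have hone : ∀ z : X → ℂ, (∀ i, ‖z i‖ ≤ 1) →
      IsNearOne ⊤ u (fun i => (1 - z i / (P i : ℂ))⁻¹) (fun i => z i / (P i : ℂ)) := by
    intro z hz
    have hz1 : z =O[⊤] fun _ => (1 : ℝ) :=
      IsBigO.of_bound 1 (Eventually.of_forall fun i => by simpa using hz i)
    refine ⟨hdiv z hz1, ?_⟩
    have h1 : (fun i => (1 - z i / (P i : ℂ))⁻¹) =O[⊤] fun _ => (1 : ℝ) := by
      refine IsBigO.of_bound 2 (Eventually.of_forall fun i => ?_)
      have := one_half_le_norm_one_sub_div (hP i) (hz i)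
      rw [norm_inv, norm_one, mul_one]
      calc _ ≤ (1 / 2 : ℝ)⁻¹ := inv_anti₀ (by norm_num) this
        _ = 2 := by norm_num
    have h2 := (((hdiv z hz1).mul (hdiv z hz1)).mul h1)
    refine (h2.congr_left fun i => ?_).congr_right fun i => by rw [mul_one, pow_two]
    have h3 : 1 - z i / (P i : ℂ) ≠ 0 := by
      intro h0
      have := one_half_le_norm_one_sub_div (hP i) (hz i)
      rw [h0, norm_zero] at this
      norm_num at this
    field_simp
    ring
  have hG : IsNearOne ⊤ u (fun i => 1 - (g (P i) : ℂ) * (x i + y i - x i * y i))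
      (fun i => -(κ * ((x i + y i - x i * y i) / (P i : ℂ)))) := by
    have h1 : (fun i => x i + y i - x i * y i) =O[⊤] fun _ => (1 : ℝ) := (hx1.add hy1).sub hxy1
    refine ⟨((hdiv _ h1).const_mul_left _).neg_left, ?_⟩
    have h2 : (fun i => ((g (P i) - κ / P i : ℝ) : ℂ)) =O[⊤] fun i => u i ^ 2 := by
      refine IsBigO.of_bound C (Eventually.of_forall fun i => ?_)
      rw [Complex.norm_real, Real.norm_eq_abs]
      refine (hg _ (hP i)).trans (le_of_eq ?_)
      simp [u, div_eq_mul_inv]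
    refine ((h2.mul h1).neg_left.congr_left fun i => ?_).congr_right fun i => by rw [mul_one]
    push_cast
    ring
  have hC : IsNearOne ⊤ u (fun i => 1 + -(x i * y i / (P i : ℂ)))
      (fun i => -(x i * y i / (P i : ℂ))) := IsNearOne.one_add (hdiv _ hxy1).neg_left
  have hall := (((hG.mul hu ((hone x hx).pow hu κ)).mul hu ((hone y hy).pow hu κ)).mul hu
    (hC.pow hu κ)).2
  obtain ⟨M, hM⟩ := hall.bound
  refine ⟨max M 0, le_max_right _ _, fun p x' y' hx' hy' => ?_⟩
  have := (eventually_top.1 hM) ⟨(p, x', y'), hx', hy'⟩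
  simp only [P, x, y, u] at this
  calc ‖regularizedTerm g κ p x' y'‖ ≤ M / (p : ℝ) ^ 2 := by
        convert this using 1
        · rw [regularizedTerm]
          congr 1
          ring
        · simp [div_eq_mul_inv]
    _ ≤ _ := by gcongr; exact le_max_left _ _

end EulerProduct

section EulerProductLimit

open MeasureTheory Topology

theorem norm_natCast_cpow_neg_le_one {s : ℂ} (hs : 0 ≤ s.re) {p : ℕ} (hp : 0 < p) :
    ‖(p : ℂ) ^ (-s)‖ ≤ 1 := by
  rw [Complex.norm_natCast_cpow_of_pos hp]
  exact Real.rpow_le_one_of_one_le_of_nonpos (by exact_mod_cast hp) (by simpa using hs)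

theorem hasProd_pow {ι : Type*} {f : ι → ℂ} {z : ℂ} (h : HasProd f z) (n : ℕ) :
    HasProd (fun i => f i ^ n) (z ^ n) := by
  induction n with
  | zero => simp
  | succ n ih => simpa [pow_succ] using ih.mul h

theorem summable_primes_div_sq (M : ℝ) : Summable fun p : Nat.Primes => M / (p : ℝ) ^ 2 := by
  have h : Summable fun p : Nat.Primes => (p : ℝ) ^ (-2 : ℝ) :=
    Nat.Primes.summable_rpow.2 (by norm_num)
  refine (h.mul_left M).congr fun p => ?_
  rw [Real.rpow_neg (by positivity), Real.rpow_ofNat, div_eq_mul_inv]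

theorem one_sub_div_ne_zero {p : ℕ} (hp : p.Prime) {x : ℂ} (hx : ‖x‖ ≤ 1) :
    1 - x / p ≠ 0 := by
  intro h0
  have := one_half_le_norm_one_sub_div hp hx
  rw [h0, norm_zero] at this
  norm_num at this

theorem tprod_localTerm_mul_zeta_pow {g : ℕ → ℝ} {κ : ℕ} {D M L : ℝ} (hL : 0 < L)
    (hg : ∀ p : ℕ, p.Prime → |g p| ≤ D / p)
    (hM : ∀ (p : Nat.Primes) (x y : ℂ), ‖x‖ ≤ 1 → ‖y‖ ≤ 1 →
      ‖regularizedTerm g κ p x y‖ ≤ M / (p : ℝ) ^ 2) (ξ η : ℝ) :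
    (∏' p : Nat.Primes, (1 + localTerm g (linePoint L ξ) (linePoint L η) p)) *
      riemannZeta (1 + linePoint L ξ) ^ κ * riemannZeta (1 + linePoint L η) ^ κ =
    (∏' p : Nat.Primes, (1 + regularizedTerm g κ p (((p : ℕ) : ℂ) ^ (-linePoint L ξ))
      (((p : ℕ) : ℂ) ^ (-linePoint L η)))) *
      riemannZeta (1 + (linePoint L ξ + linePoint L η)) ^ κ := by
  set s := linePoint L ξ with hs
  set t := linePoint L η with ht
  have hs0 : 0 < s.re := by rw [hs, linePoint_re]; positivity
  have ht0 : 0 < t.re := by rw [ht, linePoint_re]; positivity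
  have hx : ∀ p : Nat.Primes, ‖((p : ℕ) : ℂ) ^ (-s)‖ ≤ 1 := fun p =>
    norm_natCast_cpow_neg_le_one hs0.le p.2.pos
  have hy : ∀ p : Nat.Primes, ‖((p : ℕ) : ℂ) ^ (-t)‖ ≤ 1 := fun p =>
    norm_natCast_cpow_neg_le_one ht0.le p.2.pos
  have hF := (multipliable_localTerm hL hg ξ η).hasProd
  have hE : Multipliable fun p : Nat.Primes => 1 + regularizedTerm g κ p
      (((p : ℕ) : ℂ) ^ (-s)) (((p : ℕ) : ℂ) ^ (-t)) :=
    multipliable_one_add_of_summable <| (summable_primes_div_sq M).of_nonneg_of_le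
      (fun _ => norm_nonneg _) (fun p => hM p _ _ (hx p) (hy p))
  have hA := hasProd_pow (riemannZeta_eulerProduct_hasProd (s := 1 + s) (by simpa using hs0)) κ
  have hB := hasProd_pow (riemannZeta_eulerProduct_hasProd (s := 1 + t) (by simpa using ht0)) κ
  have hC := hasProd_pow (riemannZeta_eulerProduct_hasProd (s := 1 + (s + t))
    (by simpa using add_pos hs0 ht0)) κ
  refine ((hF.mul hA).mul hB).unique ?_
  convert hE.hasProd.mul hC using 1
  funext p
  have hp0 : ((p : ℕ) : ℂ) ≠ 0 := by exact_mod_cast p.2.ne_zero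
  have h1 : ∀ w : ℂ, ((p : ℕ) : ℂ) ^ (-(1 + w)) = ((p : ℕ) : ℂ) ^ (-w) / (p : ℕ) := by
    intro w
    rw [neg_add, Complex.cpow_add _ _ hp0, Complex.cpow_neg_one, div_eq_inv_mul]
  have h2 : ((p : ℕ) : ℂ) ^ (-(1 + (s + t))) =
      ((p : ℕ) : ℂ) ^ (-s) * ((p : ℕ) : ℂ) ^ (-t) / (p : ℕ) := by
    rw [h1, neg_add, Complex.cpow_add _ _ hp0]
  rw [h1 s, h1 t, h2, regularizedTerm, localTerm, ← hs, ← ht]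
  set x := ((p : ℕ) : ℂ) ^ (-s)
  set y := ((p : ℕ) : ℂ) ^ (-t)
  have hxy : ‖x * y‖ ≤ 1 := by
    rw [norm_mul]; exact mul_le_one₀ (hx p) (norm_nonneg _) (hy p)
  have h3 : (1 - x * y / (p : ℕ)) ^ κ ≠ 0 := pow_ne_zero _ (one_sub_div_ne_zero p.2 hxy)
  have h4 : (1 - x * y / (p : ℕ)) ^ κ * (1 - x * y / (p : ℕ))⁻¹ ^ κ = 1 := by
    rw [inv_pow, mul_inv_cancel₀ h3]
  linear_combination (-(1 - (g p : ℂ) * (x + y - x * y)) * (1 - x / (p : ℕ))⁻¹ ^ κ *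
    (1 - y / (p : ℕ))⁻¹ ^ κ) * h4

theorem norm_tprod_regularizedTerm_le {g : ℕ → ℝ} {κ : ℕ} {M : ℝ}
    (hM : ∀ (p : Nat.Primes) (x y : ℂ), ‖x‖ ≤ 1 → ‖y‖ ≤ 1 →
      ‖regularizedTerm g κ p x y‖ ≤ M / (p : ℝ) ^ 2) {s t : ℂ} (hs : 0 ≤ s.re) (ht : 0 ≤ t.re) :
    ‖∏' p : Nat.Primes, (1 + regularizedTerm g κ p (((p : ℕ) : ℂ) ^ (-s))
      (((p : ℕ) : ℂ) ^ (-t)))‖ ≤ Real.exp (∑' p : Nat.Primes, M / (p : ℝ) ^ 2) := by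
  have hb : ∀ p : Nat.Primes, ‖regularizedTerm g κ p (((p : ℕ) : ℂ) ^ (-s))
      (((p : ℕ) : ℂ) ^ (-t))‖ ≤ M / (p : ℝ) ^ 2 := fun p =>
    hM p _ _ (norm_natCast_cpow_neg_le_one hs p.2.pos) (norm_natCast_cpow_neg_le_one ht p.2.pos)
  have hE := multipliable_one_add_of_summable <| (summable_primes_div_sq M).of_nonneg_of_le
      (fun _ => norm_nonneg _) hb
  refine le_of_tendsto (Filter.Tendsto.norm hE.hasProd) (Eventually.of_forall fun S => ?_)
  refine (norm_prod_one_add_le S _).trans (Real.exp_le_exp.2 ?_)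
  refine (Finset.sum_le_sum fun p _ => hb p).trans ?_
  exact (summable_primes_div_sq M).sum_le_tsum _ fun p _ => (norm_nonneg _).trans (hb p)

theorem tendsto_regularizedTerm {ι : Type*} {l : Filter ι} (g : ℕ → ℝ) (κ : ℕ) {p : ℕ}
    (hp : p.Prime) {x y : ι → ℂ} (hx : Tendsto x l (𝓝 1)) (hy : Tendsto y l (𝓝 1)) :
    Tendsto (fun i => regularizedTerm g κ p (x i) (y i)) l (𝓝 (regularizedTerm g κ p 1 1)) := by
  have h1 : ∀ z : ι → ℂ, Tendsto z l (𝓝 1) →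
      Tendsto (fun i => (1 - z i / (p : ℂ))⁻¹ ^ κ) l (𝓝 ((1 - 1 / (p : ℂ))⁻¹ ^ κ)) := fun z hz =>
    ((tendsto_const_nhds.sub (hz.div_const _)).inv₀
      (one_sub_div_ne_zero hp norm_one.le)).pow κ
  have h2 : Tendsto (fun i => (1 - x i * y i / (p : ℂ)) ^ κ) l (𝓝 ((1 - 1 * 1 / (p : ℂ)) ^ κ)) :=
    (tendsto_const_nhds.sub ((hx.mul hy).div_const _)).pow κ
  have h3 : Tendsto (fun i => 1 - (g p : ℂ) * (x i + y i - x i * y i)) l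
      (𝓝 (1 - (g p : ℂ) * (1 + 1 - 1 * 1))) :=
    tendsto_const_nhds.sub (((hx.add hy).sub (hx.mul hy)).const_mul _)
  exact (((h3.mul (h1 x hx)).mul (h1 y hy)).mul h2).sub tendsto_const_nhds

theorem one_add_regularizedTerm_one (g : ℕ → ℝ) (κ : ℕ) {p : ℕ} (hp : p.Prime) :
    1 + regularizedTerm g κ p 1 1 =
      (((1 - g p) * (1 - 1 / (p : ℝ))⁻¹ ^ κ : ℝ) : ℂ) := by
  have h3 : (1 - 1 / (p : ℂ)) ^ κ ≠ 0 :=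
    pow_ne_zero _ (one_sub_div_ne_zero hp norm_one.le)
  have h4 : (1 - 1 / (p : ℂ))⁻¹ ^ κ * (1 - 1 / (p : ℂ)) ^ κ = 1 := by
    rw [inv_pow, inv_mul_cancel₀ h3]
  rw [regularizedTerm, mul_one]
  push_cast
  linear_combination ((1 - (g p : ℂ)) * (1 - 1 / (p : ℂ))⁻¹ ^ κ) * h4

theorem tprod_regularizedTerm_one {g : ℕ → ℝ} {κ : ℕ} {M : ℝ}
    (hM : ∀ (p : Nat.Primes) (x y : ℂ), ‖x‖ ≤ 1 → ‖y‖ ≤ 1 →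
      ‖regularizedTerm g κ p x y‖ ≤ M / (p : ℝ) ^ 2) :
    ∏' p : Nat.Primes, (1 + regularizedTerm g κ p 1 1) =
      ((∏' p : Nat.Primes, (1 - g p) * (1 - 1 / ((p : ℕ) : ℝ))⁻¹ ^ κ : ℝ) : ℂ) := by
  have hmul : Multipliable fun p : Nat.Primes =>
      (1 - g p) * (1 - 1 / ((p : ℕ) : ℝ))⁻¹ ^ κ := by
    have h : Multipliable fun p : Nat.Primes =>
        1 + ((1 - g p) * (1 - 1 / ((p : ℕ) : ℝ))⁻¹ ^ κ - 1) := by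
      refine multipliable_one_add_of_summable <| (summable_primes_div_sq M).of_nonneg_of_le
        (fun _ => norm_nonneg _) (fun p => ?_)
      have h1 := hM p 1 1 norm_one.le norm_one.le
      have h2 := one_add_regularizedTerm_one g κ p.2
      rw [← Complex.norm_real, Complex.ofReal_sub, ← h2]
      simpa using h1
    simpa using h
  have h := hmul.hasProd.map Complex.ofRealHom Complex.continuous_ofReal
  refine HasProd.tprod_eq ?_
  convert h using 1
  · funext p
    exact one_add_regularizedTerm_one g κ p.2
  · rfl

theorem tendsto_tprod_regularizedTerm {g : ℕ → ℝ} {κ : ℕ} {M : ℝ}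
    (hM : ∀ (p : Nat.Primes) (x y : ℂ), ‖x‖ ≤ 1 → ‖y‖ ≤ 1 →
      ‖regularizedTerm g κ p x y‖ ≤ M / (p : ℝ) ^ 2) {s t : ℝ → ℂ}
    (hs : ∀ᶠ L in atTop, 0 ≤ (s L).re) (ht : ∀ᶠ L in atTop, 0 ≤ (t L).re)
    (hs0 : Tendsto s atTop (𝓝 0)) (ht0 : Tendsto t atTop (𝓝 0)) :
    Tendsto (fun L => ∏' p : Nat.Primes, (1 + regularizedTerm g κ p (((p : ℕ) : ℂ) ^ (-s L))
      (((p : ℕ) : ℂ) ^ (-t L)))) atTop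
      (𝓝 (∏' p : Nat.Primes, (1 - g p) * (1 - 1 / ((p : ℕ) : ℝ))⁻¹ ^ κ : ℝ)) := by
  rw [← tprod_regularizedTerm_one hM]
  refine tendsto_tprod_one_add_of_dominated_convergence (summable_primes_div_sq M) ?_ ?_
  · intro p
    have hp0 : ((p : ℕ) : ℂ) ≠ 0 := by exact_mod_cast p.2.ne_zero
    have hc : ∀ r : ℝ → ℂ, Tendsto r atTop (𝓝 0) →
        Tendsto (fun L => ((p : ℕ) : ℂ) ^ (-r L)) atTop (𝓝 1) := by
      intro r hr
      have : ContinuousAt (fun z : ℂ => ((p : ℕ) : ℂ) ^ (-z)) 0 :=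
        (continuous_neg.const_cpow (Or.inl hp0)).continuousAt
      have h1 := this.tendsto.comp hr
      rwa [neg_zero, Complex.cpow_zero] at h1
    exact tendsto_regularizedTerm g κ p.2 (hc s hs0) (hc t ht0)
  · filter_upwards [hs, ht] with L h1 h2 p
    exact hM p _ _ (norm_natCast_cpow_neg_le_one h1 p.2.pos)
      (norm_natCast_cpow_neg_le_one h2 p.2.pos)

end EulerProductLimit

section SelbergSumAsymptotic

open MeasureTheory Topology

theorem one_add_I_mul_ne_zero (ξ : ℝ) : (1 : ℂ) + Complex.I * ξ ≠ 0 := by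
  intro h
  simpa using congrArg Complex.re h

theorem linePoint_ne_zero {L : ℝ} (hL : 0 < L) (ξ : ℝ) : linePoint L ξ ≠ 0 :=
  div_ne_zero (one_add_I_mul_ne_zero ξ) (by exact_mod_cast hL.ne')

theorem tendsto_linePoint (ξ : ℝ) : Tendsto (fun L => linePoint L ξ) atTop (𝓝 0) := by
  have h : Tendsto (fun L : ℝ => ((L⁻¹ : ℝ) : ℂ)) atTop (𝓝 0) := by
    have := (Complex.continuous_ofReal.tendsto 0).comp tendsto_inv_atTop_zero
    rwa [Complex.ofReal_zero] at this
  simpa [linePoint, div_eq_mul_inv] using h.const_mul (1 + Complex.I * (ξ : ℂ))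

/-- The product of zeta factors carrying the singular behaviour of the Euler product. -/
noncomputable def zetaRatio (L ξ η : ℝ) : ℂ :=
  L * riemannZeta (1 + (linePoint L ξ + linePoint L η)) * (riemannZeta (1 + linePoint L ξ))⁻¹ *
    (riemannZeta (1 + linePoint L η))⁻¹

theorem norm_zetaRatio_le {C : ℝ} (hC : 0 < C)
    (h : ∀ s : ℂ, 0 < s.re → s.re ≤ 1 → ‖(riemannZeta (1 + s))⁻¹‖ ≤ C * ‖s‖) {L : ℝ}
    (hL : 1 ≤ L) (ξ η : ℝ) :
    ‖zetaRatio L ξ η‖ ≤ 2 * C ^ 2 * (‖1 + Complex.I * (ξ : ℂ)‖ * ‖1 + Complex.I * (η : ℂ)‖) := by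
  have hL0 : 0 < L := by linarith
  have hre : ∀ ξ, 0 < (linePoint L ξ).re := fun ξ => by rw [linePoint_re]; positivity
  have hre1 : ∀ ξ, (linePoint L ξ).re ≤ 1 := fun ξ => by
    rw [linePoint_re]; exact (div_le_one hL0).2 hL
  have hn : ∀ ξ, ‖linePoint L ξ‖ = ‖1 + Complex.I * (ξ : ℂ)‖ / L := fun ξ => by
    rw [linePoint, norm_div, Complex.norm_real, Real.norm_of_nonneg hL0.le]
  have h1 : ‖riemannZeta (1 + (linePoint L ξ + linePoint L η))‖ ≤ 2 * L := by
    have := norm_riemannZeta_one_add_le (w := linePoint L ξ + linePoint L η)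
      (by rw [Complex.add_re]; exact add_pos (hre ξ) (hre η))
    refine this.trans ?_
    rw [Complex.add_re, linePoint_re, linePoint_re]
    have : 1 / (1 / L + 1 / L) = L / 2 := by field_simp; norm_num
    rw [this]; linarith
  have h2 := h _ (hre ξ) (hre1 ξ)
  have h3 := h _ (hre η) (hre1 η)
  rw [hn] at h2 h3
  rw [zetaRatio, norm_mul, norm_mul, norm_mul, Complex.norm_real, Real.norm_of_nonneg hL0.le]
  calc _ ≤ L * (2 * L) * (C * (‖1 + Complex.I * (ξ : ℂ)‖ / L)) *
        (C * (‖1 + Complex.I * (η : ℂ)‖ / L)) := by gcongr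
    _ = _ := by field_simp

theorem tendsto_zetaRatio (ξ η : ℝ) :
    Tendsto (fun L => zetaRatio L ξ η) atTop
      (𝓝 ((1 + Complex.I * ξ) * (1 + Complex.I * η) *
        ((1 + Complex.I * ξ) + (1 + Complex.I * η) : ℂ)⁻¹)) := by
  have hz : ((1 + Complex.I * ξ) + (1 + Complex.I * η) : ℂ) ≠ 0 := by
    intro h
    have := congrArg Complex.re h
    norm_num at this
  have hres : ∀ s : ℝ → ℂ, Tendsto s atTop (𝓝 0) → (∀ᶠ L in atTop, s L ≠ 0) →
      Tendsto (fun L => s L * riemannZeta (1 + s L)) atTop (𝓝 1) := by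
    intro s hs hne
    have h1 : Tendsto (fun L => 1 + s L) atTop (𝓝[≠] 1) := by
      refine tendsto_nhdsWithin_iff.2 ⟨by simpa using hs.const_add 1, ?_⟩
      filter_upwards [hne] with L hL
      simpa using hL
    have := riemannZeta_residue_one.comp h1
    refine this.congr fun L => ?_
    simp
  have hsum : ∀ L, linePoint L ξ + linePoint L η =
      ((1 + Complex.I * ξ) + (1 + Complex.I * η)) / L := fun L => by
    rw [linePoint, linePoint, ← add_div]
  have hpos := eventually_gt_atTop (0 : ℝ)
  have e1 := hres _ (tendsto_linePoint ξ) (hpos.mono fun L hL => linePoint_ne_zero hL ξ)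
  have e2 := hres _ (tendsto_linePoint η) (hpos.mono fun L hL => linePoint_ne_zero hL η)
  have e3 := hres (fun L => linePoint L ξ + linePoint L η)
    (by simpa using (tendsto_linePoint ξ).add (tendsto_linePoint η))
    (hpos.mono fun L hL => by
      rw [hsum]; exact div_ne_zero hz (by exact_mod_cast hL.ne'))
  have e4 := ((e3.mul (e1.inv₀ one_ne_zero)).mul (e2.inv₀ one_ne_zero)).mul_const
    ((1 + Complex.I * ξ) * (1 + Complex.I * η) *
        ((1 + Complex.I * ξ) + (1 + Complex.I * η) : ℂ)⁻¹)
  rw [inv_one, mul_one, mul_one, one_mul] at e4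
  refine e4.congr' ?_
  filter_upwards [hpos] with L hL
  have hLc : (L : ℂ) ≠ 0 := by exact_mod_cast hL.ne'
  have n1 := one_add_I_mul_ne_zero ξ
  have n2 := one_add_I_mul_ne_zero η
  rw [zetaRatio, hsum, mul_inv, mul_inv]
  generalize riemannZeta (1 + linePoint L ξ) = Z₁
  generalize riemannZeta (1 + linePoint L η) = Z₂
  generalize riemannZeta _ = Z₃
  rw [linePoint, linePoint]
  generalize (1 + Complex.I * (ξ : ℂ)) = z at *
  generalize (1 + Complex.I * (η : ℂ)) = w at *
  field_simp

theorem perronKernel_add_mul_pow (κ c : ℕ) (x : ℝ) :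
    perronKernel (κ + c) x * (1 + Complex.I * x) ^ κ = perronKernel c x := by
  have := one_add_I_mul_ne_zero x
  rw [perronKernel, perronKernel, mul_assoc, inv_pow, inv_pow,
    show κ + c + 1 = (c + 1) + κ by ring, pow_add _ (c + 1) κ, mul_inv, mul_assoc,
    inv_mul_cancel₀ (pow_ne_zero _ this), mul_one]

theorem tendsto_integral_perronKernel_mul {κ m n : ℕ} (hm : 1 ≤ m) (hn : 1 ≤ n)
    {Z : ℝ → ℝ × ℝ → ℂ} {S : ℂ} {T : ℝ}
    (hmeas : ∀ᶠ L in atTop, AEStronglyMeasurable (Z L))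
    (hbound : ∀ᶠ L in atTop, ∀ ξ : ℝ × ℝ,
      ‖Z L ξ‖ ≤ T * (‖1 + Complex.I * (ξ.1 : ℂ)‖ * ‖1 + Complex.I * (ξ.2 : ℂ)‖) ^ κ)
    (hlim : ∀ ξ : ℝ × ℝ, Tendsto (fun L => Z L ξ) atTop
      (𝓝 (S * ((1 + Complex.I * ξ.1) * (1 + Complex.I * ξ.2) *
        ((1 + Complex.I * ξ.1) + (1 + Complex.I * ξ.2) : ℂ)⁻¹) ^ κ))) :
    Tendsto (fun L => ∫ ξ : ℝ × ℝ,
      perronKernel (κ + m) ξ.1 * perronKernel (κ + n) ξ.2 * Z L ξ) atTop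
      (𝓝 (S * ((2 * Real.pi) ^ 2 * ((m + n).choose m / (κ + m + n).factorial)))) := by
  rw [← integral_prod_exp_mul_inv_pow hm hn κ, ← integral_const_mul]
  refine tendsto_integral_filter_of_dominated_convergence
    (fun ξ => T * ‖perronKernel m ξ.1 * perronKernel n ξ.2‖) ?_ ?_ ?_ ?_
  · filter_upwards [hmeas] with L hL
    have hK : AEStronglyMeasurable (fun ξ : ℝ × ℝ =>
        perronKernel (κ + m) ξ.1 * perronKernel (κ + n) ξ.2) :=
      ((integrable_perronKernel (by omega)).mul_prod (integrable_perronKernel (by omega))).1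
    exact hK.mul hL
  · filter_upwards [hbound] with L hL
    refine ae_of_all _ fun ξ => ?_
    rw [← perronKernel_add_mul_pow κ m, ← perronKernel_add_mul_pow κ n, norm_mul, norm_mul,
      norm_mul, norm_mul, norm_mul, norm_pow, norm_pow]
    calc _ ≤ ‖perronKernel (κ + m) ξ.1‖ * ‖perronKernel (κ + n) ξ.2‖ *
          (T * (‖1 + Complex.I * (ξ.1 : ℂ)‖ * ‖1 + Complex.I * (ξ.2 : ℂ)‖) ^ κ) :=
          mul_le_mul_of_nonneg_left (hL ξ) (by positivity)
      _ = _ := by rw [mul_pow]; ring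
  · exact ((integrable_perronKernel hm).mul_prod (integrable_perronKernel hn)).norm.const_mul _
  · refine ae_of_all _ fun ξ => ?_
    convert (hlim ξ).const_mul (perronKernel (κ + m) ξ.1 * perronKernel (κ + n) ξ.2) using 2
    have k1 := perronKernel_add_mul_pow κ m ξ.1
    have k2 := perronKernel_add_mul_pow κ n ξ.2
    change S * (perronKernel m ξ.1 * perronKernel n ξ.2 * _) = _
    rw [← k1, ← k2, mul_pow, mul_pow]
    ring

theorem pow_mul_tprod_localTerm {g : ℕ → ℝ} {κ : ℕ} {D M L : ℝ} (hL : 0 < L)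
    (hg : ∀ p : ℕ, p.Prime → |g p| ≤ D / p)
    (hM : ∀ (p : Nat.Primes) (x y : ℂ), ‖x‖ ≤ 1 → ‖y‖ ≤ 1 →
      ‖regularizedTerm g κ p x y‖ ≤ M / (p : ℝ) ^ 2) (ξ η : ℝ) :
    (L : ℂ) ^ κ * (∏' p : Nat.Primes, (1 + localTerm g (linePoint L ξ) (linePoint L η) p)) =
      (∏' p : Nat.Primes, (1 + regularizedTerm g κ p (((p : ℕ) : ℂ) ^ (-linePoint L ξ))
        (((p : ℕ) : ℂ) ^ (-linePoint L η)))) * zetaRatio L ξ η ^ κ := by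
  have h := tprod_localTerm_mul_zeta_pow hL hg hM ξ η
  have hne : ∀ x, riemannZeta (1 + linePoint L x) ≠ 0 := fun x =>
    riemannZeta_ne_zero_of_one_le_re (by
      rw [Complex.add_re, linePoint_re, Complex.one_re]
      have : 0 < 1 / L := by positivity
      linarith)
  have h1 := pow_ne_zero κ (hne ξ)
  have h2 := pow_ne_zero κ (hne η)
  rw [zetaRatio, mul_pow, mul_pow, mul_pow, inv_pow, inv_pow]
  revert h
  generalize (∏' p : Nat.Primes, (1 + localTerm g (linePoint L ξ) (linePoint L η) p)) = A
  generalize (∏' p : Nat.Primes, (1 + regularizedTerm g κ p (((p : ℕ) : ℂ) ^ (-linePoint L ξ))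
        (((p : ℕ) : ℂ) ^ (-linePoint L η)))) = B
  generalize riemannZeta (1 + (linePoint L ξ + linePoint L η)) ^ κ = Y
  generalize riemannZeta (1 + linePoint L ξ) ^ κ = Z₁ at *
  generalize riemannZeta (1 + linePoint L η) ^ κ = Z₂ at *
  intro h
  field_simp
  linear_combination (L : ℂ) ^ κ * h

theorem aestronglyMeasurable_tprod_localTerm {g : ℕ → ℝ} {D L : ℝ} (hL : 0 < L)
    (hg : ∀ p : ℕ, p.Prime → |g p| ≤ D / p) :
    AEStronglyMeasurable (fun ξ : ℝ × ℝ => ∏' p : Nat.Primes,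
      (1 + localTerm g (linePoint L ξ.1) (linePoint L ξ.2) p)) := by
  have hS : ∀ S : Finset Nat.Primes, AEStronglyMeasurable (fun ξ : ℝ × ℝ =>
      ∏ p ∈ S, (1 + localTerm g (linePoint L ξ.1) (linePoint L ξ.2) p)) := fun S =>
    (continuous_finsetProd S fun p _ =>
      continuous_const.add (continuous_localTerm g L p)).aestronglyMeasurable
  have hlim : ∀ ξ : ℝ × ℝ, Tendsto (fun S : Finset Nat.Primes =>
      ∏ p ∈ S, (1 + localTerm g (linePoint L ξ.1) (linePoint L ξ.2) p)) atTop
      (𝓝 (∏' p : Nat.Primes, (1 + localTerm g (linePoint L ξ.1) (linePoint L ξ.2) p))) :=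
    fun ξ => Multipliable.hasProd (multipliable_localTerm hL hg ξ.1 ξ.2)
  exact aestronglyMeasurable_of_tendsto_ae atTop hS (ae_of_all _ hlim)

theorem tendsto_integral_perronKernel_mul_tprod
    (hζ : ∃ C : ℝ, 0 < C ∧ ∀ s : ℂ, 0 < s.re → s.re ≤ 1 →
      ‖(riemannZeta (1 + s))⁻¹‖ ≤ C * ‖s‖)
    {κ m n : ℕ} (hm : 1 ≤ m) (hn : 1 ≤ n) {g : ℕ → ℝ} {D C : ℝ}
    (hg : ∀ p : ℕ, p.Prime → |g p| ≤ D / p)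
    (hgκ : ∀ p : ℕ, p.Prime → |g p - κ / p| ≤ C / p ^ 2) :
    Tendsto (fun L : ℝ => (L : ℂ) ^ κ * ∫ ξ : ℝ × ℝ,
      perronKernel (κ + m) ξ.1 * perronKernel (κ + n) ξ.2 * ∏' p : Nat.Primes,
        (1 + localTerm g (linePoint L ξ.1) (linePoint L ξ.2) p)) atTop
      (𝓝 ((∏' p : Nat.Primes, (1 - g p) * (1 - 1 / ((p : ℕ) : ℝ))⁻¹ ^ κ : ℝ) *
        ((2 * Real.pi) ^ 2 * ((m + n).choose m / (κ + m + n).factorial)))) := by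
  obtain ⟨B, hB, hζ⟩ := hζ
  obtain ⟨M, hM0, hM⟩ := exists_norm_regularizedTerm_le hgκ
  have hre : ∀ {L : ℝ}, 0 < L → ∀ ξ, 0 ≤ (linePoint L ξ).re := fun hL ξ => by
    rw [linePoint_re]; positivity
  have hmain := tendsto_integral_perronKernel_mul (κ := κ) hm hn
    (Z := fun L ξ => (L : ℂ) ^ κ * (∏' p : Nat.Primes,
        (1 + localTerm g (linePoint L ξ.1) (linePoint L ξ.2) p)))
    (S := ((∏' p : Nat.Primes, (1 - g p) * (1 - 1 / ((p : ℕ) : ℝ))⁻¹ ^ κ : ℝ) : ℂ))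
    (T := Real.exp (∑' p : Nat.Primes, M / (p : ℝ) ^ 2) * (2 * B ^ 2) ^ κ) ?_ ?_ ?_
  · refine hmain.congr fun L => ?_
    rw [← integral_const_mul]
    exact integral_congr_ae (ae_of_all _ fun ξ => mul_left_comm _ _ _)
  · filter_upwards [eventually_gt_atTop 0] with L hL
    exact aestronglyMeasurable_const.mul (aestronglyMeasurable_tprod_localTerm hL hg)
  · filter_upwards [eventually_ge_atTop 1] with L hL ξ
    have hL0 : 0 < L := by linarith
    rw [pow_mul_tprod_localTerm hL0 hg hM, norm_mul, norm_pow, mul_assoc, ← mul_pow]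
    exact mul_le_mul (norm_tprod_regularizedTerm_le hM (hre hL0 _) (hre hL0 _))
      (pow_le_pow_left₀ (norm_nonneg _) (norm_zetaRatio_le hB hζ hL ξ.1 ξ.2) _)
      (by positivity) (by positivity)
  · intro ξ
    have e1 := tendsto_tprod_regularizedTerm hM
      ((eventually_gt_atTop 0).mono fun L hL => hre hL ξ.1)
      ((eventually_gt_atTop 0).mono fun L hL => hre hL ξ.2)
      (tendsto_linePoint ξ.1) (tendsto_linePoint ξ.2)
    refine (e1.mul ((tendsto_zetaRatio ξ.1 ξ.2).pow κ)).congr' ?_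
    filter_upwards [eventually_gt_atTop 0] with L hL
    rw [pow_mul_tprod_localTerm hL hg hM]

theorem tendsto_sum_moebius_mul_log_pow
    (hζ : ∃ C : ℝ, 0 < C ∧ ∀ s : ℂ, 0 < s.re → s.re ≤ 1 →
      ‖(riemannZeta (1 + s))⁻¹‖ ≤ C * ‖s‖)
    {κ m n : ℕ} (hm : 1 ≤ m) (hn : 1 ≤ n) {g : ℕ → ℝ} {D C : ℝ}
    (hg : ∀ p : ℕ, p.Prime → |g p| ≤ D / p)
    (hgκ : ∀ p : ℕ, p.Prime → |g p - κ / p| ≤ C / p ^ 2) :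
    Tendsto (fun R : ℝ => (∑ d₁ ∈ Finset.Icc 1 ⌊R⌋₊, ∑ d₂ ∈ Finset.Icc 1 ⌊R⌋₊,
      (ArithmeticFunction.moebius d₁ : ℝ) * (ArithmeticFunction.moebius d₂ : ℝ) *
        ((Real.log (R / d₁) ^ (κ + m) / (κ + m).factorial) *
          (Real.log (R / d₂) ^ (κ + n) / (κ + n).factorial) *
          ∏ p ∈ (Nat.lcm d₁ d₂).primeFactors, g p)) / Real.log R ^ (κ + m + n)) atTop
      (𝓝 ((∏' p : Nat.Primes, (1 - g p) * (1 - 1 / ((p : ℕ) : ℝ))⁻¹ ^ κ) *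
        ((m + n).choose m / (κ + m + n).factorial))) := by
  have h := (tendsto_integral_perronKernel_mul_tprod hζ hm hn hg hgκ).comp Real.tendsto_log_atTop
  have hpi : (Real.pi : ℂ) ≠ 0 := by exact_mod_cast Real.pi_ne_zero
  have h2 := (Complex.continuous_re.tendsto _).comp
    (h.const_mul (((2 * Real.pi) ^ 2 : ℂ)⁻¹))
  have hv : (((2 * Real.pi) ^ 2 : ℂ)⁻¹ * ((∏' p : Nat.Primes, (1 - g p) *
      (1 - 1 / ((p : ℕ) : ℝ))⁻¹ ^ κ : ℝ) *
        ((2 * Real.pi) ^ 2 * ((m + n).choose m / (κ + m + n).factorial)))) =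
      (((∏' p : Nat.Primes, (1 - g p) * (1 - 1 / ((p : ℕ) : ℝ))⁻¹ ^ κ) *
        ((m + n).choose m / (κ + m + n).factorial) : ℝ) : ℂ) := by
    rw [Complex.ofReal_mul]
    push_cast
    field_simp
  rw [hv, Complex.ofReal_re] at h2
  refine h2.congr' ?_
  filter_upwards [eventually_gt_atTop 1] with R hR
  have hL : 0 < Real.log R := Real.log_pos hR
  have hLc : (Real.log R : ℂ) ≠ 0 := by exact_mod_cast hL.ne'
  have h3 := sum_moebius_mul_log_pow_eq_integral (a := κ + m) (b := κ + n) (by omega) (by omega)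
    hR hg
  rw [← Complex.ofReal_re (_ / _), Complex.ofReal_div, h3, Function.comp_apply,
    Function.comp_apply]
  congr 1
  generalize (∫ ξ : ℝ × ℝ, _ : ℂ) = J
  push_cast
  rw [eq_div_iff (pow_ne_zero _ hLc)]
  ring

end SelbergSumAsymptotic

section AdmissibleResidues

/-- The number of residue classes `c` modulo `q` with `q ∣ P_H(c)` and `c + h₀` a unit. -/
noncomputable def nuStar (H : Finset ℕ) (h₀ q : ℕ) : ℕ :=
  Nat.card {c : ZMod q // ∏ h ∈ H, (c + h) = 0 ∧ IsUnit (c + h₀)}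

theorem nuStar_mul (H : Finset ℕ) (h₀ : ℕ) {a b : ℕ} (hab : a.Coprime b) :
    nuStar H h₀ (a * b) = nuStar H h₀ a * nuStar H h₀ b := by
  rw [nuStar, nuStar, nuStar, ← Nat.card_prod]
  let e := ZMod.chineseRemainder hab
  have hP : ∀ c : ZMod (a * b), e (∏ h ∈ H, (c + h)) =
      (∏ h ∈ H, ((e c).1 + h), ∏ h ∈ H, ((e c).2 + h)) := by
    intro c
    rw [map_prod]
    ext
    · simp [Prod.fst_prod]
    · simp [Prod.snd_prod]
  have hU : ∀ c : ZMod (a * b), IsUnit (c + h₀) ↔ IsUnit ((e c).1 + h₀) ∧ IsUnit ((e c).2 + h₀) := by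
    intro c
    rw [← isUnit_map_iff e, map_add, map_natCast, Prod.isUnit_iff]
    simp
  have hZ : ∀ c : ZMod (a * b), ∏ h ∈ H, (c + h) = 0 ↔
      ∏ h ∈ H, ((e c).1 + h) = 0 ∧ ∏ h ∈ H, ((e c).2 + h) = 0 := by
    intro c
    rw [← map_eq_zero_iff e e.injective, hP, Prod.mk_eq_zero]
  refine Nat.card_congr ((e.toEquiv.subtypeEquiv (q := fun x : ZMod a × ZMod b => (∏ h ∈ H, (x.1 + h) = 0 ∧
    IsUnit (x.1 + h₀)) ∧ (∏ h ∈ H, (x.2 + h) = 0 ∧ IsUnit (x.2 + h₀))) fun c => ?_).trans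
    (Equiv.subtypeProdEquivProd (p := fun x : ZMod a => ∏ h ∈ H, (x + h) = 0 ∧ IsUnit (x + h₀))
      (q := fun x : ZMod b => ∏ h ∈ H, (x + h) = 0 ∧ IsUnit (x + h₀))))
  rw [hZ, hU]
  exact and_and_and_comm

theorem nuStar_one (H : Finset ℕ) (h₀ : ℕ) : nuStar H h₀ 1 = 1 := by
  rw [nuStar, Nat.card_eq_one_iff_unique]
  have : Subsingleton (ZMod 1) := inferInstanceAs (Subsingleton (Fin 1))
  exact ⟨inferInstance, ⟨0, Subsingleton.elim _ _, isUnit_of_subsingleton _⟩⟩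

theorem nuStar_prod_primes (H : Finset ℕ) (h₀ : ℕ) (s : Finset ℕ) (hs : ∀ p ∈ s, p.Prime) :
    nuStar H h₀ (∏ p ∈ s, p) = ∏ p ∈ s, nuStar H h₀ p := by
  induction s using Finset.induction_on with
  | empty => simpa using nuStar_one H h₀
  | insert p s hp ih =>
    rw [Finset.prod_insert hp, Finset.prod_insert hp, nuStar_mul,
      ih fun q hq => hs q (Finset.mem_insert_of_mem hq)]
    refine Nat.Coprime.prod_right fun q hq => ?_
    refine (Nat.coprime_primes (hs p (Finset.mem_insert_self _ _))
      (hs q (Finset.mem_insert_of_mem hq))).2 ?_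
    rintro rfl
    exact hp hq

theorem totient_prod_primes (s : Finset ℕ) (hs : ∀ p ∈ s, p.Prime) :
    (∏ p ∈ s, p).totient = ∏ p ∈ s, (p - 1) := by
  induction s using Finset.induction_on with
  | empty => simp
  | insert p s hp ih =>
    rw [Finset.prod_insert hp, Finset.prod_insert hp, Nat.totient_mul,
      ih fun q hq => hs q (Finset.mem_insert_of_mem hq),
      Nat.totient_prime (hs p (Finset.mem_insert_self _ _))]
    refine Nat.Coprime.prod_right fun q hq => ?_
    refine (Nat.coprime_primes (hs p (Finset.mem_insert_self _ _))
      (hs q (Finset.mem_insert_of_mem hq))).2 ?_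
    rintro rfl
    exact hp hq

theorem nuStar_div_totient (H : Finset ℕ) (h₀ : ℕ) {q : ℕ} (hq : Squarefree q) :
    (nuStar H h₀ q : ℝ) / q.totient =
      ∏ p ∈ q.primeFactors, (nuStar H h₀ p : ℝ) / ((p : ℝ) - 1) := by
  have hs : ∀ p ∈ q.primeFactors, p.Prime := fun p hp => Nat.prime_of_mem_primeFactors hp
  have h1 := nuStar_prod_primes H h₀ q.primeFactors hs
  have h2 := totient_prod_primes q.primeFactors hs
  rw [Nat.prod_primeFactors_of_squarefree hq] at h1 h2
  rw [h1, h2, Nat.cast_prod, Nat.cast_prod, ← Finset.prod_div_distrib]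
  refine Finset.prod_congr rfl fun p hp => ?_
  rw [Nat.cast_sub (hs p hp).one_le, Nat.cast_one]

section Prime

/-- The residue classes modulo `p` in which `P_H` vanishes. -/
noncomputable def rootSet (H : Finset ℕ) (p : ℕ) : Finset (ZMod p) :=
  H.image fun h : ℕ => -(h : ZMod p)

variable {H : Finset ℕ} {h₀ p : ℕ}

theorem mem_rootSet_iff (hp : p.Prime) (c : ZMod p) :
    c ∈ rootSet H p ↔ ∏ h ∈ H, (c + h) = 0 := by
  have : Fact p.Prime := ⟨hp⟩
  rw [rootSet, Finset.mem_image, Finset.prod_eq_zero_iff]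
  refine exists_congr fun h => and_congr_right fun _ => ?_
  rw [neg_eq_iff_add_eq_zero, add_comm]

theorem nu_eq_card_rootSet (hp : p.Prime) : nu H p = (rootSet H p).card := by
  have : NeZero p := ⟨hp.ne_zero⟩
  rw [nu]
  refine Finset.card_bij (fun c _ => (c : ZMod p)) ?_ ?_ ?_
  · intro c hc
    rw [Finset.mem_filter] at hc
    rw [mem_rootSet_iff hp, ← ZMod.natCast_eq_zero_iff] at *
    simpa using hc.2
  · intro c hc d hd h
    rw [Finset.mem_filter, Finset.mem_range] at hc hd
    rwa [ZMod.natCast_eq_natCast_iff', Nat.mod_eq_of_lt hc.1, Nat.mod_eq_of_lt hd.1] at h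
  · intro c hc
    refine ⟨c.val, ?_, ZMod.natCast_zmod_val c⟩
    rw [mem_rootSet_iff hp] at hc
    rw [Finset.mem_filter, Finset.mem_range, ← ZMod.natCast_eq_zero_iff]
    refine ⟨ZMod.val_lt c, ?_⟩
    simpa using hc

theorem nu_eq_nuStar_add_one (hp : p.Prime) (hh₀ : h₀ ∈ H) : nu H p = nuStar H h₀ p + 1 := by
  have : Fact p.Prime := ⟨hp⟩
  have hmem : -(h₀ : ZMod p) ∈ rootSet H p := Finset.mem_image_of_mem _ hh₀
  rw [nu_eq_card_rootSet hp, ← Finset.card_erase_add_one hmem, nuStar,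
    Nat.subtype_card ((rootSet H p).erase (-(h₀ : ZMod p)))]
  intro c
  rw [Finset.mem_erase, mem_rootSet_iff hp, isUnit_iff_ne_zero, Ne, Ne, eq_neg_iff_add_eq_zero]
  exact and_comm

theorem nu_le_card (hp : p.Prime) : nu H p ≤ H.card := by
  rw [nu_eq_card_rootSet hp]
  exact Finset.card_image_le

theorem nu_eq_card (hp : p.Prime) (hH : ∀ h ∈ H, h < p) : nu H p = H.card := by
  rw [nu_eq_card_rootSet hp, rootSet, Finset.card_image_of_injOn]
  intro a ha b hb hab
  have := neg_injective hab
  rwa [ZMod.natCast_eq_natCast_iff', Nat.mod_eq_of_lt (hH a ha), Nat.mod_eq_of_lt (hH b hb)] at this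

end Prime

theorem nuStar_le_pow (H : Finset ℕ) {h₀ : ℕ} (hh₀ : h₀ ∈ H) {q : ℕ} (hq : Squarefree q) :
    nuStar H h₀ q ≤ H.card ^ q.primeFactors.card := by
  have hs : ∀ p ∈ q.primeFactors, p.Prime := fun p hp => Nat.prime_of_mem_primeFactors hp
  have h1 := nuStar_prod_primes H h₀ q.primeFactors hs
  rw [Nat.prod_primeFactors_of_squarefree hq] at h1
  rw [h1]
  refine Finset.prod_le_pow_card _ _ _ fun p hp => ?_
  have := nu_le_card (H := H) (hs p hp)
  rw [nu_eq_nuStar_add_one (hs p hp) hh₀] at this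
  omega

section LocalDensity

variable {H : Finset ℕ} {h₀ p : ℕ}

theorem nuStar_div_nonneg (hp : p.Prime) : 0 ≤ (nuStar H h₀ p : ℝ) / ((p : ℝ) - 1) := by
  have : (2 : ℝ) ≤ p := by exact_mod_cast hp.two_le
  exact div_nonneg (Nat.cast_nonneg _) (by linarith)

theorem nuStar_div_le (hp : p.Prime) (hh₀ : h₀ ∈ H) :
    (nuStar H h₀ p : ℝ) / ((p : ℝ) - 1) ≤ 2 * H.card / p := by
  have h2 : (2 : ℝ) ≤ p := by exact_mod_cast hp.two_le
  have h3 : (nuStar H h₀ p : ℝ) ≤ H.card := by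
    have := nu_le_card (H := H) hp
    rw [nu_eq_nuStar_add_one hp hh₀] at this
    exact_mod_cast (by omega : nuStar H h₀ p ≤ H.card)
  rw [div_le_div_iff₀ (by linarith) (by linarith)]
  nlinarith [(Nat.cast_nonneg (nuStar H h₀ p) : (0 : ℝ) ≤ _)]

theorem abs_nuStar_div_sub_le (hh₀ : h₀ ∈ H) :
    ∃ C : ℝ, ∀ p : ℕ, p.Prime →
      |(nuStar H h₀ p : ℝ) / ((p : ℝ) - 1) - ((H.card - 1 : ℕ) : ℝ) / p| ≤ C / (p : ℝ) ^ 2 := by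
  refine ⟨3 * H.card * (H.sup id + 1), fun p hp => ?_⟩
  have h2 : (2 : ℝ) ≤ p := by exact_mod_cast hp.two_le
  have hk : ((H.card - 1 : ℕ) : ℝ) ≤ H.card := by exact_mod_cast Nat.sub_le _ _
  have hk0 : (0 : ℝ) ≤ ((H.card - 1 : ℕ) : ℝ) := Nat.cast_nonneg _
  by_cases hlt : H.sup id < p
  · have h1 := nu_eq_card (H := H) hp fun h hh =>
      lt_of_le_of_lt (Finset.le_sup (f := id) hh) hlt
    rw [nu_eq_nuStar_add_one hp hh₀] at h1
    rw [show nuStar H h₀ p = H.card - 1 by omega]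
    have h4 : ((H.card - 1 : ℕ) : ℝ) / ((p : ℝ) - 1) - ((H.card - 1 : ℕ) : ℝ) / p =
        ((H.card - 1 : ℕ) : ℝ) / (p * (p - 1)) := by
      have : (p : ℝ) - 1 ≠ 0 := by linarith
      have : (p : ℝ) ≠ 0 := by linarith
      field_simp
      ring
    rw [h4, abs_of_nonneg (div_nonneg hk0 (by nlinarith)), div_le_div_iff₀ (by nlinarith)
      (by positivity)]
    have hs : (0 : ℝ) ≤ ((H.sup id : ℕ) : ℝ) := Nat.cast_nonneg _
    have hc : (0 : ℝ) ≤ (H.card : ℝ) := Nat.cast_nonneg _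
    calc ((H.card - 1 : ℕ) : ℝ) * (p : ℝ) ^ 2 ≤ H.card * (2 * (p * (p - 1))) := by
          refine mul_le_mul hk ?_ (by positivity) hc
          nlinarith
      _ ≤ (3 * H.card * (H.sup id + 1)) * (p * (p - 1)) := by
          have : (0 : ℝ) ≤ H.card * (p * (p - 1)) := mul_nonneg hc (by nlinarith)
          nlinarith [mul_nonneg this hs]
  · have hple : (p : ℝ) ≤ H.sup id + 1 := by
      have : p ≤ H.sup id + 1 := by omega
      exact_mod_cast this
    have h1 := nuStar_div_le hp hh₀
    have h0 := nuStar_div_nonneg (H := H) (h₀ := h₀) hp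
    have h3 : ((H.card - 1 : ℕ) : ℝ) / p ≤ H.card / p := by gcongr
    have h4 : (0 : ℝ) ≤ ((H.card - 1 : ℕ) : ℝ) / p := by positivity
    have h5 : |(nuStar H h₀ p : ℝ) / ((p : ℝ) - 1) - ((H.card - 1 : ℕ) : ℝ) / p| ≤
        3 * H.card / p := by
      rw [abs_le]
      have : (3 : ℝ) * H.card / p = 2 * H.card / p + H.card / p := by ring
      rw [this]
      constructor <;> linarith
    refine h5.trans ?_
    rw [div_le_div_iff₀ (by linarith) (by positivity)]
    have hc : (0 : ℝ) ≤ (H.card : ℝ) := Nat.cast_nonneg _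
    have : (0 : ℝ) ≤ 3 * H.card * p := by positivity
    nlinarith [mul_le_mul_of_nonneg_left hple this]

theorem one_sub_nuStar_div_mul (hp : p.Prime) (hh₀ : h₀ ∈ H) :
    (1 - (nuStar H h₀ p : ℝ) / ((p : ℝ) - 1)) * (1 - 1 / (p : ℝ))⁻¹ ^ (H.card - 1) =
      (1 - (nu H p : ℝ) / p) * (1 - 1 / (p : ℝ)) ^ (-(H.card : ℤ)) := by
  have h2 : (2 : ℝ) ≤ p := by exact_mod_cast hp.two_le
  have h3 : (p : ℝ) - 1 ≠ 0 := by linarith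
  have h4 : (p : ℝ) ≠ 0 := by linarith
  have hk : H.card = (H.card - 1) + 1 := by
    have := Finset.card_pos.2 ⟨h₀, hh₀⟩
    omega
  rw [zpow_neg, zpow_natCast, ← inv_pow]
  conv_rhs => rw [hk, pow_succ']
  rw [← mul_assoc]
  congr 1
  rw [nu_eq_nuStar_add_one hp hh₀]
  have : 1 - 1 / (p : ℝ) = (p - 1) / p := by field_simp
  rw [this]
  push_cast
  field_simp
  ring

theorem tprod_nuStar_eq_singSeries (hh₀ : h₀ ∈ H) :
    ∏' p : Nat.Primes, (1 - (nuStar H h₀ p : ℝ) / (((p : ℕ) : ℝ) - 1)) *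
      (1 - 1 / ((p : ℕ) : ℝ))⁻¹ ^ (H.card - 1) = singSeries H :=
  tprod_congr fun p => one_sub_nuStar_div_mul p.2 hh₀

end LocalDensity

end AdmissibleResidues

section PrimesLevelConsequences

open Topology

theorem card_filter_mod_le (q N a : ℕ) :
    ((Finset.Icc 1 N).filter fun p => p % q = a % q).card ≤ N / q + 1 := by
  calc _ ≤ (Finset.range (N / q + 1)).card := by
        refine Finset.card_le_card_of_injOn (fun p => p / q) ?_ ?_
        · intro p hp
          have := (Finset.mem_Icc.1 (Finset.mem_filter.1 hp).1).2
          simpa using Nat.lt_succ_of_le (Nat.div_le_div_right this)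
        · intro p hp r hr h
          have h1 := (Finset.mem_filter.1 hp).2
          have h2 := (Finset.mem_filter.1 hr).2
          rw [← Nat.div_add_mod p q, ← Nat.div_add_mod r q, h1, h2]
          simp only at h
          rw [h]
    _ = _ := Finset.card_range _

theorem sum_log_mod_le (q N a : ℕ) :
    (∑ p ∈ Finset.Icc 1 N, if p.Prime ∧ p % q = a % q then Real.log p else 0) ≤
      ((N : ℝ) / q + 1) * Real.log N := by
  have h1 : (∑ p ∈ Finset.Icc 1 N, if p.Prime ∧ p % q = a % q then Real.log p else 0) ≤
      ∑ p ∈ (Finset.Icc 1 N).filter fun p => p % q = a % q, Real.log N := by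
    rw [Finset.sum_filter]
    refine Finset.sum_le_sum fun p hp => ?_
    rw [Finset.mem_Icc] at hp
    have hp0 : (0 : ℝ) < p := by exact_mod_cast hp.1
    have hlog : Real.log p ≤ Real.log N := Real.log_le_log hp0 (by exact_mod_cast hp.2)
    have hlog0 : 0 ≤ Real.log N := Real.log_natCast_nonneg N
    split_ifs with h2 h3 h3
    · exact hlog
    · exact absurd h2.2 h3
    · exact hlog0
    · exact le_rfl
  refine h1.trans ?_
  rw [Finset.sum_const, nsmul_eq_mul]
  refine mul_le_mul_of_nonneg_right ?_ (Real.log_natCast_nonneg N)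
  calc (((Finset.Icc 1 N).filter fun p => p % q = a % q).card : ℝ) ≤ ((N / q + 1 : ℕ) : ℝ) := by
        exact_mod_cast card_filter_mod_le q N a
    _ ≤ _ := by push_cast; gcongr; exact Nat.cast_div_le

theorem sum_log_mod_nonneg (q N a : ℕ) :
    0 ≤ (∑ p ∈ Finset.Icc 1 N, if p.Prime ∧ p % q = a % q then Real.log p else 0) :=
  Finset.sum_nonneg fun p _ => by split_ifs <;> simp [Real.log_natCast_nonneg]

theorem primeMaxAbs_term_le {q : ℕ} (hq : 0 < q) (N a : ℕ) :
    (if Nat.Coprime a q then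
      |(∑ p ∈ Finset.Icc 1 N, if p.Prime ∧ p % q = a % q then Real.log p else 0)
        - N / q.totient| else 0) ≤ ((N : ℝ) / q + 1) * Real.log N + N / q.totient := by
  have h1 := sum_log_mod_le q N a
  have h2 := sum_log_mod_nonneg q N a
  have h3 : (0 : ℝ) ≤ N / q.totient := by positivity
  split_ifs
  · rw [abs_le]
    constructor <;> linarith
  · linarith

theorem primeMaxAbs_le {q : ℕ} (hq : 0 < q) (N : ℕ) :
    primeMaxAbs q N ≤ ((N : ℝ) / q + 1) * Real.log N + N / q.totient :=
  ciSup_le fun a => primeMaxAbs_term_le hq N a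

theorem le_primeMaxAbs {q : ℕ} (hq : 0 < q) (N : ℕ) {a : ℕ} (ha : a.Coprime q) :
    |(∑ p ∈ Finset.Icc 1 N, if p.Prime ∧ p % q = a % q then Real.log p else 0)
        - N / q.totient| ≤ primeMaxAbs q N := by
  have hb : BddAbove (Set.range fun a : ℕ => if Nat.Coprime a q then
      |(∑ p ∈ Finset.Icc 1 N, if p.Prime ∧ p % q = a % q then Real.log p else 0)
        - N / q.totient| else 0) :=
    ⟨_, Set.forall_mem_range.2 fun a => primeMaxAbs_term_le hq N a⟩
  have := le_ciSup hb a
  simp only [if_pos ha] at this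
  exact this

theorem primeMaxAbs_nonneg {q : ℕ} (hq : 0 < q) (N : ℕ) : 0 ≤ primeMaxAbs q N :=
  (abs_nonneg _).trans (le_primeMaxAbs hq N (Nat.coprime_one_left q))

theorem PrimesLevel.abs_theta_sub_le {ϑ : ℝ} (h : PrimesLevel ϑ) (hϑ : 0 < ϑ) :
    ∃ C : ℝ, ∀ N : ℕ, 2 ≤ N → |Chebyshev.theta N - N| ≤ C * N / Real.log N ^ 2 := by
  obtain ⟨C, -, hC⟩ := h ϑ hϑ 2 two_pos
  refine ⟨C, fun N hN => ?_⟩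
  have h1 := hC N hN
  rw [sub_self, Real.rpow_zero, Nat.floor_one, Finset.Icc_self, Finset.sum_singleton,
    Real.rpow_ofNat] at h1
  refine le_trans (le_of_eq ?_) ((le_primeMaxAbs one_pos N (Nat.coprime_one_right 0)).trans h1)
  rw [Nat.totient_one, Nat.cast_one, div_one]
  congr 2
  rw [Chebyshev.theta_eq_sum_Icc, Nat.floor_natCast, ← Finset.sum_filter]
  refine Finset.sum_congr ?_ fun _ _ => rfl
  ext p
  simp only [Finset.mem_filter, Finset.mem_Icc, Nat.mod_one, and_true]
  constructor
  · exact fun hp => ⟨⟨hp.2.one_le, hp.1.2⟩, hp.2⟩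
  · exact fun hp => ⟨⟨Nat.zero_le _, hp.1.2⟩, hp.2⟩

theorem PrimesLevel.sub_le_one {ϑ δ : ℝ} (h : PrimesLevel ϑ) (hδ : 0 < δ) : ϑ - δ ≤ 1 := by
  by_contra! hlt
  obtain ⟨C, hC0, hC⟩ := h δ hδ 1 one_pos
  have h1 : Tendsto (fun N : ℕ => (N : ℝ) ^ (ϑ - δ - 1)) atTop atTop :=
    (tendsto_rpow_atTop (by linarith)).comp tendsto_natCast_atTop_atTop
  have h2 : Tendsto (fun N : ℕ => Real.log (N : ℝ)) atTop atTop :=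
    Real.tendsto_log_atTop.comp tendsto_natCast_atTop_atTop
  obtain ⟨N, hN2, hN, hlog⟩ := ((eventually_ge_atTop 2).and
    ((h1.eventually_ge_atTop 2).and (h2.eventually_gt_atTop (2 * C)))).exists
  have hN0 : (0 : ℝ) < N := by positivity
  have hsub : Finset.Ioc N (2 * N) ⊆ Finset.Icc 1 ⌊(N : ℝ) ^ (ϑ - δ)⌋₊ := by
    intro q hq
    rw [Finset.mem_Ioc] at hq
    rw [Finset.mem_Icc]
    refine ⟨by omega, hq.2.trans (Nat.le_floor ?_)⟩
    have : (N : ℝ) ^ (ϑ - δ) = (N : ℝ) ^ (ϑ - δ - 1) * N := by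
      rw [← Real.rpow_add_one hN0.ne']
      congr 1
      ring
    rw [this]
    push_cast
    exact mul_le_mul_of_nonneg_right hN hN0.le
  have hlow : (N : ℝ) / 2 ≤ ∑ q ∈ Finset.Icc 1 ⌊(N : ℝ) ^ (ϑ - δ)⌋₊, primeMaxAbs q N := by
    calc (N : ℝ) / 2 = ∑ q ∈ Finset.Ioc N (2 * N), (1 / 2 : ℝ) := by
          rw [Finset.sum_const, Nat.card_Ioc, nsmul_eq_mul, show 2 * N - N = N by omega]
          ring
      _ ≤ ∑ q ∈ Finset.Ioc N (2 * N), primeMaxAbs q N := by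
          refine Finset.sum_le_sum fun q hq => ?_
          rw [Finset.mem_Ioc] at hq
          have hq0 : 0 < q := by omega
          refine le_trans ?_ (le_primeMaxAbs hq0 N (Nat.coprime_one_left q))
          rw [Finset.sum_eq_zero, zero_sub, abs_neg, abs_of_nonneg (by positivity)]
          · have ht : (q.totient : ℝ) ≤ 2 * N := by
              exact_mod_cast (Nat.totient_le q).trans hq.2
            have ht0 : (0 : ℝ) < q.totient := by exact_mod_cast Nat.totient_pos.2 hq0
            rw [div_le_div_iff₀ two_pos ht0]
            linarith
          · intro p hp
            rw [Finset.mem_Icc] at hp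
            rw [if_neg]
            rintro ⟨hpp, hmod⟩
            rw [Nat.mod_eq_of_lt (by omega), Nat.mod_eq_of_lt (by omega)] at hmod
            exact hpp.one_lt.ne' hmod
      _ ≤ _ := by
          refine Finset.sum_le_sum_of_subset_of_nonneg hsub fun q hq _ => ?_
          exact primeMaxAbs_nonneg (Finset.mem_Icc.1 hq).1 N
  have h3 := hlow.trans (hC N hN2)
  rw [Real.rpow_one, div_le_div_iff₀ two_pos (by linarith)] at h3
  nlinarith

end PrimesLevelConsequences

section SquarefreeSums

theorem sum_divisors_pow_card_primeFactors (B : ℝ) {q : ℕ} (hq : Squarefree q) :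
    ∑ d ∈ q.divisors, B ^ d.primeFactors.card = (1 + B) ^ q.primeFactors.card := by
  have h := (ArithmeticFunction.IsMultiplicative.prodPrimeFactors fun _ =>
    B).prodPrimeFactors_one_add_of_squarefree hq
  rw [← Finset.prod_const, Finset.prod_congr rfl (g := fun p => 1 +
    ArithmeticFunction.prodPrimeFactors (fun _ => B) p), h]
  · refine Finset.sum_congr rfl fun d hd => ?_
    rw [ArithmeticFunction.prodPrimeFactors_apply (Nat.pos_of_mem_divisors hd).ne',
      Finset.prod_const]
  · intro p hp
    have hp := Nat.prime_of_mem_primeFactors hp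
    rw [ArithmeticFunction.prodPrimeFactors_apply hp.ne_zero, hp.primeFactors,
      Finset.prod_singleton]

theorem card_divisors_of_squarefree {q : ℕ} (hq : Squarefree q) :
    q.divisors.card = 2 ^ q.primeFactors.card := by
  have h := sum_divisors_pow_card_primeFactors 1 hq
  simp only [one_pow, Finset.sum_const, nsmul_eq_mul, mul_one, one_add_one_eq_two] at h
  exact_mod_cast h

theorem sum_inv_Icc_le (Q : ℕ) : ∑ m ∈ Finset.Icc 1 Q, (m : ℝ)⁻¹ ≤ 1 + Real.log Q := by
  have h := harmonic_le_one_add_log Q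
  simpa only [harmonic_eq_sum_Icc, Rat.cast_sum, Rat.cast_inv, Rat.cast_natCast] using h

theorem sum_squarefree_pow_div_le (B Q : ℕ) :
    ∑ q ∈ (Finset.Icc 1 Q).filter Squarefree, (B : ℝ) ^ q.primeFactors.card / q ≤
      (1 + Real.log Q) ^ B := by
  induction B with
  | zero =>
    rw [pow_zero]
    calc _ ≤ ∑ q ∈ (Finset.Icc 1 Q).filter Squarefree, if q = 1 then (1 : ℝ) else 0 := by
          refine Finset.sum_le_sum fun q hq => ?_
          rw [Finset.mem_filter, Finset.mem_Icc] at hq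
          split_ifs with h1
          · simp [h1]
          · rw [Nat.cast_zero, zero_pow, zero_div]
            rw [Finset.card_ne_zero, Nat.nonempty_primeFactors]
            omega
      _ ≤ 1 := by
          rw [Finset.sum_ite_eq']
          split_ifs <;> norm_num
  | succ B ih =>
    have hlog : 0 ≤ 1 + Real.log Q := by have := Real.log_natCast_nonneg Q; linarith
    have h1 : ∀ q ∈ (Finset.Icc 1 Q).filter Squarefree,
        ((B + 1 : ℕ) : ℝ) ^ q.primeFactors.card / q =
          ∑ d ∈ (Finset.Icc 1 Q).filter Squarefree,
            if d ∣ q then (B : ℝ) ^ d.primeFactors.card / d * ((q / d : ℕ) : ℝ)⁻¹ else 0 := by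
      intro q hq
      rw [Finset.mem_filter, Finset.mem_Icc] at hq
      rw [Nat.cast_add_one, add_comm, ← sum_divisors_pow_card_primeFactors _ hq.2,
        Finset.sum_div, ← Finset.sum_filter]
      refine Finset.sum_congr ?_ ?_
      · ext d
        simp only [Nat.mem_divisors, Finset.mem_filter, Finset.mem_Icc]
        constructor
        · rintro ⟨hd, hq0⟩
          exact ⟨⟨⟨Nat.pos_of_dvd_of_pos hd hq.1.1, (Nat.le_of_dvd hq.1.1 hd).trans hq.1.2⟩,
            hq.2.squarefree_of_dvd hd⟩, hd⟩
        · rintro ⟨-, hd⟩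
          exact ⟨hd, by omega⟩
      · intro d hd
        rw [Finset.mem_filter, Finset.mem_filter, Finset.mem_Icc] at hd
        have hd' := hd.2
        have hd0 : (d : ℝ) ≠ 0 := by exact_mod_cast (Nat.one_le_iff_ne_zero.1 hd.1.1.1)
        rw [Nat.cast_div hd' hd0, inv_div, div_mul_div_comm, mul_comm (d : ℝ),
          mul_div_mul_right _ _ hd0]
    rw [Finset.sum_congr rfl h1, Finset.sum_comm, pow_succ]
    calc _ ≤ ∑ d ∈ (Finset.Icc 1 Q).filter Squarefree,
          (B : ℝ) ^ d.primeFactors.card / d * (1 + Real.log Q) := by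
          refine Finset.sum_le_sum fun d hd => ?_
          rw [Finset.mem_filter, Finset.mem_Icc] at hd
          rw [← Finset.sum_filter, ← Finset.mul_sum]
          refine mul_le_mul_of_nonneg_left ?_ (by positivity)
          refine le_trans ?_ (sum_inv_Icc_le Q)
          have hinj : Set.InjOn (fun q => q / d)
              (((Finset.Icc 1 Q).filter Squarefree).filter (d ∣ ·)) := by
            intro a ha b hb hab
            have ha := (Finset.mem_filter.1 ha).2
            have hb := (Finset.mem_filter.1 hb).2
            rw [← Nat.div_mul_cancel ha, ← Nat.div_mul_cancel hb]
            simp only at hab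
            rw [hab]
          rw [← Finset.sum_image (f := fun m : ℕ => (m : ℝ)⁻¹) hinj]
          refine Finset.sum_le_sum_of_subset_of_nonneg ?_ fun _ _ _ => by positivity
          intro m hm
          obtain ⟨q, hq, rfl⟩ := Finset.mem_image.1 hm
          simp only [Finset.mem_filter, Finset.mem_Icc] at hq
          rw [Finset.mem_Icc]
          exact ⟨Nat.div_pos (Nat.le_of_dvd hq.1.1.1 hq.2) hd.1.1,
            (Nat.div_le_self _ _).trans hq.1.1.2⟩
      _ ≤ _ := by
          rw [← Finset.sum_mul]
          exact mul_le_mul_of_nonneg_right ih hlog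

theorem squarefree_lcm {a b : ℕ} (ha : Squarefree a) (hb : Squarefree b) :
    Squarefree (Nat.lcm a b) := by
  rw [Nat.squarefree_iff_factorization_le_one (Nat.lcm_ne_zero ha.ne_zero hb.ne_zero)]
  intro p
  rw [Nat.factorization_lcm ha.ne_zero hb.ne_zero, Finsupp.sup_apply]
  exact max_le ((Nat.squarefree_iff_factorization_le_one ha.ne_zero).1 ha p)
    ((Nat.squarefree_iff_factorization_le_one hb.ne_zero).1 hb p)

theorem sum_sum_lcm_le (f : ℕ → ℝ) (hf : ∀ q, Squarefree q → 0 ≤ f q) (R : ℝ) (hR : 0 ≤ R) :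
    ∑ d₁ ∈ (Finset.Icc 1 ⌊R⌋₊).filter Squarefree,
      ∑ d₂ ∈ (Finset.Icc 1 ⌊R⌋₊).filter Squarefree, f (Nat.lcm d₁ d₂) ≤
      ∑ q ∈ (Finset.Icc 1 ⌊R ^ 2⌋₊).filter Squarefree, 4 ^ q.primeFactors.card * f q := by
  set S := (Finset.Icc 1 ⌊R⌋₊).filter Squarefree with hS
  set T := (Finset.Icc 1 ⌊R ^ 2⌋₊).filter Squarefree with hT
  have hmaps : ∀ x ∈ S ×ˢ S, Nat.lcm x.1 x.2 ∈ T := by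
    rintro ⟨a, b⟩ hx
    simp only [hS, Finset.mem_product, Finset.mem_filter, Finset.mem_Icc] at hx
    simp only [hT, Finset.mem_filter, Finset.mem_Icc]
    refine ⟨⟨Nat.lcm_pos hx.1.1.1 hx.2.1.1, ?_⟩, squarefree_lcm hx.1.2 hx.2.2⟩
    refine (Nat.lcm_le_mul hx.1.1.1 hx.2.1.1).trans ?_
    apply Nat.le_floor
    rw [sq, Nat.cast_mul]
    exact mul_le_mul ((Nat.le_floor_iff hR).1 hx.1.1.2) ((Nat.le_floor_iff hR).1 hx.2.1.2)
      (Nat.cast_nonneg _) hR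
  rw [← Finset.sum_product', ← Finset.sum_fiberwise_of_maps_to hmaps]
  refine Finset.sum_le_sum fun q hq => ?_
  have hq' := (Finset.mem_filter.1 hq).2
  calc _ = ∑ x ∈ (S ×ˢ S).filter (fun x => Nat.lcm x.1 x.2 = q), f q :=
        Finset.sum_congr rfl fun x hx => by rw [(Finset.mem_filter.1 hx).2]
    _ = (((S ×ˢ S).filter (fun x => Nat.lcm x.1 x.2 = q)).card : ℝ) * f q := by
        rw [Finset.sum_const, nsmul_eq_mul]
    _ ≤ _ := by
        refine mul_le_mul_of_nonneg_right ?_ (hf q hq')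
        have hcard : ((S ×ˢ S).filter (fun x => Nat.lcm x.1 x.2 = q)).card ≤
            (q.divisors ×ˢ q.divisors).card := by
          refine Finset.card_le_card fun x hx => ?_
          have h := (Finset.mem_filter.1 hx).2
          rw [Finset.mem_product, Nat.mem_divisors, Nat.mem_divisors]
          exact ⟨⟨h ▸ Nat.dvd_lcm_left _ _, hq'.ne_zero⟩, ⟨h ▸ Nat.dvd_lcm_right _ _, hq'.ne_zero⟩⟩
        rw [Finset.card_product, card_divisors_of_squarefree hq', ← mul_pow] at hcard
        exact_mod_cast hcard

theorem le_two_pow_mul_totient {q : ℕ} (hq : Squarefree q) :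
    q ≤ 2 ^ q.primeFactors.card * q.totient := by
  have h := totient_prod_primes q.primeFactors fun p hp => Nat.prime_of_mem_primeFactors hp
  rw [Nat.prod_primeFactors_of_squarefree hq] at h
  rw [h, ← Finset.prod_const, ← Finset.prod_mul_distrib]
  nth_rewrite 1 [← Nat.prod_primeFactors_of_squarefree hq]
  refine Finset.prod_le_prod' fun p hp => ?_
  have := (Nat.prime_of_mem_primeFactors hp).two_le
  omega

end SquarefreeSums

section WeightedErrors

theorem one_le_log_of_three_le {X : ℕ} (hX : 3 ≤ X) : 1 ≤ Real.log X := by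
  have hX' : (3 : ℝ) ≤ X := by exact_mod_cast hX
  rw [Real.le_log_iff_exp_le (by linarith)]
  linarith [Real.exp_one_lt_d9]

theorem primeMaxAbs_le_of_squarefree {q X : ℕ} (hq : Squarefree q) (hX : 3 ≤ X)
    (hqX : q ≤ 2 * X) :
    primeMaxAbs q X ≤ 4 * X * Real.log X * (2 ^ q.primeFactors.card / q) := by
  have hq0 : 0 < q := Nat.pos_of_ne_zero hq.ne_zero
  have hq0' : (0 : ℝ) < q := by exact_mod_cast hq0
  have hL := one_le_log_of_three_le hX
  have hX0 : (0 : ℝ) ≤ X := Nat.cast_nonneg X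
  have hφ : (0 : ℝ) < q.totient := by exact_mod_cast Nat.totient_pos.2 hq0
  have h2 : (1 : ℝ) ≤ 2 ^ q.primeFactors.card := one_le_pow₀ one_le_two
  have hφ' : (q : ℝ) ≤ 2 ^ q.primeFactors.card * q.totient := by
    exact_mod_cast le_two_pow_mul_totient hq
  have h3 : (X : ℝ) / q.totient ≤ X * (2 ^ q.primeFactors.card / q) := by
    rw [mul_div_assoc', div_le_div_iff₀ hφ hq0', mul_assoc]
    exact mul_le_mul_of_nonneg_left hφ' hX0
  have h4 : (X : ℝ) / q + 1 ≤ 3 * (X / q) := by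
    have : (1 : ℝ) ≤ 2 * (X / q) := by
      rw [mul_div_assoc', le_div_iff₀ hq0', one_mul]
      exact_mod_cast hqX
    linarith
  have h5 : (X : ℝ) / q ≤ X * (2 ^ q.primeFactors.card / q) := by
    rw [mul_div_assoc']
    gcongr
    exact le_mul_of_one_le_right hX0 h2
  set Y := (X : ℝ) * (2 ^ q.primeFactors.card / q)
  have hY : 0 ≤ Y := by positivity
  calc _ ≤ _ := primeMaxAbs_le hq0 X
    _ ≤ 3 * Y * Real.log X + Y * Real.log X := by
        refine add_le_add (mul_le_mul_of_nonneg_right (by linarith) (by linarith)) ?_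
        exact h3.trans (le_mul_of_one_le_right hY hL)
    _ = _ := by ring

theorem PrimesLevel.sum_pow_mul_primeMaxAbs_le {ϑ δ : ℝ} (h : PrimesLevel ϑ) (hδ : 0 < δ)
    (b A : ℕ) : ∃ C : ℝ, 0 < C ∧ ∀ X Q : ℕ, 3 ≤ X → (Q : ℝ) ≤ (X : ℝ) ^ (ϑ - δ) → Q ≤ 2 * X →
      ∑ q ∈ (Finset.Icc 1 Q).filter Squarefree, (b : ℝ) ^ q.primeFactors.card * primeMaxAbs q X ≤
        C * X / Real.log X ^ A := by
  set B := 2 * b ^ 2 with hB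
  obtain ⟨C, hC0, hC⟩ := h δ hδ ((B + 1 + 2 * A : ℕ) : ℝ) (by positivity)
  refine ⟨4 * 3 ^ B + C, by positivity, fun X Q hX hQ hQX => ?_⟩
  have hL := one_le_log_of_three_le hX
  set L := Real.log X with hLdef
  have hL0 : 0 < L := by linarith
  have hX0 : (0 : ℝ) < X := by positivity
  have h1 := hC X (by omega)
  rw [Real.rpow_natCast] at h1
  have h2 : ∀ q ∈ (Finset.Icc 1 Q).filter Squarefree,
      (b : ℝ) ^ q.primeFactors.card * primeMaxAbs q X ≤
        4 * X * L / L ^ (B + 1 + A) * ((B : ℝ) ^ q.primeFactors.card / q) +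
          L ^ (B + 1 + A) * primeMaxAbs q X := by
    intro q hq
    rw [Finset.mem_filter, Finset.mem_Icc] at hq
    have h3 := primeMaxAbs_le_of_squarefree hq.2 hX (hq.1.2.trans hQX)
    have h4 := primeMaxAbs_nonneg hq.1.1 X
    set w := (b : ℝ) ^ q.primeFactors.card with hw
    set l := L ^ (B + 1 + A) with hl
    have hl0 : 0 < l := by positivity
    have hw2 : w ≤ w ^ 2 / l + l := by
      rw [div_add' _ _ _ hl0.ne', le_div_iff₀ hl0]
      nlinarith [sq_nonneg (w - l), sq_nonneg w, sq_nonneg l]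
    calc w * primeMaxAbs q X ≤ (w ^ 2 / l + l) * primeMaxAbs q X :=
          mul_le_mul_of_nonneg_right hw2 h4
      _ = w ^ 2 / l * primeMaxAbs q X + l * primeMaxAbs q X := by ring
      _ ≤ w ^ 2 / l * (4 * X * L * (2 ^ q.primeFactors.card / q)) + l * primeMaxAbs q X := by
          gcongr
      _ = _ := by
          have : ((B : ℕ) : ℝ) ^ q.primeFactors.card = w ^ 2 * 2 ^ q.primeFactors.card := by
            rw [hB, hw, Nat.cast_mul, mul_pow, ← pow_mul, mul_comm, mul_comm _ 2, pow_mul]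
            norm_num
          rw [this]
          ring
  have hlogQ : 1 + Real.log Q ≤ 3 * L := by
    rcases Nat.eq_zero_or_pos Q with rfl | hQ0
    · rw [Nat.cast_zero, Real.log_zero]; linarith
    · have : Real.log Q ≤ Real.log (2 * X) :=
        Real.log_le_log (by exact_mod_cast hQ0) (by exact_mod_cast hQX)
      rw [Real.log_mul two_ne_zero hX0.ne'] at this
      linarith [Real.log_two_lt_d9]
  have hlogQ0 : 0 ≤ 1 + Real.log Q := by linarith [Real.log_natCast_nonneg Q]
  have h5 : ∑ q ∈ (Finset.Icc 1 Q).filter Squarefree, primeMaxAbs q X ≤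
      C * X / L ^ (B + 1 + 2 * A) := by
    refine le_trans (Finset.sum_le_sum_of_subset_of_nonneg ?_ ?_) h1
    · refine (Finset.filter_subset _ _).trans (Finset.Icc_subset_Icc_right (Nat.le_floor hQ))
    · exact fun q hq _ => primeMaxAbs_nonneg (Finset.mem_Icc.1 hq).1 X
  calc _ ≤ _ := Finset.sum_le_sum h2
    _ = 4 * X * L / L ^ (B + 1 + A) *
          (∑ q ∈ (Finset.Icc 1 Q).filter Squarefree, (B : ℝ) ^ q.primeFactors.card / q) +
        L ^ (B + 1 + A) * ∑ q ∈ (Finset.Icc 1 Q).filter Squarefree, primeMaxAbs q X := by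
        rw [Finset.sum_add_distrib, Finset.mul_sum, Finset.mul_sum]
    _ ≤ 4 * X * L / L ^ (B + 1 + A) * (3 * L) ^ B +
        L ^ (B + 1 + A) * (C * X / L ^ (B + 1 + 2 * A)) := by
        gcongr
        exact (sum_squarefree_pow_div_le B Q).trans (pow_le_pow_left₀ hlogQ0 hlogQ B)
    _ = _ := by
        rw [mul_pow, two_mul, ← add_assoc, pow_add L (B + 1 + A) A, pow_add L (B + 1) A,
          pow_succ L B]
        field_simp
end WeightedErrors

section ResidueClassSums

theorem abs_sum_theta_class_sub_le {q N h₀ X₁ X₂ : ℕ} [NeZero q] (hN : 1 ≤ N)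
    (hX₁ : X₁ + 1 = N + h₀) (hX₂ : X₂ + 1 = 2 * N + h₀) {c : ZMod q} (hc : IsUnit (c + h₀)) :
    |(∑ n ∈ Finset.Ico N (2 * N), if (n : ZMod q) = c then theta (n + h₀) else 0) -
      N / q.totient| ≤ primeMaxAbs q X₂ + primeMaxAbs q X₁ := by
  have hq0 : 0 < q := Nat.pos_of_ne_zero (NeZero.ne q)
  set a := (c + h₀).val with ha
  have hac : a.Coprime q := by
    obtain ⟨u, hu⟩ := hc
    rw [ha, ← hu]
    exact ZMod.val_coe_unit_coprime u
  have hmod : ∀ n : ℕ, (n : ZMod q) = c ↔ (n + h₀) % q = a % q := by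
    intro n
    rw [← ZMod.natCast_eq_natCast_iff', ha, ZMod.natCast_zmod_val, Nat.cast_add,
      add_left_inj]
  have h1 : (∑ n ∈ Finset.Ico N (2 * N), if (n : ZMod q) = c then theta (n + h₀) else 0) =
      (∑ p ∈ Finset.Icc 1 X₂, if p.Prime ∧ p % q = a % q then Real.log p else 0) -
        ∑ p ∈ Finset.Icc 1 X₁, if p.Prime ∧ p % q = a % q then Real.log p else 0 := by
    set G : ℕ → ℝ := fun p => if p.Prime ∧ p % q = a % q then Real.log p else 0
    rw [← Finset.Ico_add_one_right_eq_Icc, ← Finset.Ico_add_one_right_eq_Icc, eq_sub_iff_add_eq',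
      ← Finset.sum_Ico_consecutive G (Nat.le_add_left 1 X₁) (show X₁ + 1 ≤ X₂ + 1 by omega), hX₁,
      hX₂, ← Finset.sum_Ico_add']
    congr 1
    refine Finset.sum_congr rfl fun n _ => ?_
    simp only [G, theta, hmod]
    by_cases h1 : (n + h₀).Prime <;> by_cases h2 : (n + h₀) % q = a % q <;> simp [h1, h2]
  have h2 : (N : ℝ) / q.totient = X₂ / q.totient - X₁ / q.totient := by
    have e1 : (X₁ : ℝ) + 1 = N + h₀ := by exact_mod_cast hX₁
    have e2 : (X₂ : ℝ) + 1 = 2 * N + h₀ := by exact_mod_cast hX₂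
    rw [← sub_div]
    congr 1
    linarith
  rw [h1, h2, sub_sub_sub_comm]
  exact (abs_sub _ _).trans (add_le_add (le_primeMaxAbs hq0 X₂ hac) (le_primeMaxAbs hq0 X₁ hac))

theorem abs_sum_theta_dvd_sub_le (H : Finset ℕ) {q N h₀ X₁ X₂ : ℕ} (hq : 0 < q) (hN : 1 ≤ N)
    (hX₁ : X₁ + 1 = N + h₀) (hX₂ : X₂ + 1 = 2 * N + h₀)
    (hqN : ∀ p, p.Prime → p ∣ q → p < N) :
    |(∑ n ∈ Finset.Ico N (2 * N), if q ∣ ∏ h ∈ H, (n + h) then theta (n + h₀) else 0) -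
      N * ((nuStar H h₀ q : ℝ) / q.totient)| ≤
      nuStar H h₀ q * (primeMaxAbs q X₂ + primeMaxAbs q X₁) := by
  classical
  have : NeZero q := ⟨hq.ne'⟩
  set S : Finset (ZMod q) :=
    Finset.univ.filter fun c => ∏ h ∈ H, (c + h) = 0 ∧ IsUnit (c + h₀) with hS
  have hcard : nuStar H h₀ q = S.card := by
    rw [nuStar, Nat.card_eq_fintype_card, Fintype.card_subtype]
  have h1 : ∀ n ∈ Finset.Ico N (2 * N),
      (if q ∣ ∏ h ∈ H, (n + h) then theta (n + h₀) else 0) =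
        ∑ c ∈ S, if (n : ZMod q) = c then theta (n + h₀) else 0 := by
    intro n hn
    rw [Finset.mem_Ico] at hn
    have hdvd : q ∣ ∏ h ∈ H, (n + h) ↔ ∏ h ∈ H, ((n : ZMod q) + h) = 0 := by
      rw [← ZMod.natCast_eq_zero_iff]
      push_cast
      rfl
    rw [Finset.sum_ite_eq]
    simp only [hS, Finset.mem_filter, Finset.mem_univ, true_and, ← hdvd]
    by_cases hp : (n + h₀).Prime
    · have hu : IsUnit ((n : ZMod q) + h₀) := by
        have : ((n + h₀ : ℕ) : ZMod q) = (n : ZMod q) + h₀ := by push_cast; rfl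
        rw [← this, ZMod.isUnit_iff_coprime, hp.coprime_iff_not_dvd]
        intro hd
        have := hqN _ hp hd
        omega
      simp [hu]
    · simp [theta, hp]
  rw [Finset.sum_congr rfl h1, Finset.sum_comm, hcard,
    show (N : ℝ) * ((S.card : ℝ) / q.totient) = ∑ c ∈ S, (N : ℝ) / q.totient by
      rw [Finset.sum_const, nsmul_eq_mul]; ring, ← Finset.sum_sub_distrib]
  refine (Finset.abs_sum_le_sum_abs _ _).trans ?_
  rw [← nsmul_eq_mul]
  refine Finset.sum_le_card_nsmul _ _ _ fun c hc => ?_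
  exact abs_sum_theta_class_sub_le hN hX₁ hX₂ (Finset.mem_filter.1 hc).2.2

end ResidueClassSums

section Reduction

theorem LambdaR_mul_LambdaR_mul (R : ℝ) (n : ℕ) (H : Finset ℕ) (l₁ l₂ : ℕ) (t : ℝ) :
    LambdaR R n H l₁ * LambdaR R n H l₂ * t =
      ∑ d₁ ∈ Finset.Icc 1 ⌊R⌋₊, ∑ d₂ ∈ Finset.Icc 1 ⌊R⌋₊,
        (ArithmeticFunction.moebius d₁ : ℝ) * (ArithmeticFunction.moebius d₂ : ℝ) *
          ((Real.log (R / d₁) ^ (H.card + l₁) / (H.card + l₁).factorial) *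
            (Real.log (R / d₂) ^ (H.card + l₂) / (H.card + l₂).factorial) *
            if Nat.lcm d₁ d₂ ∣ ∏ h ∈ H, (n + h) then t else 0) := by
  rw [LambdaR, LambdaR, Finset.mul_sum, Finset.mul_sum, Finset.sum_mul_sum, Finset.sum_mul]
  refine Finset.sum_congr rfl fun d₁ _ => ?_
  rw [Finset.sum_mul]
  refine Finset.sum_congr rfl fun d₂ _ => ?_
  have hd : Nat.lcm d₁ d₂ ∣ ∏ h ∈ H, (n + h) ↔ d₁ ∣ ∏ h ∈ H, (n + h) ∧ d₂ ∣ ∏ h ∈ H, (n + h) :=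
    Nat.lcm_dvd_iff
  by_cases h1 : d₁ ∣ ∏ h ∈ H, (n + h)
  · by_cases h2 : d₂ ∣ ∏ h ∈ H, (n + h)
    · rw [if_pos h1, if_pos h2, if_pos (hd.2 ⟨h1, h2⟩)]
      ring
    · rw [if_neg h2, if_neg fun h => h2 (hd.1 h).2]
      ring
  · rw [if_neg h1, if_neg fun h => h1 (hd.1 h).1]
    ring

theorem abs_log_div_pow_div_factorial_le {R : ℝ} {d : ℕ} (hd : d ∈ Finset.Icc 1 ⌊R⌋₊) (j : ℕ) :
    |Real.log (R / d) ^ j / j.factorial| ≤ Real.log R ^ j := by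
  rw [Finset.mem_Icc] at hd
  have hd1 : (1 : ℝ) ≤ d := by exact_mod_cast hd.1
  have hdR : (d : ℝ) ≤ R := (Nat.le_floor_iff' (by omega)).1 hd.2
  have h0 : 0 ≤ Real.log (R / d) := Real.log_nonneg (by rwa [one_le_div (by linarith)])
  have h1 : Real.log (R / d) ≤ Real.log R :=
    Real.log_le_log (by apply div_pos <;> linarith) (div_le_self (by linarith) hd1)
  rw [abs_of_nonneg (by positivity)]
  refine (div_le_self (by positivity) ?_).trans (pow_le_pow_left₀ h0 h1 j)
  exact_mod_cast j.factorial_pos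

theorem abs_moebius_le_one_real (d : ℕ) : |(ArithmeticFunction.moebius d : ℝ)| ≤ 1 := by
  exact_mod_cast ArithmeticFunction.abs_moebius_le_one (n := d)

theorem abs_sum_LambdaR_mul_LambdaR_sub_le {H : Finset ℕ} {h₀ : ℕ} (hh₀ : h₀ ∈ H) (l₁ l₂ : ℕ)
    {N X₁ X₂ : ℕ} {R : ℝ} (hR : 1 ≤ R) (hRN : R < N)
    (hX₁ : X₁ + 1 = N + h₀) (hX₂ : X₂ + 1 = 2 * N + h₀) :
    |(∑ n ∈ Finset.Ico N (2 * N), LambdaR R n H l₁ * LambdaR R n H l₂ * theta (n + h₀)) -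
      N * ∑ d₁ ∈ Finset.Icc 1 ⌊R⌋₊, ∑ d₂ ∈ Finset.Icc 1 ⌊R⌋₊,
        (ArithmeticFunction.moebius d₁ : ℝ) * (ArithmeticFunction.moebius d₂ : ℝ) *
          ((Real.log (R / d₁) ^ (H.card + l₁) / (H.card + l₁).factorial) *
            (Real.log (R / d₂) ^ (H.card + l₂) / (H.card + l₂).factorial) *
            ∏ p ∈ (Nat.lcm d₁ d₂).primeFactors, (nuStar H h₀ p : ℝ) / ((p : ℝ) - 1))| ≤
      Real.log R ^ (H.card + l₁) * Real.log R ^ (H.card + l₂) *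
        ∑ q ∈ (Finset.Icc 1 ⌊R ^ 2⌋₊).filter Squarefree,
          ((4 * H.card : ℕ) : ℝ) ^ q.primeFactors.card * (primeMaxAbs q X₂ + primeMaxAbs q X₁) := by
  have hN : 1 ≤ N := by
    have : (0 : ℝ) < N := by linarith
    exact_mod_cast this
  have hlog : 0 ≤ Real.log R := Real.log_nonneg hR
  set f : ℕ → ℝ := fun q =>
    (H.card : ℝ) ^ q.primeFactors.card * (primeMaxAbs q X₂ + primeMaxAbs q X₁) with hf
  have hf0 : ∀ q, Squarefree q → 0 ≤ f q := fun q hq => by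
    have h1 := primeMaxAbs_nonneg (Nat.pos_of_ne_zero hq.ne_zero) X₁
    have h2 := primeMaxAbs_nonneg (Nat.pos_of_ne_zero hq.ne_zero) X₂
    positivity
  set L := Real.log R ^ (H.card + l₁) * Real.log R ^ (H.card + l₂) with hL
  have hL0 : 0 ≤ L := by positivity
  simp only [LambdaR_mul_LambdaR_mul]
  rw [Finset.sum_comm, Finset.mul_sum, ← Finset.sum_sub_distrib]
  calc _ ≤ ∑ d₁ ∈ Finset.Icc 1 ⌊R⌋₊, ∑ d₂ ∈ Finset.Icc 1 ⌊R⌋₊,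
        if Squarefree d₁ ∧ Squarefree d₂ then L * f (Nat.lcm d₁ d₂) else 0 := by
        refine (Finset.abs_sum_le_sum_abs _ _).trans (Finset.sum_le_sum fun d₁ hd₁ => ?_)
        rw [Finset.sum_comm, Finset.mul_sum, ← Finset.sum_sub_distrib]
        refine (Finset.abs_sum_le_sum_abs _ _).trans (Finset.sum_le_sum fun d₂ hd₂ => ?_)
        split_ifs with hsq
        · have hlcm := squarefree_lcm hsq.1 hsq.2
          have hpN : ∀ p, p.Prime → p ∣ Nat.lcm d₁ d₂ → p < N := by
            intro p hp hd
            have hle : p ≤ ⌊R⌋₊ := by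
              rcases (hp.dvd_mul).1 (hd.trans (Nat.lcm_dvd_mul d₁ d₂)) with h | h
              · exact (Nat.le_of_dvd (Finset.mem_Icc.1 hd₁).1 h).trans (Finset.mem_Icc.1 hd₁).2
              · exact (Nat.le_of_dvd (Finset.mem_Icc.1 hd₂).1 h).trans (Finset.mem_Icc.1 hd₂).2
            have h1 : (p : ℝ) ≤ R := (Nat.le_floor_iff' hp.ne_zero).1 hle
            exact_mod_cast h1.trans_lt hRN
          have hmain := abs_sum_theta_dvd_sub_le H (Nat.pos_of_ne_zero hlcm.ne_zero) hN hX₁ hX₂ hpN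
          have hν : ((nuStar H h₀ (Nat.lcm d₁ d₂) : ℕ) : ℝ) ≤
              (H.card : ℝ) ^ (Nat.lcm d₁ d₂).primeFactors.card := by
            exact_mod_cast nuStar_le_pow H hh₀ hlcm
          have h1 := primeMaxAbs_nonneg (Nat.pos_of_ne_zero hlcm.ne_zero) X₁
          have h2 := primeMaxAbs_nonneg (Nat.pos_of_ne_zero hlcm.ne_zero) X₂
          rw [nuStar_div_totient H h₀ hlcm] at hmain
          rw [← Finset.mul_sum, ← Finset.mul_sum, mul_left_comm (N : ℝ), mul_left_comm (N : ℝ),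
            ← mul_sub, ← mul_sub, abs_mul, abs_mul, abs_mul]
          have hc : |Real.log (R / d₁) ^ (H.card + l₁) / (H.card + l₁).factorial *
              (Real.log (R / d₂) ^ (H.card + l₂) / (H.card + l₂).factorial)| ≤ L := by
            rw [abs_mul]
            exact mul_le_mul (abs_log_div_pow_div_factorial_le hd₁ _)
              (abs_log_div_pow_div_factorial_le hd₂ _) (abs_nonneg _) (by positivity)
          have hμ : |(ArithmeticFunction.moebius d₁ : ℝ)| * |(ArithmeticFunction.moebius d₂ : ℝ)| ≤
              1 := mul_le_one₀ (abs_moebius_le_one_real _) (abs_nonneg _)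
                (abs_moebius_le_one_real _)
          refine (mul_le_of_le_one_left (by positivity) hμ).trans ?_
          refine mul_le_mul hc (hmain.trans ?_) (abs_nonneg _) hL0
          exact mul_le_mul_of_nonneg_right hν (by positivity)
        · rw [not_and_or] at hsq
          have hμ : (ArithmeticFunction.moebius d₁ : ℝ) * (ArithmeticFunction.moebius d₂ : ℝ) = 0 := by
            rcases hsq with h | h
            · rw [ArithmeticFunction.moebius_eq_zero_of_not_squarefree h, Int.cast_zero, zero_mul]
            · rw [ArithmeticFunction.moebius_eq_zero_of_not_squarefree h, Int.cast_zero, mul_zero]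
          simp [hμ]
    _ = L * ∑ d₁ ∈ (Finset.Icc 1 ⌊R⌋₊).filter Squarefree,
          ∑ d₂ ∈ (Finset.Icc 1 ⌊R⌋₊).filter Squarefree, f (Nat.lcm d₁ d₂) := by
        rw [Finset.mul_sum, Finset.sum_filter]
        refine Finset.sum_congr rfl fun d₁ _ => ?_
        by_cases h1 : Squarefree d₁
        · simp only [h1, true_and, if_true]
          rw [Finset.mul_sum, Finset.sum_filter]
        · simp [h1]
    _ ≤ L * ∑ q ∈ (Finset.Icc 1 ⌊R ^ 2⌋₊).filter Squarefree, 4 ^ q.primeFactors.card * f q :=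
        mul_le_mul_of_nonneg_left (sum_sum_lcm_le f hf0 R (by linarith)) hL0
    _ = _ := by
        congr 1
        refine Finset.sum_congr rfl fun q _ => ?_
        rw [hf, Nat.cast_mul, mul_pow]
        simp only [Nat.cast_ofNat]
        ring

end Reduction

section ShortErrors

theorem PrimesLevel.eventually_sum_pow_mul_primeMaxAbs_le {ϑ ε : ℝ} (h : PrimesLevel ϑ)
    (hε : 0 < ε) (hϑ : 0 < ϑ - ε) (b A : ℕ) :
    ∃ C : ℝ, ∀ᶠ N : ℕ in atTop, ∀ Q X : ℕ, (Q : ℝ) ≤ (N : ℝ) ^ (ϑ - ε) → N ≤ X + 1 → X ≤ 3 * N →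
      ∑ q ∈ (Finset.Icc 1 Q).filter Squarefree, (b : ℝ) ^ q.primeFactors.card * primeMaxAbs q X ≤
        C * N / Real.log N ^ A := by
  obtain ⟨C, hC0, hC⟩ := h.sum_pow_mul_primeMaxAbs_le (half_pos hε) b A
  refine ⟨C * 3 * 2 ^ A, ?_⟩
  have hlim : Tendsto (fun N : ℕ => (N : ℝ) ^ (ε / 2)) atTop atTop :=
    (tendsto_rpow_atTop (half_pos hε)).comp tendsto_natCast_atTop_atTop
  filter_upwards [hlim.eventually_ge_atTop (2 ^ (ϑ - ε / 2)), eventually_ge_atTop 4] with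
    N hN hN4 Q X hQ hNX hXN
  have hN4' : (4 : ℝ) ≤ N := by exact_mod_cast hN4
  have hN0 : (0 : ℝ) < N := by linarith
  have hNX' : (N : ℝ) ≤ X + 1 := by exact_mod_cast hNX
  have hXN' : (X : ℝ) ≤ 3 * N := by exact_mod_cast hXN
  have hX2 : (N : ℝ) / 2 ≤ X := by linarith
  have hQX : (Q : ℝ) ≤ (X : ℝ) ^ (ϑ - ε / 2) := by
    refine hQ.trans (le_trans ?_ (Real.rpow_le_rpow (by positivity) hX2 (by linarith)))
    rw [Real.div_rpow hN0.le two_pos.le, le_div_iff₀ (by positivity),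
      show ϑ - ε / 2 = (ϑ - ε) + ε / 2 by ring, Real.rpow_add hN0]
    gcongr
    convert hN using 2
    ring
  have hQ2 : Q ≤ 2 * X := by
    have h1 : (N : ℝ) ^ (ϑ - ε) ≤ N := by
      conv_rhs => rw [← Real.rpow_one (N : ℝ)]
      exact Real.rpow_le_rpow_of_exponent_le (by linarith) (h.sub_le_one hε)
    have h2 : (Q : ℝ) ≤ ((2 * X : ℕ) : ℝ) := by
      push_cast
      linarith
    exact_mod_cast h2
  have hlogX : Real.log N / 2 ≤ Real.log X := by
    have h1 : Real.log N ≤ Real.log ((X : ℝ) ^ 2) := by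
      apply Real.log_le_log hN0
      nlinarith
    rw [Real.log_pow] at h1
    push_cast at h1
    linarith
  have hlogN : 0 < Real.log N := Real.log_pos (by linarith)
  refine (hC X Q (by omega) hQX hQ2).trans ?_
  calc C * X / Real.log X ^ A ≤ C * (3 * N) / (Real.log N / 2) ^ A := by gcongr
    _ = _ := by
      rw [div_pow]
      field_simp

end ShortErrors

section MainTerm

open Topology

theorem tendsto_sum_moebius_mul_log_pow_nuStar {ϑ : ℝ} (hprimes : PrimesLevel ϑ) (hϑ : 0 < ϑ)
    {H : Finset ℕ} {h₀ : ℕ} (hh₀ : h₀ ∈ H) (l₁ l₂ : ℕ) :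
    Tendsto (fun R : ℝ => (∑ d₁ ∈ Finset.Icc 1 ⌊R⌋₊, ∑ d₂ ∈ Finset.Icc 1 ⌊R⌋₊,
      (ArithmeticFunction.moebius d₁ : ℝ) * (ArithmeticFunction.moebius d₂ : ℝ) *
        ((Real.log (R / d₁) ^ (H.card + l₁) / (H.card + l₁).factorial) *
          (Real.log (R / d₂) ^ (H.card + l₂) / (H.card + l₂).factorial) *
          ∏ p ∈ (Nat.lcm d₁ d₂).primeFactors, (nuStar H h₀ p : ℝ) / ((p : ℝ) - 1))) /
        Real.log R ^ (H.card + l₁ + l₂ + 1)) atTop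
      (𝓝 (singSeries H *
        ((l₁ + l₂ + 2).choose (l₁ + 1) / (H.card + l₁ + l₂ + 1).factorial))) := by
  obtain ⟨C, hC⟩ := abs_nuStar_div_sub_le hh₀
  have hk : 0 < H.card := Finset.card_pos.2 ⟨h₀, hh₀⟩
  have h := tendsto_sum_moebius_mul_log_pow
    (exists_norm_inv_zeta_le (hprimes.abs_theta_sub_le hϑ)) (κ := H.card - 1)
    (Nat.le_add_left 1 l₁) (Nat.le_add_left 1 l₂)
    (g := fun p => (nuStar H h₀ p : ℝ) / ((p : ℝ) - 1)) (D := 2 * H.card)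
    (fun p hp => by
      rw [abs_of_nonneg (nuStar_div_nonneg hp)]
      exact nuStar_div_le hp hh₀) hC
  rw [tprod_nuStar_eq_singSeries hh₀, show H.card - 1 + (l₁ + 1) = H.card + l₁ by omega,
    show H.card - 1 + (l₂ + 1) = H.card + l₂ by omega,
    show H.card + l₁ + (l₂ + 1) = H.card + l₁ + l₂ + 1 by omega,
    show l₁ + 1 + (l₂ + 1) = l₁ + l₂ + 2 by omega] at h
  exact h

theorem PrimesLevel.eventually_abs_sum_LambdaR_sub_le {ϑ ε : ℝ} (hprimes : PrimesLevel ϑ)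
    (hε : 0 < ε) (hϑ : 0 < ϑ - ε) {H : Finset ℕ} {h₀ : ℕ} (hh₀ : h₀ ∈ H) (l₁ l₂ : ℕ) {R : ℕ → ℝ}
    (hR : ∀ N : ℕ, 2 ≤ N → R N ≤ (N : ℝ) ^ ((ϑ - ε) / 2)) (hRtop : Tendsto R atTop atTop) :
    ∃ C : ℝ, ∀ᶠ N : ℕ in atTop,
      |((N : ℝ)⁻¹ * ∑ n ∈ Finset.Ico N (2 * N),
          LambdaR (R N) n H l₁ * LambdaR (R N) n H l₂ * theta (n + h₀)) /
        Real.log (R N) ^ (H.card + l₁ + l₂ + 1) -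
      (∑ d₁ ∈ Finset.Icc 1 ⌊R N⌋₊, ∑ d₂ ∈ Finset.Icc 1 ⌊R N⌋₊,
        (ArithmeticFunction.moebius d₁ : ℝ) * (ArithmeticFunction.moebius d₂ : ℝ) *
          ((Real.log (R N / d₁) ^ (H.card + l₁) / (H.card + l₁).factorial) *
            (Real.log (R N / d₂) ^ (H.card + l₂) / (H.card + l₂).factorial) *
            ∏ p ∈ (Nat.lcm d₁ d₂).primeFactors, (nuStar H h₀ p : ℝ) / ((p : ℝ) - 1))) /
        Real.log (R N) ^ (H.card + l₁ + l₂ + 1)| ≤ C / Real.log N := by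
  obtain ⟨C, hC⟩ := hprimes.eventually_sum_pow_mul_primeMaxAbs_le hε hϑ (4 * H.card) H.card
  have hk : 0 < H.card := Finset.card_pos.2 ⟨h₀, hh₀⟩
  refine ⟨2 * C, ?_⟩
  filter_upwards [hC, hRtop.eventually_ge_atTop 2, eventually_ge_atTop (h₀ + 2)] with N hN hR2 hNh
  have hN2 : (2 : ℝ) ≤ N := by exact_mod_cast (show 2 ≤ N by omega)
  have hN0 : (0 : ℝ) < N := by linarith
  have hRsq : R N ^ 2 ≤ (N : ℝ) ^ (ϑ - ε) := by
    have h1 := pow_le_pow_left₀ (by linarith) (hR N (by omega)) 2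
    rwa [← Real.rpow_mul_natCast hN0.le, Nat.cast_ofNat, div_mul_cancel₀ _ two_ne_zero] at h1
  have hRsqN : R N ^ 2 ≤ N := by
    refine hRsq.trans ?_
    conv_rhs => rw [← Real.rpow_one (N : ℝ)]
    exact Real.rpow_le_rpow_of_exponent_le (by linarith) (hprimes.sub_le_one hε)
  have hRN : R N < N := by nlinarith
  have hQ : ((⌊R N ^ 2⌋₊ : ℕ) : ℝ) ≤ (N : ℝ) ^ (ϑ - ε) :=
    (Nat.floor_le (by positivity)).trans hRsq
  have hX₁ : N + h₀ - 1 + 1 = N + h₀ := by omega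
  have hX₂ : 2 * N + h₀ - 1 + 1 = 2 * N + h₀ := by omega
  have hmain := abs_sum_LambdaR_mul_LambdaR_sub_le hh₀ l₁ l₂ (by linarith) hRN hX₁ hX₂
  have hS₁ := hN _ _ hQ (show N ≤ N + h₀ - 1 + 1 by omega) (by omega)
  have hS₂ := hN _ _ hQ (show N ≤ 2 * N + h₀ - 1 + 1 by omega) (by omega)
  simp only [mul_add, Finset.sum_add_distrib] at hmain
  have hlogR : 0 < Real.log (R N) := Real.log_pos (by linarith)
  have hlogN : Real.log (R N) ≤ Real.log N := Real.log_le_log (by linarith) hRN.le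
  have hlogN0 : 0 < Real.log N := hlogR.trans_le hlogN
  have hL : 0 ≤ Real.log (R N) ^ (H.card + l₁) * Real.log (R N) ^ (H.card + l₂) := by positivity
  have hCN : 0 ≤ C * N / Real.log N ^ H.card := by
    refine le_trans (Finset.sum_nonneg fun q hq => ?_) hS₁
    have := primeMaxAbs_nonneg (Finset.mem_Icc.1 (Finset.mem_filter.1 hq).1).1 (N + h₀ - 1)
    positivity
  have hle := mul_le_mul_of_nonneg_left (add_le_add hS₂ hS₁) hL
  rw [mul_add (_ * _) (Finset.sum _ _)] at hle
  have hbound := hmain.trans hle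
  obtain ⟨j, hj⟩ : ∃ j, H.card = j + 1 := ⟨H.card - 1, by omega⟩
  generalize (∑ d₁ ∈ Finset.Icc 1 ⌊R N⌋₊, ∑ d₂ ∈ Finset.Icc 1 ⌊R N⌋₊,
    (ArithmeticFunction.moebius d₁ : ℝ) * (ArithmeticFunction.moebius d₂ : ℝ) *
      ((Real.log (R N / d₁) ^ (H.card + l₁) / (H.card + l₁).factorial) *
        (Real.log (R N / d₂) ^ (H.card + l₂) / (H.card + l₂).factorial) *
        ∏ p ∈ (Nat.lcm d₁ d₂).primeFactors, (nuStar H h₀ p : ℝ) / ((p : ℝ) - 1))) = T at *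
  generalize (∑ n ∈ Finset.Ico N (2 * N),
    LambdaR (R N) n H l₁ * LambdaR (R N) n H l₂ * theta (n + h₀)) = U at *
  generalize Real.log (R N) = L at *
  have h1 : (N : ℝ)⁻¹ * U / L ^ (H.card + l₁ + l₂ + 1) - T / L ^ (H.card + l₁ + l₂ + 1) =
      (U - N * T) / (N * L ^ (H.card + l₁ + l₂ + 1)) := by
    field_simp
  rw [h1, abs_div, abs_of_pos (show 0 < (N : ℝ) * L ^ (H.card + l₁ + l₂ + 1) by positivity),
    div_le_iff₀ (by positivity)]
  refine hbound.trans ?_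
  have hC0 : 0 ≤ C := by
    by_contra! hlt
    have : C * N / Real.log N ^ H.card < 0 :=
      div_neg_of_neg_of_pos (mul_neg_of_neg_of_pos hlt hN0) (by positivity)
    linarith
  have h2 : L ^ j ≤ Real.log N ^ j := pow_le_pow_left₀ hlogR.le hlogN j
  calc L ^ (H.card + l₁) * L ^ (H.card + l₂) *
        (C * N / Real.log N ^ H.card + C * N / Real.log N ^ H.card) =
      2 * C * N * L ^ (H.card + l₁ + l₂ + 1) / Real.log N ^ H.card * L ^ j := by
        rw [hj]; ring
    _ ≤ 2 * C * N * L ^ (H.card + l₁ + l₂ + 1) / Real.log N ^ H.card * Real.log N ^ j := by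
        gcongr
    _ = _ := by
        rw [hj]
        field_simp
        ring

end MainTerm

/-- **Lemma 2 (GPY Proposition 2).** Assuming the primes have distribution level `ϑ`,
for `R ≤ N^{(ϑ-ε)/2}`, `R → ∞`, and `h₀ ∈ H`,
`(1/N) ∑_{n ~ N} Λ_R(n; H, l₁) Λ_R(n; H, l₂) θ(n + h₀)
  = (𝔖(H) + o(1)) C(l₁+l₂+2, l₁+1) (log R)^{k+l₁+l₂+1}/(k+l₁+l₂+1)!`. -/
theorem lambda_squared_theta_average (k l₁ l₂ : ℕ) (H : Finset ℕ) (hH : H.card = k)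
    (h₀ : ℕ) (hh₀ : h₀ ∈ H) (ϑ ε : ℝ) (hε : 0 < ε) (hprimes : PrimesLevel ϑ) :
    ∀ R : ℕ → ℝ,
      (∀ N : ℕ, 2 ≤ N → R N ≤ (N : ℝ) ^ ((ϑ - ε) / 2)) →
      Tendsto R atTop atTop →
      Tendsto
        (fun N : ℕ =>
          ((N : ℝ)⁻¹ * ∑ n ∈ Finset.Ico N (2 * N),
              LambdaR (R N) n H l₁ * LambdaR (R N) n H l₂ * theta (n + h₀)) /
            (Real.log (R N) ^ (k + l₁ + l₂ + 1) / (k + l₁ + l₂ + 1).factorial))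
        atTop (nhds (singSeries H * ((l₁ + l₂ + 2).choose (l₁ + 1)))) := by
  intro R hR hRtop
  subst hH
  have hϑ : 0 < ϑ - ε := by
    obtain ⟨N, hN, hN2⟩ := ((hRtop.eventually_ge_atTop 2).and (eventually_ge_atTop 2)).exists
    by_contra! hle
    have h1 : (N : ℝ) ^ ((ϑ - ε) / 2) ≤ 1 :=
      Real.rpow_le_one_of_one_le_of_nonpos (by exact_mod_cast (show 1 ≤ N by omega)) (by linarith)
    linarith [hR N hN2]
  have hmain := (tendsto_sum_moebius_mul_log_pow_nuStar hprimes (by linarith) hh₀ l₁ l₂).comp hRtop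
  obtain ⟨C, hC⟩ := hprimes.eventually_abs_sum_LambdaR_sub_le hε hϑ hh₀ l₁ l₂ hR hRtop
  have hlog : Tendsto (fun N : ℕ => C / Real.log (N : ℝ)) atTop (nhds 0) :=
    (Real.tendsto_log_atTop.comp tendsto_natCast_atTop_atTop).const_div_atTop C
  have herr := squeeze_zero_norm' (hC.mono fun N hN => by rwa [Real.norm_eq_abs]) hlog
  have hsum := (hmain.add herr).mul_const ((H.card + l₁ + l₂ + 1).factorial : ℝ)
  have hK : ((H.card + l₁ + l₂ + 1).factorial : ℝ) ≠ 0 := by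
    exact_mod_cast (Nat.factorial_pos _).ne'
  rw [add_zero, mul_assoc, div_mul_cancel₀ _ hK] at hsum
  refine hsum.congr fun N => ?_
  rw [Function.comp_apply, add_sub_cancel, div_div_eq_mul_div, div_mul_eq_mul_div]
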